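/- For every integer d ≥ 3 there is a constant C = C(d) with the following property. Let H be a finite collection of n hyperplanes in ℝ^d equipped with a weight function w : H → ℝ_{≥0} with total weight w(H) = ∑_{h∈H} w(h) > 0, let r be a real number with 2 ≤ r ≤ n, and let K₀ ⊆ ℝ^d be a convex set with frontier σ. Then there exists a finite family Ξ of at most C·r^{d−1}·log₂ r closed convex sets, each a nonempty intersection of at most d+1 closed halfspaces, with pairwise disjoint interiors, such that: (a) the union of the members of Ξ contains every connected component of ℝ^d ∖ ⋃H whose closure meets σ, and (b) for each Δ ∈ Ξ, the total weight of the hyperplanes of H that intersect the interior of Δ is at most w(H)/r. -/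

import Mathlib

open scoped RealInnerProductSpace
open scoped Classical

noncomputable section

/-- A closed halfspace in `ℝ^d`. -/
def halfspace {d : ℕ} (a : EuclideanSpace ℝ (Fin d)) (b : ℝ) : Set (EuclideanSpace ℝ (Fin d)) :=
  {x | ⟪x, a⟫ ≤ b}

/-- A hyperplane in `ℝ^d`. -/
def hyperplane {d : ℕ} (a : EuclideanSpace ℝ (Fin d)) (b : ℝ) : Set (EuclideanSpace ℝ (Fin d)) :=
  {x | ⟪x, a⟫ = b}

/-- A point `p` of a finite set `P` is `k`-shallow if some closed halfspace contains `p`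
and at most `k` points of `P` (including `p`). -/
def IsShallowPt {d : ℕ} (P : Finset (EuclideanSpace ℝ (Fin d))) (k : ℕ)
    (p : EuclideanSpace ℝ (Fin d)) : Prop :=
  ∃ a b, a ≠ 0 ∧ p ∈ halfspace a b ∧
    ((P : Set (EuclideanSpace ℝ (Fin d))) ∩ halfspace a b).ncard ≤ k

/-- `P` is in general position: no `d+1` points of `P` lie on a common hyperplane. -/
def GenPos {d : ℕ} (P : Finset (EuclideanSpace ℝ (Fin d))) : Prop :=
  ∀ (a : EuclideanSpace ℝ (Fin d)) (b : ℝ), a ≠ 0 →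
    ((P : Set (EuclideanSpace ℝ (Fin d))) ∩ hyperplane a b).ncard ≤ d

namespace ZoneCutting

/-! ### Cubes in set families of bounded Vapnik–Chervonenkis dimension -/

section Cubes

variable {α : Type*}

/-- The pairs `(J, t)` with `J ⊆ U`, `|J| = j`, such that all modifications of `t` inside `J`
belong to the family. -/
def cubes (U : Finset α) (𝓕 : Finset (Finset α)) (j : ℕ) : Finset (Finset α × Finset α) :=
  (U.powerset ×ˢ 𝓕).filter fun q => q.1.card = j ∧ ∀ S ⊆ q.1, symmDiff q.2 S ∈ 𝓕

theorem mem_cubes {U : Finset α} {𝓕 : Finset (Finset α)} {j : ℕ} {q : Finset α × Finset α} :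
    q ∈ cubes U 𝓕 j ↔ q.1 ⊆ U ∧ q.1.card = j ∧ ∀ S ⊆ q.1, symmDiff q.2 S ∈ 𝓕 := by
  constructor
  · intro h
    simp only [cubes, Finset.mem_filter, Finset.mem_product, Finset.mem_powerset] at h
    exact ⟨h.1.1, h.2⟩
  · intro h
    have h0 := h.2.2 ∅ (by simp)
    rw [← Finset.bot_eq_empty, symmDiff_bot] at h0
    simp only [cubes, Finset.mem_filter, Finset.mem_product, Finset.mem_powerset]
    exact ⟨⟨h.1, h0⟩, h.2⟩

theorem card_cubes_zero (U : Finset α) (𝓕 : Finset (Finset α)) :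
    (cubes U 𝓕 0).card = 𝓕.card := by
  refine (Finset.card_bij' (fun q _ => q.2) (fun t _ => (∅, t)) ?_ ?_ ?_ ?_)
  · intro q hq
    have h0 := (mem_cubes.1 hq).2.2 ∅ (by simp)
    rwa [← Finset.bot_eq_empty, symmDiff_bot] at h0
  · intro t ht
    rw [mem_cubes]
    refine ⟨by simp, by simp, fun S hS => ?_⟩
    have : S = ⊥ := by simpa using hS
    rw [this, symmDiff_bot]; exact ht
  · intro q hq
    have := (mem_cubes.1 hq).2.1
    rw [Finset.card_eq_zero] at this
    ext1 <;> simp [this]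
  · intro t _; rfl

theorem card_cubes_union_inter (U : Finset α) (A B : Finset (Finset α)) (j : ℕ) :
    (cubes U A j).card + (cubes U B j).card
      ≤ (cubes U (A ∪ B) j).card + (cubes U (A ∩ B) j).card := by
  rw [← Finset.card_union_add_card_inter]
  refine add_le_add (Finset.card_le_card ?_) (Finset.card_le_card ?_)
  · intro q hq
    rw [Finset.mem_union, mem_cubes, mem_cubes] at hq
    rw [mem_cubes]
    rcases hq with h | h
    · exact ⟨h.1, h.2.1, fun S hS => Finset.mem_union_left _ (h.2.2 S hS)⟩
    · exact ⟨h.1, h.2.1, fun S hS => Finset.mem_union_right _ (h.2.2 S hS)⟩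
  · intro q hq
    rw [Finset.mem_inter, mem_cubes, mem_cubes] at hq
    rw [mem_cubes]
    exact ⟨hq.1.1, hq.1.2.1, fun S hS => Finset.mem_inter.2 ⟨hq.1.2.2 S hS, hq.2.2.2 S hS⟩⟩

theorem card_cubes_insert_le {U : Finset α} {x : α} (𝓕 : Finset (Finset α)) (j : ℕ) :
    (cubes (insert x U) 𝓕 (j + 1)).card ≤
      (cubes U (𝓕.nonMemberSubfamily x) (j + 1)).card +
      (cubes U (𝓕.memberSubfamily x) (j + 1)).card +
      2 * (cubes U (𝓕.nonMemberSubfamily x ∩ 𝓕.memberSubfamily x) j).card := by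
  set A := 𝓕.nonMemberSubfamily x
  set B := 𝓕.memberSubfamily x
  have hsub : cubes (insert x U) 𝓕 (j + 1) ⊆
      (cubes U A (j + 1)) ∪ (cubes U B (j + 1)).image (fun q => (q.1, insert x q.2)) ∪
      ((cubes U (A ∩ B) j).image (fun q => (insert x q.1, q.2)) ∪
       (cubes U (A ∩ B) j).image (fun q => (insert x q.1, insert x q.2))) := by
    rintro ⟨J, t⟩ hq
    rw [mem_cubes] at hq
    obtain ⟨hJ, hc, hS⟩ := hq
    dsimp only at hJ hc hS
    by_cases hxJ : x ∈ J
    · apply Finset.mem_union_right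
      have hA : ∀ S ⊆ J.erase x, symmDiff (t.erase x) S ∈ A := by
        intro S hSJ
        have hxS : x ∉ S := fun h => by simpa using hSJ h
        rw [Finset.mem_nonMemberSubfamily]
        refine ⟨?_, by simp [Finset.mem_symmDiff, hxS]⟩
        by_cases hxt : x ∈ t
        · convert hS (insert x S) (Finset.insert_subset hxJ (hSJ.trans (Finset.erase_subset _ _)))
            using 1
          ext y; simp only [Finset.mem_symmDiff, Finset.mem_erase, Finset.mem_insert]
          by_cases hy : y = x <;> grind
        · convert hS S (hSJ.trans (Finset.erase_subset _ _)) using 1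
          rw [Finset.erase_eq_of_notMem hxt]
      have hB : ∀ S ⊆ J.erase x, symmDiff (t.erase x) S ∈ B := by
        intro S hSJ
        have hxS : x ∉ S := fun h => by simpa using hSJ h
        rw [Finset.mem_memberSubfamily]
        refine ⟨?_, by simp [Finset.mem_symmDiff, hxS]⟩
        by_cases hxt : x ∈ t
        · convert hS S (hSJ.trans (Finset.erase_subset _ _)) using 1
          ext y; simp only [Finset.mem_symmDiff, Finset.mem_erase, Finset.mem_insert]
          by_cases hy : y = x <;> grind
        · convert hS (insert x S) (Finset.insert_subset hxJ (hSJ.trans (Finset.erase_subset _ _)))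
            using 1
          ext y; simp only [Finset.mem_symmDiff, Finset.mem_erase, Finset.mem_insert]
          by_cases hy : y = x <;> grind
      have hmem : (J.erase x, t.erase x) ∈ cubes U (A ∩ B) j := by
        rw [mem_cubes]
        refine ⟨?_, ?_, fun S h => Finset.mem_inter.2 ⟨hA S h, hB S h⟩⟩
        · intro y hy
          have := hJ (Finset.mem_of_mem_erase hy)
          exact (Finset.mem_insert.1 this).resolve_left (Finset.ne_of_mem_erase hy)
        · rw [Finset.card_erase_of_mem hxJ, hc]; rfl
      by_cases hxt : x ∈ t
      · apply Finset.mem_union_right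
        exact Finset.mem_image.2 ⟨_, hmem, by simp [Finset.insert_erase hxJ, Finset.insert_erase hxt]⟩
      · apply Finset.mem_union_left
        exact Finset.mem_image.2 ⟨_, hmem, by
          simp [Finset.insert_erase hxJ, Finset.erase_eq_of_notMem hxt]⟩
    · apply Finset.mem_union_left
      have hJU : J ⊆ U := (Finset.subset_insert_iff_of_notMem hxJ).1 hJ
      by_cases hxt : x ∈ t
      · apply Finset.mem_union_right
        refine Finset.mem_image.2 ⟨(J, t.erase x), ?_, by simp [Finset.insert_erase hxt]⟩
        rw [mem_cubes]
        refine ⟨hJU, hc, fun S h => ?_⟩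
        have hxS : x ∉ S := fun h' => hxJ (h h')
        rw [Finset.mem_memberSubfamily]
        refine ⟨?_, by simp [Finset.mem_symmDiff, hxS]⟩
        convert hS S h using 1
        ext y; simp only [Finset.mem_symmDiff, Finset.mem_erase, Finset.mem_insert]
        by_cases hy : y = x <;> grind
      · apply Finset.mem_union_left
        rw [mem_cubes]
        refine ⟨hJU, hc, fun S h => ?_⟩
        have hxS : x ∉ S := fun h' => hxJ (h h')
        rw [Finset.mem_nonMemberSubfamily]
        exact ⟨hS S h, by simp [Finset.mem_symmDiff, hxS, hxt]⟩
  refine (Finset.card_le_card hsub).trans ?_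
  refine (Finset.card_union_le _ _).trans ?_
  have h1 := Finset.card_union_le (cubes U A (j + 1))
    ((cubes U B (j + 1)).image (fun q => (q.1, insert x q.2)))
  have h2 := Finset.card_union_le ((cubes U (A ∩ B) j).image (fun q => (insert x q.1, q.2)))
    ((cubes U (A ∩ B) j).image (fun q => (insert x q.1, insert x q.2)))
  have h3 := Finset.card_image_le (s := cubes U B (j + 1)) (f := fun q => (q.1, insert x q.2))
  have h4 := Finset.card_image_le (s := cubes U (A ∩ B) j) (f := fun q => (insert x q.1, q.2))
  have h5 := Finset.card_image_le (s := cubes U (A ∩ B) j)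
    (f := fun q => (insert x q.1, insert x q.2))
  omega

theorem card_cubes_le (U : Finset α) (𝓕 : Finset (Finset α)) (V j : ℕ)
    (hU : ∀ t ∈ 𝓕, t ⊆ U) (hV : ∀ s, 𝓕.Shatters s → s.card < V) :
    (cubes U 𝓕 j).card ≤ 2 ^ j * V.choose j * 𝓕.card := by
  induction U using Finset.induction_on generalizing 𝓕 V j with
  | empty =>
    cases j with
    | zero => simp [card_cubes_zero]
    | succ j =>
      have : cubes ∅ 𝓕 (j + 1) = ∅ := by
        rw [Finset.eq_empty_iff_forall_notMem]
        intro q hq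
        rw [mem_cubes] at hq
        have h1 : q.1 = ∅ := by simpa using hq.1
        simp [h1] at hq
      simp [this]
  | insert x U hx ih =>
    cases j with
    | zero => simp [card_cubes_zero]
    | succ j =>
      cases V with
      | zero =>
        have : 𝓕 = ∅ := by
          by_contra hne
          have hs : 𝓕.Shatters ∅ :=
            Finset.shatters_empty.2 (Finset.nonempty_iff_ne_empty.2 hne)
          simpa using hV _ hs
        subst this
        simp [cubes]
      | succ V =>
        refine (card_cubes_insert_le 𝓕 j).trans ?_
        have hui := card_cubes_union_inter U (𝓕.nonMemberSubfamily x) (𝓕.memberSubfamily x) (j + 1)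
        have hcard := Finset.card_memberSubfamily_add_card_nonMemberSubfamily x 𝓕
        have hcui := Finset.card_union_add_card_inter (𝓕.nonMemberSubfamily x) (𝓕.memberSubfamily x)
        set A := 𝓕.nonMemberSubfamily x with hA
        set B := 𝓕.memberSubfamily x with hB
        have hAU : ∀ t ∈ A, t ⊆ U := by
          intro t ht
          rw [Finset.mem_nonMemberSubfamily] at ht
          exact (Finset.subset_insert_iff_of_notMem ht.2).1 (hU t ht.1)
        have hBU : ∀ t ∈ B, t ⊆ U := by
          intro t ht
          rw [Finset.mem_memberSubfamily] at ht
          exact (Finset.subset_insert_iff_of_notMem ht.2).1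
            ((Finset.subset_insert _ _).trans (hU _ ht.1))
        have hxs : ∀ (𝓖 : Finset (Finset α)), (∀ t ∈ 𝓖, t ⊆ U) → ∀ s, 𝓖.Shatters s → x ∉ s := by
          intro 𝓖 h𝓖 s hs hxs
          obtain ⟨u, hu, hsu⟩ := hs (Finset.Subset.refl s)
          exact hx (h𝓖 u hu (Finset.inter_eq_left.1 hsu hxs))
        have ih1 := ih (A ∪ B) (V + 1) (j + 1)
          (fun t ht => (Finset.mem_union.1 ht).elim (hAU t) (hBU t)) (by
            intro s hs
            apply hV
            have hxs' := hxs _ (fun t ht => (Finset.mem_union.1 ht).elim (hAU t) (hBU t)) s hs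
            intro t ht
            obtain ⟨u, hu, hsu⟩ := hs ht
            rcases Finset.mem_union.1 hu with h | h
            · exact ⟨u, (Finset.mem_nonMemberSubfamily.1 h).1, hsu⟩
            · refine ⟨insert x u, (Finset.mem_memberSubfamily.1 h).1, ?_⟩
              rw [Finset.inter_insert_of_notMem hxs', hsu])
        have hV' : ∀ s, (A ∩ B).Shatters s → s.card < V := by
          intro s hs
          have hxs' := hxs _ (fun t ht => hAU t (Finset.mem_inter.1 ht).1) s hs
          have : 𝓕.Shatters (insert x s) := by
            intro t ht
            obtain ⟨u, hu, hsu⟩ := hs (t := t.erase x) (by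
              intro y hy
              exact (Finset.mem_insert.1 (ht (Finset.mem_of_mem_erase hy))).resolve_left
                (Finset.ne_of_mem_erase hy))
            rw [Finset.mem_inter, Finset.mem_nonMemberSubfamily, Finset.mem_memberSubfamily] at hu
            by_cases hxt : x ∈ t
            · refine ⟨insert x u, hu.2.1, ?_⟩
              rw [← Finset.insert_inter_distrib, hsu, Finset.insert_erase hxt]
            · refine ⟨u, hu.1.1, ?_⟩
              rw [Finset.insert_inter_of_notMem hu.1.2, hsu, Finset.erase_eq_of_notMem hxt]
          have h := hV _ this
          rw [Finset.card_insert_of_notMem hxs'] at h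
          omega
        have hIU : ∀ t ∈ A ∩ B, t ⊆ U := fun t ht => hAU t (Finset.mem_inter.1 ht).1
        have ih2 := ih (A ∩ B) V (j + 1) hIU hV'
        have ih3 := ih (A ∩ B) V j hIU hV'
        rw [Nat.choose_succ_succ'] at ih1 ⊢
        have hsum : 𝓕.card = (A ∪ B).card + (A ∩ B).card := by omega
        rw [hsum]
        set a := (A ∪ B).card
        set b := (A ∩ B).card
        have e : 2 ^ (j + 1) * (V.choose j + V.choose (j + 1)) * (a + b)
          = 2 ^ (j + 1) * (V.choose j + V.choose (j + 1)) * a + 2 ^ (j + 1) * V.choose (j + 1) * b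
            + 2 * (2 ^ j * V.choose j * b) := by ring
        rw [e]
        omega

theorem card_family_le (U : Finset α) (𝓕 : Finset (Finset α)) (V : ℕ)
    (hU : ∀ t ∈ 𝓕, t ⊆ U) (hV : ∀ s, 𝓕.Shatters s → s.card ≤ V) :
    𝓕.card ≤ (V + 1) * (U.card + 1) ^ V := by
  refine (Finset.card_le_card_shatterer 𝓕).trans ?_
  have hsub : 𝓕.shatterer ⊆ (Finset.range (V + 1)).biUnion fun k => U.powersetCard k := by
    intro s hs
    rw [Finset.mem_shatterer] at hs
    rw [Finset.mem_biUnion]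
    refine ⟨s.card, Finset.mem_range.2 (by have := hV s hs; omega), ?_⟩
    rw [Finset.mem_powersetCard]
    refine ⟨?_, rfl⟩
    obtain ⟨u, hu, hsu⟩ := hs (Finset.Subset.refl s)
    exact (Finset.inter_eq_left.1 hsu).trans (hU u hu)
  refine (Finset.card_le_card hsub).trans (Finset.card_biUnion_le.trans ?_)
  have : ∀ k ∈ Finset.range (V + 1), (U.powersetCard k).card ≤ (U.card + 1) ^ V := by
    intro k hk
    rw [Finset.card_powersetCard]
    calc U.card.choose k ≤ U.card ^ k := Nat.choose_le_pow _ _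
      _ ≤ (U.card + 1) ^ k := Nat.pow_le_pow_left (by omega) _
      _ ≤ (U.card + 1) ^ V := Nat.pow_le_pow_right (by omega) (by
          have := Finset.mem_range.1 hk; omega)
  refine (Finset.sum_le_sum this).trans ?_
  simp

end Cubes

section SignPatterns

variable {α W : Type*} [AddCommGroup W] [Module ℝ W]

/-- The set of indices in `U` whose functional is positive at `x`. -/
def posSet (f : α → W →ₗ[ℝ] ℝ) (U : Finset α) (x : W) : Finset α := U.filter fun h => 0 < f h x

/-- The sign patterns on `U` of a finite set of points. -/
def patterns (f : α → W →ₗ[ℝ] ℝ) (X : Finset W) (U : Finset α) : Finset (Finset α) :=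
  X.image (posSet f U)

theorem patterns_subset {f : α → W →ₗ[ℝ] ℝ} {X : Finset W} {U t : Finset α}
    (ht : t ∈ patterns f X U) : t ⊆ U := by
  obtain ⟨x, _, rfl⟩ := Finset.mem_image.1 ht
  exact Finset.filter_subset _ _

theorem posSet_inter {f : α → W →ₗ[ℝ] ℝ} {U U' : Finset α} (h : U' ⊆ U) (x : W) :
    posSet f U x ∩ U' = posSet f U' x := by
  ext y
  simp only [posSet, Finset.mem_inter, Finset.mem_filter]
  exact ⟨fun hy => ⟨hy.2, hy.1.2⟩, fun hy => ⟨⟨h hy.1, hy.2⟩, hy.1⟩⟩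

theorem inter_mem_patterns {f : α → W →ₗ[ℝ] ℝ} {X : Finset W} {U U' t : Finset α} (h : U' ⊆ U)
    (ht : t ∈ patterns f X U) : t ∩ U' ∈ patterns f X U' := by
  obtain ⟨x, hx, rfl⟩ := Finset.mem_image.1 ht
  rw [posSet_inter h]
  exact Finset.mem_image_of_mem _ hx

theorem card_of_shatters_patterns [FiniteDimensional ℝ W] (f : α → W →ₗ[ℝ] ℝ) (X : Finset W)
    (U : Finset α) (s : Finset α)
    (hs : (patterns f X U).Shatters s) : s.card ≤ Module.finrank ℝ W := by
  by_contra hlt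
  push Not at hlt
  have hdep : ¬ LinearIndependent ℝ (fun h : s => f h) := by
    intro hli
    have := hli.fintype_card_le_finrank
    rw [Fintype.card_coe] at this
    have h2 : Module.finrank ℝ (W →ₗ[ℝ] ℝ) = Module.finrank ℝ W := Subspace.dual_finrank_eq
    omega
  rw [Fintype.not_linearIndependent_iff] at hdep
  obtain ⟨g, hg, i, hi⟩ := hdep
  have main : ∀ g : s → ℝ, ∑ i, g i • f i = 0 → ∀ i, ¬ 0 < g i := by
    intro g hg i hi
    obtain ⟨u, hu, hsu⟩ := hs (t := s.attach.filter (fun h => 0 < g h) |>.image Subtype.val) (by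
      intro y hy
      obtain ⟨z, _, rfl⟩ := Finset.mem_image.1 hy
      exact z.2)
    obtain ⟨x, hx, rfl⟩ := Finset.mem_image.1 hu
    have hsU : s ⊆ U := by
      obtain ⟨v, hv, hsv⟩ := hs (Finset.Subset.refl s)
      exact (Finset.inter_eq_left.1 hsv).trans (patterns_subset hv)
    have hiff : ∀ h : s, 0 < f h x ↔ 0 < g h := by
      intro h
      have h1 : (h : α) ∈ s ∩ posSet f U x ↔ 0 < f h x := by
        simp [posSet, hsU h.2]
      rw [← h1, hsu]
      simp
    have h0 : ∑ h, g h * f h x = 0 := by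
      have := congrArg (fun φ : W →ₗ[ℝ] ℝ => φ x) hg
      simpa using this
    have hnn : ∀ h ∈ Finset.univ, 0 ≤ g h * f h x := by
      intro h _
      by_cases hp : 0 < g h
      · exact (mul_pos hp ((hiff h).2 hp)).le
      · have h2 : ¬ 0 < f h x := fun h' => hp ((hiff h).1 h')
        exact mul_nonneg_of_nonpos_of_nonpos (not_lt.1 hp) (not_lt.1 h2)
    have := (Finset.sum_eq_zero_iff_of_nonneg hnn).1 h0 i (Finset.mem_univ _)
    have h3 := mul_pos hi ((hiff i).2 hi)
    linarith
  rcases lt_or_gt_of_ne hi with h | h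
  · refine main (fun i => - g i) ?_ i (by linarith)
    rw [← neg_eq_zero, ← Finset.sum_neg_distrib] at hg; simpa only [← neg_smul] using hg
  · exact main g hg i h

end SignPatterns

/-! ### Random sampling -/

section Sampling

variable {α τ : Type*}

/-- The expectation of `G R`, where `R` is the random subset of `Y` that contains each element `h`
independently with probability `p h`. -/
def expect (Y : Finset α) (p : α → ℝ) (G : Finset α → ℝ) : ℝ :=
  ∑ R ∈ Y.powerset, ((∏ h ∈ R, p h) * ∏ h ∈ Y \ R, (1 - p h)) * G R

theorem weight_nonneg {Y R : Finset α} {p : α → ℝ} (hR : R ⊆ Y) (h0 : ∀ h ∈ Y, 0 ≤ p h)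
    (h1 : ∀ h ∈ Y, p h ≤ 1) : 0 ≤ (∏ h ∈ R, p h) * ∏ h ∈ Y \ R, (1 - p h) :=
  mul_nonneg (Finset.prod_nonneg fun h hh => h0 h (hR hh))
    (Finset.prod_nonneg fun h hh => sub_nonneg.2 (h1 h (Finset.sdiff_subset hh)))

theorem expect_empty (p : α → ℝ) (G : Finset α → ℝ) : expect ∅ p G = G ∅ := by
  simp [expect]

theorem expect_insert {Y : Finset α} {h : α} (hh : h ∉ Y) (p : α → ℝ) (G : Finset α → ℝ) :
    expect (insert h Y) p G = expect Y p fun R => p h * G (insert h R) + (1 - p h) * G R := by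
  unfold expect
  rw [Finset.sum_powerset_insert hh, ← Finset.sum_add_distrib]
  refine Finset.sum_congr rfl fun R hR => ?_
  have hR' : R ⊆ Y := Finset.mem_powerset.1 hR
  have hhR : h ∉ R := fun hm => hh (hR' hm)
  rw [Finset.insert_sdiff_of_notMem _ hhR, Finset.prod_insert (by simp [hh]),
    Finset.prod_insert hhR, Finset.insert_sdiff_insert, Finset.sdiff_insert_of_notMem hh]
  ring

theorem expect_mono {Y : Finset α} {p : α → ℝ} (h0 : ∀ h ∈ Y, 0 ≤ p h) (h1 : ∀ h ∈ Y, p h ≤ 1)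
    {G G' : Finset α → ℝ} (hG : ∀ R ⊆ Y, G R ≤ G' R) : expect Y p G ≤ expect Y p G' :=
  Finset.sum_le_sum fun _ hR =>
    mul_le_mul_of_nonneg_left (hG _ (Finset.mem_powerset.1 hR))
      (weight_nonneg (Finset.mem_powerset.1 hR) h0 h1)

theorem expect_const_mul (Y : Finset α) (p : α → ℝ) (c : ℝ) (G : Finset α → ℝ) :
    expect Y p (fun R => c * G R) = c * expect Y p G := by
  unfold expect
  rw [Finset.mul_sum]
  exact Finset.sum_congr rfl fun _ _ => by ring

theorem expect_sum (Y : Finset α) (p : α → ℝ) (T : Finset τ) (G : τ → Finset α → ℝ) :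
    expect Y p (fun R => ∑ t ∈ T, G t R) = ∑ t ∈ T, expect Y p (G t) := by
  unfold expect
  rw [Finset.sum_comm]
  exact Finset.sum_congr rfl fun _ _ => by rw [Finset.mul_sum]

theorem expect_const (Y : Finset α) (p : α → ℝ) (c : ℝ) : expect Y p (fun _ => c) = c := by
  unfold expect
  rw [← Finset.sum_mul, ← Finset.prod_add]
  simp

theorem expect_le_prod_mul_expect (Y : Finset α) (p q c : α → ℝ)
    (hp0 : ∀ h ∈ Y, 0 ≤ p h) (hp1 : ∀ h ∈ Y, p h ≤ 1)
    (hq0 : ∀ h ∈ Y, 0 ≤ q h) (hq1 : ∀ h ∈ Y, q h ≤ 1) (hc : ∀ h ∈ Y, 0 ≤ c h)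
    (G : Finset α → ℝ)
    (hG : ∀ h ∈ Y, ∀ R ⊆ Y, h ∉ R → p h * G (insert h R) + (1 - p h) * G R ≤
      c h * (q h * G (insert h R) + (1 - q h) * G R)) :
    expect Y p G ≤ (∏ h ∈ Y, c h) * expect Y q G := by
  induction Y using Finset.induction_on generalizing G with
  | empty => simp [expect_empty]
  | insert a Y ha ih =>
    have hsub : Y ⊆ insert a Y := Finset.subset_insert _ _
    have haY : a ∈ insert a Y := Finset.mem_insert_self _ _
    rw [expect_insert ha, expect_insert ha, Finset.prod_insert ha]
    set G' : Finset α → ℝ := fun R => q a * G (insert a R) + (1 - q a) * G R with hG'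
    have h1 : expect Y p (fun R => p a * G (insert a R) + (1 - p a) * G R) ≤
        expect Y p (fun R => c a * G' R) := by
      refine expect_mono (fun h hh => hp0 h (hsub hh)) (fun h hh => hp1 h (hsub hh)) ?_
      intro R hR
      exact hG a haY R (hR.trans hsub) (fun hm => ha (hR hm))
    rw [expect_const_mul] at h1
    have h2 := ih (fun h hh => hp0 h (hsub hh)) (fun h hh => hp1 h (hsub hh))
      (fun h hh => hq0 h (hsub hh)) (fun h hh => hq1 h (hsub hh)) (fun h hh => hc h (hsub hh)) G'
      (by
        intro h hh R hR hhR
        have hne : h ≠ a := fun e => ha (e ▸ hh)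
        have e1 := hG h (hsub hh) R (hR.trans hsub) hhR
        have e2 := hG h (hsub hh) (insert a R)
          (Finset.insert_subset haY (hR.trans hsub)) (by simp [hne, hhR])
        have e3 := mul_le_mul_of_nonneg_left e1 (sub_nonneg.2 (hq1 a haY))
        have e4 := mul_le_mul_of_nonneg_left e2 (hq0 a haY)
        simp only [hG']
        rw [Finset.insert_comm a h R]
        linarith)
    calc _ ≤ _ := h1
      _ ≤ c a * ((∏ h ∈ Y, c h) * expect Y q G') := mul_le_mul_of_nonneg_left h2 (hc a haY)
      _ = _ := by ring

/-- The probability of a configuration decreases exponentially in the weight of the elements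
excluded by it. -/
theorem expect_indicator_le (Y : Finset α) (p : α → ℝ)
    (hp0 : ∀ h ∈ Y, 0 ≤ p h) (hp1 : ∀ h ∈ Y, p h ≤ 1) (P : Finset α → Prop) [DecidablePred P] (D X : Finset α)
    (hX : X ⊆ Y) (M : ℕ) (hM : (D ∩ Y).card ≤ M)
    (hP : ∀ R ⊆ Y, P R → D ∩ Y ⊆ R ∧ Disjoint X R)
    (hmono : ∀ R ⊆ Y, P R → ∀ R' ⊆ R, D ∩ Y ⊆ R' → P R') :
    expect Y p (fun R => if P R then 1 else 0) ≤
      2 ^ M * Real.exp (-(∑ h ∈ X, p h) / 2) *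
        expect Y (fun h => p h / 2) (fun R => if P R then 1 else 0) := by
  set c : α → ℝ := fun h => (if h ∈ D then 2 else 1) * (if h ∈ X then Real.exp (-p h / 2) else 1)
    with hc
  have hc0 : ∀ h, 0 ≤ c h := fun h => by
    simp only [hc]
    positivity
  have key := expect_le_prod_mul_expect Y p (fun h => p h / 2) c hp0 hp1
    (fun h hh => by have := hp0 h hh; linarith)
    (fun h hh => by have := hp1 h hh; linarith) (fun h _ => hc0 h)
    (fun R => if P R then 1 else 0) (by
      intro h hh R hR hhR
      have hpos := hp0 h hh
      have hle := hp1 h hh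
      have hins : insert h R ⊆ Y := Finset.insert_subset hh hR
      have hexp1 : 1 - p h ≤ Real.exp (-p h / 2) * (1 - p h / 2) := by
        have := Real.add_one_le_exp (-p h / 2)
        nlinarith
      by_cases hD : h ∈ D
      · have hnR : ¬ P R := fun h' => hhR ((hP R hR h').1 (Finset.mem_inter.2 ⟨hD, hh⟩))
        by_cases hI : P (insert h R)
        · have hnX : h ∉ X := fun h' => Finset.disjoint_left.1 (hP _ hins hI).2 h'
            (Finset.mem_insert_self _ _)
          simp [hnR, hI, hc, hD, hnX]
          linarith
        · simp [hnR, hI]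
      · by_cases hXh : h ∈ X
        · have hnI : ¬ P (insert h R) := fun h' => Finset.disjoint_left.1 (hP _ hins h').2 hXh
            (Finset.mem_insert_self _ _)
          by_cases hPR : P R
          · simp [hnI, hPR, hc, hD, hXh]
            linarith
          · simp [hnI, hPR]
        · by_cases hI : P (insert h R)
          · have hPR : P R := hmono _ hins hI R (Finset.subset_insert _ _) (by
              intro y hy
              rcases Finset.mem_insert.1 ((hP _ hins hI).1 hy) with e | e
              · exact absurd (e ▸ (Finset.mem_inter.1 hy).1) hD
              · exact e)
            simp [hI, hPR, hc, hD, hXh]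
          · by_cases hPR : P R
            · simp [hI, hPR, hc, hD, hXh]
              linarith
            · simp [hI, hPR])
  refine key.trans ?_
  have hprod : ∏ h ∈ Y, c h ≤ 2 ^ M * Real.exp (-(∑ h ∈ X, p h) / 2) := by
    simp only [hc]
    rw [Finset.prod_mul_distrib]
    have e1 : ∏ h ∈ Y, (if h ∈ D then (2:ℝ) else 1) = 2 ^ (D ∩ Y).card := by
      rw [Finset.prod_ite]
      simp only [Finset.prod_const, one_pow, mul_one]
      congr 2
      ext y; simp [and_comm]
    have e2 : ∏ h ∈ Y, (if h ∈ X then Real.exp (-p h / 2) else 1)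
        = Real.exp (-(∑ h ∈ X, p h) / 2) := by
      rw [Finset.prod_ite]
      simp only [Finset.prod_const, one_pow, mul_one]
      rw [← Real.exp_sum, Finset.filter_mem_eq_inter, Finset.inter_eq_right.2 hX]
      congr 1
      rw [← Finset.sum_neg_distrib, Finset.sum_div]
    rw [e1, e2]
    exact mul_le_mul_of_nonneg_right (pow_le_pow_right₀ (by norm_num) hM) (Real.exp_nonneg _)
  refine mul_le_mul_of_nonneg_right hprod ?_
  refine Finset.sum_nonneg fun R hR => mul_nonneg (weight_nonneg (Finset.mem_powerset.1 hR)
    (fun h hh => by have := hp0 h hh; linarith) (fun h hh => by have := hp1 h hh; have := hp0 h hh; linarith)) ?_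
  dsimp only
  split_ifs <;> norm_num

theorem exists_sample (Y : Finset α) (p : α → ℝ)
    (hp0 : ∀ h ∈ Y, 0 ≤ p h) (hp1 : ∀ h ∈ Y, p h ≤ 1) (T : Finset α → Finset τ)
    (D X : τ → Finset α) (hX : ∀ t, X t ⊆ Y) (M : ℕ)
    (hM : ∀ t, (D t ∩ Y).card ≤ M)
    (hP : ∀ R ⊆ Y, ∀ t ∈ T R, D t ∩ Y ⊆ R ∧ Disjoint (X t) R)
    (hmono : ∀ R ⊆ Y, ∀ t ∈ T R, ∀ R' ⊆ R, D t ∩ Y ⊆ R' → t ∈ T R') :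
    ∃ R ⊆ Y, (∀ h ∈ Y, p h = 1 → h ∈ R) ∧
      ∑ t ∈ T R, Real.exp ((∑ h ∈ X t, p h) / 2) ≤
        2 ^ M * expect Y (fun h => p h / 2) (fun R => ((T R).card : ℝ)) := by
  set B := 2 ^ M * expect Y (fun h => p h / 2) (fun R => ((T R).card : ℝ)) with hB
  set S : Finset τ := Y.powerset.biUnion T with hS
  have hTS : ∀ R ⊆ Y, T R = S.filter (fun t => t ∈ T R) := by
    intro R hR
    ext t
    simp only [hS, Finset.mem_filter, Finset.mem_biUnion, Finset.mem_powerset]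
    exact ⟨fun h => ⟨⟨R, hR, h⟩, h⟩, fun h => h.2⟩
  have hE : expect Y p (fun R => ∑ t ∈ T R, Real.exp ((∑ h ∈ X t, p h) / 2)) ≤ B := by
    have e1 : expect Y p (fun R => ∑ t ∈ T R, Real.exp ((∑ h ∈ X t, p h) / 2)) =
        expect Y p (fun R => ∑ t ∈ S, Real.exp ((∑ h ∈ X t, p h) / 2) *
          (if t ∈ T R then 1 else 0)) := by
      refine Finset.sum_congr rfl fun R hR => ?_
      congr 1
      dsimp only
      conv_lhs => rw [hTS R (Finset.mem_powerset.1 hR)]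
      rw [Finset.sum_filter]
      exact Finset.sum_congr rfl fun t _ => by split_ifs <;> simp
    have e2 : expect Y (fun h => p h / 2) (fun R => ((T R).card : ℝ)) =
        expect Y (fun h => p h / 2) (fun R => ∑ t ∈ S, (if t ∈ T R then 1 else 0)) := by
      refine Finset.sum_congr rfl fun R hR => ?_
      congr 1
      dsimp only
      conv_lhs => rw [hTS R (Finset.mem_powerset.1 hR)]
      rw [Finset.card_filter]
      push_cast
      rfl
    rw [e1, hB, e2, expect_sum, expect_sum, Finset.mul_sum]
    refine Finset.sum_le_sum fun t _ => ?_
    rw [expect_const_mul]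
    have := expect_indicator_le Y p hp0 hp1 (fun R => t ∈ T R) (D t) (X t) (hX t) M (hM t)
      (fun R hR h => hP R hR t h) (fun R hR h => hmono R hR t h)
    refine (mul_le_mul_of_nonneg_left this (Real.exp_nonneg _)).trans (le_of_eq ?_)
    have e3 : Real.exp ((∑ h ∈ X t, p h) / 2) * Real.exp (-(∑ h ∈ X t, p h) / 2) = 1 := by
      rw [← Real.exp_add]
      simp [neg_div]
    linear_combination (2 ^ M * expect Y (fun h => p h / 2)
      (fun R => if t ∈ T R then 1 else 0)) * e3
  by_contra hno
  push Not at hno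
  have hlt : expect Y p (fun _ => B) <
      expect Y p (fun R => ∑ t ∈ T R, Real.exp ((∑ h ∈ X t, p h) / 2)) := by
    have hpt : ∀ R ∈ Y.powerset, 0 < (∏ h ∈ R, p h) * ∏ h ∈ Y \ R, (1 - p h) →
        B < ∑ t ∈ T R, Real.exp ((∑ h ∈ X t, p h) / 2) := by
      intro R hR hpos
      refine hno R (Finset.mem_powerset.1 hR) ?_
      intro h hh h1
      by_contra hhR
      have : ∏ h ∈ Y \ R, (1 - p h) = 0 :=
        Finset.prod_eq_zero (Finset.mem_sdiff.2 ⟨hh, hhR⟩) (by rw [h1]; ring)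
      rw [this, mul_zero] at hpos
      exact lt_irrefl _ hpos
    have hsum1 := expect_const Y p 1
    unfold expect at hsum1 ⊢
    simp only [mul_one] at hsum1
    have hex : ∃ R ∈ Y.powerset, 0 < (∏ h ∈ R, p h) * ∏ h ∈ Y \ R, (1 - p h) := by
      by_contra hne
      push Not at hne
      have := Finset.sum_nonpos hne
      linarith
    refine Finset.sum_lt_sum (fun R hR => ?_) ?_
    · have hw := weight_nonneg (Finset.mem_powerset.1 hR) hp0 hp1
      rcases hw.eq_or_lt with h | h
      · rw [← h]; simp
      · exact mul_le_mul_of_nonneg_left (hpt R hR h).le hw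
    · obtain ⟨R, hR, h⟩ := hex
      exact ⟨R, hR, mul_lt_mul_of_pos_left (hpt R hR h) h⟩
  rw [expect_const] at hlt
  linarith

theorem expect_exp_card_le (Y : Finset α) (q : α → ℝ) (hq0 : ∀ h ∈ Y, 0 ≤ q h)
    (hq1 : ∀ h ∈ Y, q h ≤ 1) (s : ℝ) (hs : 0 ≤ s) :
    expect Y q (fun R => Real.exp (s * R.card)) ≤
      Real.exp ((∑ h ∈ Y, q h) * (Real.exp s - 1)) := by
  induction Y using Finset.induction_on with
  | empty => simp [expect_empty]
  | insert a Y ha ih =>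
    have hsub : Y ⊆ insert a Y := Finset.subset_insert _ _
    have ih' := ih (fun h hh => hq0 h (hsub hh)) (fun h hh => hq1 h (hsub hh))
    rw [expect_insert ha, Finset.sum_insert ha, add_mul, Real.exp_add]
    have e : expect Y q (fun R => q a * Real.exp (s * (insert a R).card) +
        (1 - q a) * Real.exp (s * R.card)) =
        (1 + q a * (Real.exp s - 1)) * expect Y q (fun R => Real.exp (s * R.card)) := by
      rw [← expect_const_mul]
      refine Finset.sum_congr rfl fun R hR => ?_
      dsimp only
      have haR : a ∉ R := fun hm => ha (Finset.mem_powerset.1 hR hm)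
      rw [Finset.card_insert_of_notMem haR]
      push_cast
      rw [mul_add s, Real.exp_add, mul_one]
      ring
    rw [e]
    have hge : 0 ≤ q a * (Real.exp s - 1) :=
      mul_nonneg (hq0 a (Finset.mem_insert_self _ _)) (by have := Real.add_one_le_exp s; linarith)
    refine mul_le_mul ?_ ih' ?_ (Real.exp_nonneg _)
    · have := Real.add_one_le_exp (q a * (Real.exp s - 1)); linarith
    · exact Finset.sum_nonneg fun R hR => mul_nonneg (weight_nonneg (Finset.mem_powerset.1 hR)
        (fun h hh => hq0 h (hsub hh)) (fun h hh => hq1 h (hsub hh))) (Real.exp_nonneg _)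

theorem expect_poly_log_le (K : ℕ) : ∃ C : ℝ, 0 < C ∧ ∀ (α : Type) (Y : Finset α) (q : α → ℝ),
    (∀ h ∈ Y, 0 ≤ q h) → (∀ h ∈ Y, q h ≤ 1) → ∀ r : ℝ, 1 ≤ r → ∑ h ∈ Y, q h ≤ r →
    expect Y q (fun R => ((R.card : ℝ) + 1) ^ K * (1 + Real.log (R.card + 1))) ≤
      C * (r ^ K * (1 + Real.log r)) := by
  refine ⟨(K.factorial + (K + 1).factorial) * Real.exp 1 * Real.exp 2, by positivity, ?_⟩
  intro α Y q hq0 hq1 r hr hsum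
  have hr0 : 0 < r := by linarith
  have hlogr : 0 ≤ Real.log r := Real.log_nonneg hr
  have hpt : ∀ R ⊆ Y, ((R.card : ℝ) + 1) ^ K * (1 + Real.log (R.card + 1)) ≤
      ((K.factorial + (K + 1).factorial) * Real.exp 1 * (r ^ K * (1 + Real.log r))) *
        Real.exp (1 / r * R.card) := by
    intro R _
    set N := (R.card : ℝ)
    have hN : 0 ≤ N := Nat.cast_nonneg _
    set y := (N + 1) / r with hy
    have hy0 : 0 < y := by positivity
    have hNy : N + 1 = r * y := by rw [hy]; field_simp
    have hlog : Real.log (N + 1) ≤ Real.log r + y := by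
      rw [hNy, Real.log_mul hr0.ne' hy0.ne']
      have := Real.log_le_sub_one_of_pos hy0
      linarith
    have h1 : 1 + Real.log (N + 1) ≤ (1 + Real.log r) * (1 + y) := by nlinarith
    have h2 : y ^ K ≤ K.factorial * Real.exp y := by
      have := Real.pow_div_factorial_le_exp y hy0.le K
      rwa [div_le_iff₀ (by positivity), mul_comm] at this
    have h3 : y ^ (K + 1) ≤ (K + 1).factorial * Real.exp y := by
      have := Real.pow_div_factorial_le_exp y hy0.le (K + 1)
      rwa [div_le_iff₀ (by positivity), mul_comm] at this
    have h4 : Real.exp y ≤ Real.exp 1 * Real.exp (1 / r * N) := by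
      rw [← Real.exp_add, Real.exp_le_exp, hy]
      rw [add_div, add_comm]
      have : 1 / r ≤ 1 := (div_le_one hr0).2 hr
      have e : N / r = 1 / r * N := by ring
      linarith
    have h5 : y ^ K * (1 + y) ≤ (K.factorial + (K + 1).factorial) *
        (Real.exp 1 * Real.exp (1 / r * N)) := by
      calc y ^ K * (1 + y) = y ^ K + y ^ (K + 1) := by ring
        _ ≤ (K.factorial + (K + 1).factorial) * Real.exp y := by linarith
        _ ≤ _ := mul_le_mul_of_nonneg_left h4 (by positivity)
    calc (N + 1) ^ K * (1 + Real.log (N + 1))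
        ≤ (r * y) ^ K * ((1 + Real.log r) * (1 + y)) := by
          rw [hNy] at h1 ⊢
          exact mul_le_mul_of_nonneg_left h1 (pow_nonneg (mul_pos hr0 hy0).le K)
      _ = (r ^ K * (1 + Real.log r)) * (y ^ K * (1 + y)) := by rw [mul_pow]; ring
      _ ≤ (r ^ K * (1 + Real.log r)) * ((K.factorial + (K + 1).factorial) *
        (Real.exp 1 * Real.exp (1 / r * N))) := mul_le_mul_of_nonneg_left h5 (by positivity)
      _ = _ := by ring
  refine (expect_mono hq0 hq1 hpt).trans ?_
  rw [expect_const_mul]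
  have h6 := expect_exp_card_le Y q hq0 hq1 (1 / r) (by positivity)
  have h7 : (∑ h ∈ Y, q h) * (Real.exp (1 / r) - 1) ≤ 2 := by
    have hle : |1 / r| ≤ 1 := by
      rw [abs_of_pos (by positivity), div_le_one hr0]; exact hr
    have h8 := (le_abs_self _).trans (Real.abs_exp_sub_one_le hle)
    rw [abs_of_pos (by positivity)] at h8
    have h9 : 0 ≤ Real.exp (1 / r) - 1 := by
      have := Real.add_one_le_exp (1 / r)
      have : 0 < 1 / r := by positivity
      linarith
    calc (∑ h ∈ Y, q h) * (Real.exp (1 / r) - 1) ≤ r * (2 * (1 / r)) :=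
          mul_le_mul hsum h8 h9 hr0.le
      _ = 2 := by field_simp
  have h10 := h6.trans (Real.exp_le_exp.2 h7)
  refine (mul_le_mul_of_nonneg_left h10 (by positivity)).trans (le_of_eq (by ring))

end Sampling

/-! ### Generic arrangements of linear hyperplanes -/

theorem exists_linear_solution {d : ℕ} {I : Type*} [Fintype I] (hI : Fintype.card I = d + 1)
    (L : I → (Fin (d + 1) → ℝ) →ₗ[ℝ] ℝ) (hL : ∀ x, (∀ i, L i x = 0) → x = 0) (c : I → ℝ) :
    ∃ x, ∀ i, L i x = c i := by
  have hinj : Function.Injective (LinearMap.pi L) := by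
    rw [← LinearMap.ker_eq_bot, LinearMap.ker_eq_bot']
    intro x hx
    exact hL x fun i => congrFun hx i
  have hsurj := (LinearMap.injective_iff_surjective_of_finrank_eq_finrank
    (by simp [hI])).1 hinj
  obtain ⟨x, hx⟩ := hsurj c
  exact ⟨x, fun i => congrFun hx i⟩

theorem exists_ne_zero_of_card_lt {d : ℕ} {I : Type*} [Fintype I] (hI : Fintype.card I < d + 1)
    (L : I → (Fin (d + 1) → ℝ) →ₗ[ℝ] ℝ) : ∃ x, x ≠ 0 ∧ ∀ i, L i x = 0 := by
  have : LinearMap.ker (LinearMap.pi L) ≠ ⊥ :=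
    LinearMap.ker_ne_bot_of_finrank_lt (by simpa using hI)
  obtain ⟨x, hx, hne⟩ := (Submodule.ne_bot_iff _).1 this
  exact ⟨x, hne, fun i => congrFun hx i⟩

/-- The sign attached to membership of `h` in `t`. -/
def sg {α : Type*} (t : Finset α) (h : α) : ℝ := if h ∈ t then 1 else -1

section Sign

variable {α : Type*} {t t' : Finset α} {h : α}

theorem sg_mul_self : sg t h * sg t h = 1 := by unfold sg; split_ifs <;> norm_num

theorem sg_ne_zero : sg t h ≠ 0 := by unfold sg; split_ifs <;> norm_num

theorem sg_of_mem (hh : h ∈ t) : sg t h = 1 := if_pos hh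

theorem sg_of_notMem (hh : h ∉ t) : sg t h = -1 := if_neg hh

theorem sg_congr (hh : h ∈ t ↔ h ∈ t') : sg t h = sg t' h := by
  unfold sg; simp only [hh]

end Sign

/-- A family of linear functionals on `ℝ^(d+1)` in general position, together with a level
functional that is positive on the cone cut out by the functionals in `E`, and a generic
cost functional. -/
structure GenericArrangement (d : ℕ) (α : Type*) where
  /-- the functionals -/
  f : α → (Fin (d + 1) → ℝ) →ₗ[ℝ] ℝ
  /-- the level functional -/
  level : (Fin (d + 1) → ℝ) →ₗ[ℝ] ℝ
  /-- the cost functional -/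
  cost : (Fin (d + 1) → ℝ) →ₗ[ℝ] ℝ
  /-- the indices of the functionals that bound the ambient cone -/
  E : Finset α
  card_E : E.card = d + 1
  compact : IsCompact {x | (∀ e ∈ E, 0 ≤ f e x) ∧ level x = 1}
  level_pos : ∀ x, (∀ e ∈ E, 0 ≤ f e x) → x ≠ 0 → 0 < level x
  gen : ∀ S : Finset α, S.card = d + 1 → ∀ x, (∀ h ∈ S, f h x = 0) → x = 0
  gen_cost : ∀ S : Finset α, S.card + 2 = d + 1 → ∀ x, (∀ h ∈ S, f h x = 0) → level x = 0 →
    cost x = 0 → x = 0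

namespace GenericArrangement

variable {d : ℕ} {α : Type*} (𝒜 : GenericArrangement d α)

/-- `y` lies in the relative interior of the face with zero set `F` of the cell with pattern `t`. -/
def Face (U t F : Finset α) (y : Fin (d + 1) → ℝ) : Prop :=
  (∀ h ∈ F, 𝒜.f h y = 0) ∧ ∀ h ∈ U, h ∉ F → 0 < sg t h * 𝒜.f h y

/-- `y` is the normalised point of the ray on which all functionals in `Z` vanish, and is the unique
minimiser of `ε * cost` on the normalised cone given by the signs in `Z` and the equations
in `F`. -/
structure Bottom (ε : ℝ) (F t Z : Finset α) (y : Fin (d + 1) → ℝ) : Prop where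
  card : Z.card = d
  sub : F ⊆ Z
  zero : ∀ h ∈ Z, 𝒜.f h y = 0
  level : 𝒜.level y = 1
  opt : ∀ x, (∀ h ∈ F, 𝒜.f h x = 0) → 𝒜.level x = 1 → (∀ h ∈ Z, 0 ≤ sg t h * 𝒜.f h x) →
    ε * 𝒜.cost x ≤ ε * 𝒜.cost y → x = y

variable {𝒜}

theorem ne_zero_of_level {y : Fin (d + 1) → ℝ} (hy : 𝒜.level y = 1) : y ≠ 0 := by
  rintro rfl
  simp at hy

theorem card_le_of_zero {S : Finset α} {y : Fin (d + 1) → ℝ} (hy : y ≠ 0)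
    (h0 : ∀ h ∈ S, 𝒜.f h y = 0) : S.card ≤ d := by
  by_contra hlt
  push Not at hlt
  obtain ⟨S', hS', hc⟩ := Finset.exists_subset_card_eq (show d + 1 ≤ S.card by omega)
  exact hy (𝒜.gen S' hc y fun h hh => h0 h (hS' hh))

theorem Face.card_le_or {U t F : Finset α} {y : Fin (d + 1) → ℝ} (hy : 𝒜.Face U t F y)
    (hEU : 𝒜.E ⊆ U) (hF : F.card ≤ d) : y ≠ 0 := by
  rintro rfl
  have : ∃ e ∈ 𝒜.E, e ∉ F := by
    by_contra hno
    push Not at hno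
    have := Finset.card_le_card (show 𝒜.E ⊆ F from hno)
    rw [𝒜.card_E] at this
    omega
  obtain ⟨e, he, heF⟩ := this
  have := hy.2 e (hEU he) heF
  simp at this

theorem Face.nonneg {U t F : Finset α} {y : Fin (d + 1) → ℝ} (hy : 𝒜.Face U t F y) :
    ∀ h ∈ U, 0 ≤ sg t h * 𝒜.f h y := by
  intro h hh
  by_cases hF : h ∈ F
  · rw [hy.1 h hF, mul_zero]
  · exact (hy.2 h hh hF).le

theorem Face.smul {U t F : Finset α} {y : Fin (d + 1) → ℝ} (hy : 𝒜.Face U t F y) {c : ℝ}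
    (hc : 0 < c) : 𝒜.Face U t F (c • y) := by
  refine ⟨fun h hh => by rw [map_smul, hy.1 h hh, smul_zero], fun h hh hF => ?_⟩
  have := mul_pos hc (hy.2 h hh hF)
  rw [map_smul, smul_eq_mul]
  linarith

theorem level_pos_of_nonneg {U t : Finset α} {y : Fin (d + 1) → ℝ} (hEU : 𝒜.E ⊆ U)
    (hEt : 𝒜.E ⊆ t) (hy : ∀ h ∈ U, 0 ≤ sg t h * 𝒜.f h y) (h0 : y ≠ 0) : 0 < 𝒜.level y := by
  refine 𝒜.level_pos y (fun e he => ?_) h0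
  have := hy e (hEU he)
  rwa [sg_of_mem (hEt he), one_mul] at this

theorem Face.exists_level {U t F : Finset α} {y : Fin (d + 1) → ℝ} (hy : 𝒜.Face U t F y)
    (hEU : 𝒜.E ⊆ U) (hEt : 𝒜.E ⊆ t) (hF : F.card ≤ d) :
    ∃ y, 𝒜.Face U t F y ∧ 𝒜.level y = 1 := by
  have hpos := level_pos_of_nonneg hEU hEt hy.nonneg (hy.card_le_or hEU hF)
  refine ⟨(𝒜.level y)⁻¹ • y, hy.smul (inv_pos.2 hpos), ?_⟩
  rw [map_smul, smul_eq_mul, inv_mul_cancel₀ hpos.ne']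

theorem exists_notMem_E {Z : Finset α} (hZ : Z.card = d) : ∃ e ∈ 𝒜.E, e ∉ Z := by
  by_contra hno
  push Not at hno
  have := Finset.card_le_card (show 𝒜.E ⊆ Z from hno)
  rw [𝒜.card_E] at this
  omega

section Vertex

variable {Z : Finset α} {y : Fin (d + 1) → ℝ}

theorem apply_ne_zero (hZ : Z.card = d) (hy : ∀ h ∈ Z, 𝒜.f h y = 0) (hl : 𝒜.level y = 1) {h : α}
    (hh : h ∉ Z) : 𝒜.f h y ≠ 0 := by
  intro h0
  refine ne_zero_of_level hl (𝒜.gen (insert h Z) ?_ y ?_)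
  · rw [Finset.card_insert_of_notMem hh, hZ]
  · intro g hg
    rcases Finset.mem_insert.1 hg with rfl | hg
    · exact h0
    · exact hy g hg

theorem eq_smul_of_zero (hZ : Z.card = d) (hy : ∀ h ∈ Z, 𝒜.f h y = 0) (hl : 𝒜.level y = 1)
    {x : Fin (d + 1) → ℝ} (hx : ∀ h ∈ Z, 𝒜.f h x = 0) : x = 𝒜.level x • y := by
  obtain ⟨e, he, heZ⟩ := exists_notMem_E (𝒜 := 𝒜) hZ
  have hne := apply_ne_zero hZ hy hl heZ
  have h0 : x - (𝒜.f e x / 𝒜.f e y) • y = 0 := by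
    refine 𝒜.gen (insert e Z) ?_ _ ?_
    · rw [Finset.card_insert_of_notMem heZ, hZ]
    · intro g hg
      rw [map_sub, map_smul, smul_eq_mul]
      rcases Finset.mem_insert.1 hg with rfl | hg
      · field_simp; ring
      · rw [hx g hg, hy g hg]; ring
  rw [sub_eq_zero] at h0
  have h1 : 𝒜.level x = 𝒜.f e x / 𝒜.f e y := by
    have := congrArg 𝒜.level h0
    rwa [map_smul, hl, smul_eq_mul, mul_one] at this
  rw [h1]
  exact h0

theorem eq_of_agree (hZ : Z.card = d) (hy : ∀ h ∈ Z, 𝒜.f h y = 0) (hl : 𝒜.level y = 1)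
    {x x' : Fin (d + 1) → ℝ} (hx : ∀ h ∈ Z, 𝒜.f h x = 𝒜.f h x') (hlx : 𝒜.level x = 𝒜.level x') :
    x = x' := by
  have := eq_smul_of_zero hZ hy hl (x := x - x') (fun h hh => by rw [map_sub, hx h hh, sub_self])
  rw [map_sub, hlx, sub_self, zero_smul, sub_eq_zero] at this
  exact this

theorem exists_point (hZ : Z.card = d) (hy : ∀ h ∈ Z, 𝒜.f h y = 0) (hl : 𝒜.level y = 1)
    (c : α → ℝ) (b : ℝ) : ∃ x, (∀ h ∈ Z, 𝒜.f h x = c h) ∧ 𝒜.level x = b := by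
  obtain ⟨x, hx⟩ := exists_linear_solution (I := Option Z) (by simp [hZ])
    (fun o => o.elim 𝒜.level fun h => 𝒜.f h) (by
      intro x hx
      refine eq_of_agree hZ hy hl (x' := 0) (fun h hh => ?_) ?_
      · simpa using hx (some ⟨h, hh⟩)
      · simpa using hx none) (fun o => o.elim b fun h => c h)
  exact ⟨x, fun h hh => hx (some ⟨h, hh⟩), hx none⟩

theorem exists_edge (hZ : Z.card = d) (hy : ∀ h ∈ Z, 𝒜.f h y = 0) (hl : 𝒜.level y = 1) :
    ∃ z : α → Fin (d + 1) → ℝ, ∀ g ∈ Z, 𝒜.level (z g) = 0 ∧ 𝒜.f g (z g) = 1 ∧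
      (∀ h ∈ Z, h ≠ g → 𝒜.f h (z g) = 0) ∧ 𝒜.cost (z g) ≠ 0 := by
  have (g : α) : ∃ z, g ∈ Z → 𝒜.level z = 0 ∧ 𝒜.f g z = 1 ∧
      (∀ h ∈ Z, h ≠ g → 𝒜.f h z = 0) ∧ 𝒜.cost z ≠ 0 := by
    obtain ⟨z, hz, hlz⟩ := exists_point hZ hy hl (fun h => if h = g then 1 else 0) 0
    refine ⟨z, fun hg => ⟨hlz, by simp [hz g hg], fun h hh hne => by simp [hz h hh, hne], ?_⟩⟩
    intro hc
    have := 𝒜.gen_cost (Z.erase g) (by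
      rw [Finset.card_erase_of_mem hg, hZ]
      have := Finset.card_pos.2 ⟨g, hg⟩
      omega) z (fun h hh => by
        simp [hz h (Finset.mem_of_mem_erase hh), Finset.ne_of_mem_erase hh]) hlz hc
    have h1 := hz g hg
    rw [this] at h1
    simp at h1
  choose z hz using this
  exact ⟨z, hz⟩

theorem eq_add_sum_edge (hZ : Z.card = d) (hy : ∀ h ∈ Z, 𝒜.f h y = 0) (hl : 𝒜.level y = 1)
    {z : α → Fin (d + 1) → ℝ} (hz : ∀ g ∈ Z, 𝒜.level (z g) = 0 ∧ 𝒜.f g (z g) = 1 ∧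
      (∀ h ∈ Z, h ≠ g → 𝒜.f h (z g) = 0) ∧ 𝒜.cost (z g) ≠ 0) {x : Fin (d + 1) → ℝ}
    (hx : 𝒜.level x = 1) : x = y + ∑ g ∈ Z, 𝒜.f g x • z g := by
  refine eq_of_agree hZ hy hl (fun h hh => ?_) ?_
  · rw [map_add, hy h hh, zero_add, map_sum, Finset.sum_eq_single h]
    · rw [map_smul, (hz h hh).2.1, smul_eq_mul, mul_one]
    · intro g hg hne
      rw [map_smul, (hz g hg).2.2.1 h hh hne.symm, smul_zero]
    · exact fun h' => absurd hh h'
  · rw [map_add, map_sum, hl, hx, Finset.sum_eq_zero, add_zero]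
    intro g hg
    rw [map_smul, (hz g hg).1, smul_zero]

theorem bottom_of_slopes (hZ : Z.card = d) (hy : ∀ h ∈ Z, 𝒜.f h y = 0) (hl : 𝒜.level y = 1)
    {z : α → Fin (d + 1) → ℝ} (hz : ∀ g ∈ Z, 𝒜.level (z g) = 0 ∧ 𝒜.f g (z g) = 1 ∧
      (∀ h ∈ Z, h ≠ g → 𝒜.f h (z g) = 0) ∧ 𝒜.cost (z g) ≠ 0) {F t : Finset α} (hF : F ⊆ Z) {ε : ℝ}
    (hs : ∀ g ∈ Z, g ∉ F → 0 < ε * (sg t g * 𝒜.cost (z g))) : 𝒜.Bottom ε F t Z y := by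
  refine ⟨hZ, hF, hy, hl, fun x hxF hxl hxZ hc => ?_⟩
  have hxy := eq_add_sum_edge hZ hy hl hz hxl
  have hcost : ε * 𝒜.cost x = ε * 𝒜.cost y +
      ∑ g ∈ Z, (sg t g * 𝒜.f g x) * (ε * (sg t g * 𝒜.cost (z g))) := by
    conv_lhs => rw [hxy]
    rw [map_add, map_sum, mul_add, Finset.mul_sum]
    congr 1
    refine Finset.sum_congr rfl fun g _ => ?_
    rw [map_smul, smul_eq_mul]
    linear_combination -(ε * 𝒜.f g x * 𝒜.cost (z g)) * sg_mul_self (t := t) (h := g)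
  have hnn : ∀ g ∈ Z, 0 ≤ (sg t g * 𝒜.f g x) * (ε * (sg t g * 𝒜.cost (z g))) := by
    intro g hg
    by_cases hgF : g ∈ F
    · rw [hxF g hgF]; simp
    · exact mul_nonneg (hxZ g hg) (hs g hg hgF).le
  have hsum : ∑ g ∈ Z, (sg t g * 𝒜.f g x) * (ε * (sg t g * 𝒜.cost (z g))) = 0 :=
    le_antisymm (by linarith) (Finset.sum_nonneg hnn)
  rw [Finset.sum_eq_zero_iff_of_nonneg hnn] at hsum
  refine eq_of_agree hZ hy hl (fun h hh => ?_) (by rw [hxl, hl])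
  rw [hy h hh]
  by_cases hhF : h ∈ F
  · exact hxF h hhF
  · have := hsum h hh
    rcases mul_eq_zero.1 this with h1 | h1
    · exact (mul_eq_zero.1 h1).resolve_left sg_ne_zero
    · exact absurd h1 (hs h hh hhF).ne'

end Vertex

theorem Bottom.unique {ε : ℝ} {F t U Z Z' : Finset α} {y y' : Fin (d + 1) → ℝ}
    (h : 𝒜.Bottom ε F t Z y) (h' : 𝒜.Bottom ε F t Z' y') (hZ : Z ⊆ U) (hZ' : Z' ⊆ U)
    (hy : ∀ g ∈ U, 0 ≤ sg t g * 𝒜.f g y) (hy' : ∀ g ∈ U, 0 ≤ sg t g * 𝒜.f g y') :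
    Z = Z' ∧ y = y' := by
  have heq : y = y' := by
    rcases le_total (ε * 𝒜.cost y) (ε * 𝒜.cost y') with hle | hle
    · exact h'.opt y (fun g hg => h.zero g (h.sub hg)) h.level (fun g hg => hy g (hZ' hg)) hle
    · exact (h.opt y' (fun g hg => h'.zero g (h'.sub hg)) h'.level
        (fun g hg => hy' g (hZ hg)) hle).symm
  subst heq
  refine ⟨?_, rfl⟩
  have hc : (Z ∪ Z').card ≤ d := card_le_of_zero (𝒜 := 𝒜) (ne_zero_of_level h.level) (by
    intro g hg
    rcases Finset.mem_union.1 hg with hg | hg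
    · exact h.zero g hg
    · exact h'.zero g hg)
  have e1 : Z = Z ∪ Z' :=
    Finset.eq_of_subset_of_card_le Finset.subset_union_left (by rw [h.card]; exact hc)
  have e2 : Z' = Z ∪ Z' :=
    Finset.eq_of_subset_of_card_le Finset.subset_union_right (by rw [h'.card]; exact hc)
  rw [e1]; exact e2.symm

theorem exists_pos_forall_pos {ι : Type*} (S : Finset ι) (a b : ι → ℝ) (ha : ∀ i ∈ S, 0 < a i) :
    ∃ s : ℝ, 0 < s ∧ ∀ i ∈ S, 0 < a i + s * b i := by
  induction S using Finset.induction_on with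
  | empty => exact ⟨1, one_pos, by simp⟩
  | insert i S _ ih =>
    obtain ⟨s, hs, hS⟩ := ih fun j hj => ha j (Finset.mem_insert_of_mem hj)
    have hi := ha i (Finset.mem_insert_self _ _)
    set s' := min s (a i / (|b i| + 1)) with hs'
    have hpos : 0 < s' := lt_min hs (by positivity)
    refine ⟨s', hpos, fun j hj => ?_⟩
    rcases Finset.mem_insert.1 hj with rfl | hj
    · have h1 : s' * (|b j| + 1) ≤ a j := by
        rw [← le_div_iff₀ (by positivity)]; exact min_le_right _ _
      have h2 := neg_abs_le (b j)
      nlinarith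
    · have h1 := hS j hj
      have h2 : s' ≤ s := min_le_left _ _
      have h3 := ha j (Finset.mem_insert_of_mem hj)
      rcases le_total 0 (b j) with hb | hb
      · have := mul_nonneg hpos.le hb; linarith
      · have := mul_le_mul_of_nonpos_right h2 hb; linarith

theorem exists_bottom {U t F : Finset α} (hEU : 𝒜.E ⊆ U) (hEt : 𝒜.E ⊆ t) (hF : F ⊆ U)
    {x : Fin (d + 1) → ℝ} (hx : ∀ h ∈ U, 0 ≤ sg t h * 𝒜.f h x) (hxF : ∀ h ∈ F, 𝒜.f h x = 0)
    (hx0 : x ≠ 0) {ε : ℝ} (hε : ε ≠ 0) :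
    ∃ Z y, Z ⊆ U ∧ 𝒜.Bottom ε F t Z y ∧ 𝒜.Face U t Z y := by
  set K : Set (Fin (d + 1) → ℝ) := {x | 𝒜.level x = 1 ∧ (∀ h ∈ F, 𝒜.f h x = 0) ∧
    ∀ h ∈ U, 0 ≤ sg t h * 𝒜.f h x} with hK
  have hcont : ∀ φ : (Fin (d + 1) → ℝ) →ₗ[ℝ] ℝ, Continuous φ :=
    fun φ => φ.continuous_of_finiteDimensional
  have hKc : IsCompact K := by
    refine 𝒜.compact.of_isClosed_subset ?_ ?_
    · refine (isClosed_eq (hcont _) continuous_const).inter (IsClosed.inter ?_ ?_)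
      · have : IsClosed {x | ∀ h ∈ F, 𝒜.f h x = 0} := by
          rw [show {x | ∀ h ∈ F, 𝒜.f h x = 0} = ⋂ h ∈ F, {x | 𝒜.f h x = 0} by ext; simp]
          exact isClosed_biInter fun h _ => isClosed_eq (hcont _) continuous_const
        exact this
      · have : IsClosed {x | ∀ h ∈ U, 0 ≤ sg t h * 𝒜.f h x} := by
          rw [show {x | ∀ h ∈ U, 0 ≤ sg t h * 𝒜.f h x} = ⋂ h ∈ U, {x | 0 ≤ sg t h * 𝒜.f h x} by
            ext; simp]
          exact isClosed_biInter fun h _ =>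
            isClosed_le continuous_const (continuous_const.mul (hcont _))
        exact this
    · rintro x ⟨h1, -, h3⟩
      refine ⟨fun e he => ?_, h1⟩
      have := h3 e (hEU he)
      rwa [sg_of_mem (hEt he), one_mul] at this
  have hKne : K.Nonempty := by
    have hpos := level_pos_of_nonneg hEU hEt hx hx0
    refine ⟨(𝒜.level x)⁻¹ • x, ?_, fun h hh => ?_, fun h hh => ?_⟩
    · rw [map_smul, smul_eq_mul, inv_mul_cancel₀ hpos.ne']
    · rw [map_smul, hxF h hh, smul_zero]
    · rw [map_smul, smul_eq_mul]
      have := mul_nonneg (inv_pos.2 hpos).le (hx h hh)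
      linarith
  obtain ⟨y, ⟨hyl, hyF, hyU⟩, hmin⟩ := hKc.exists_isMinOn hKne
    (continuous_const.mul (hcont 𝒜.cost) : Continuous fun x => ε * 𝒜.cost x).continuousOn
  have hmove : ∀ z, 𝒜.level z = 0 → (∀ h ∈ F, 𝒜.f h z = 0) →
      (∀ h ∈ U, 𝒜.f h y = 0 → 0 ≤ sg t h * 𝒜.f h z) → 0 ≤ ε * 𝒜.cost z := by
    intro z hzl hzF hzU
    obtain ⟨s, hs, hpos⟩ := exists_pos_forall_pos (U.filter fun h => 𝒜.f h y ≠ 0)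
      (fun h => sg t h * 𝒜.f h y) (fun h => sg t h * 𝒜.f h z) (by
        intro h hh
        rw [Finset.mem_filter] at hh
        exact lt_of_le_of_ne (hyU h hh.1) (mul_ne_zero sg_ne_zero hh.2).symm)
    have hmem : y + s • z ∈ K := by
      refine ⟨by simp [hyl, hzl], fun h hh => by simp [hyF h hh, hzF h hh], fun h hh => ?_⟩
      rw [map_add, map_smul, smul_eq_mul]
      by_cases h0 : 𝒜.f h y = 0
      · have := mul_nonneg hs.le (hzU h hh h0)
        rw [h0]; linarith
      · have := hpos h (Finset.mem_filter.2 ⟨hh, h0⟩)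
        linarith
    have : ε * 𝒜.cost y ≤ ε * 𝒜.cost (y + s • z) := hmin hmem
    simp only [map_add, map_smul, smul_eq_mul] at this
    have h2 : 0 ≤ s * (ε * 𝒜.cost z) := by linarith
    exact nonneg_of_mul_nonneg_right h2 hs
  set Z := U.filter fun h => 𝒜.f h y = 0 with hZ
  have hZU : Z ⊆ U := Finset.filter_subset _ _
  have hFZ : F ⊆ Z := fun h hh => Finset.mem_filter.2 ⟨hF hh, hyF h hh⟩
  have hZ0 : ∀ h ∈ Z, 𝒜.f h y = 0 := fun h hh => (Finset.mem_filter.1 hh).2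
  have hface : 𝒜.Face U t Z y := by
    refine ⟨hZ0, fun h hh hn => ?_⟩
    have : 𝒜.f h y ≠ 0 := fun h0 => hn (Finset.mem_filter.2 ⟨hh, h0⟩)
    exact lt_of_le_of_ne (hyU h hh) (mul_ne_zero sg_ne_zero this).symm
  have hZle : Z.card ≤ d := card_le_of_zero (𝒜 := 𝒜) (ne_zero_of_level hyl) hZ0
  have hZc : Z.card = d := by
    by_contra hne
    have hlt : Z.card + 1 ≤ d := by omega
    obtain ⟨S, hZS, -, hSc⟩ := Finset.exists_subsuperset_card_eq
      (Finset.subset_union_left (s₁ := Z) (s₂ := 𝒜.E)) (n := d - 1) (by omega) (by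
        have := Finset.card_le_card (Finset.subset_union_right (s₁ := Z) (s₂ := 𝒜.E))
        rw [𝒜.card_E] at this
        omega)
    obtain ⟨z, hz0, hz⟩ := exists_ne_zero_of_card_lt (d := d) (I := Option S)
      (by simp [hSc]; omega) (fun o => o.elim 𝒜.level fun h => 𝒜.f h)
    have hzl : 𝒜.level z = 0 := hz none
    have hzS : ∀ h ∈ S, 𝒜.f h z = 0 := fun h hh => hz (some ⟨h, hh⟩)
    have hzZ : ∀ h ∈ U, 𝒜.f h y = 0 → 𝒜.f h z = 0 :=
      fun h hh h0 => hzS h (hZS (Finset.mem_filter.2 ⟨hh, h0⟩))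
    have hzF : ∀ h ∈ F, 𝒜.f h z = 0 := fun h hh => hzS h (hZS (hFZ hh))
    have h1 := hmove z hzl hzF (fun h hh h0 => by rw [hzZ h hh h0, mul_zero])
    have h2 := hmove (-z) (by simp [hzl]) (fun h hh => by simp [hzF h hh])
      (fun h hh h0 => by simp [hzZ h hh h0])
    rw [map_neg, mul_neg] at h2
    have h3 : ε * 𝒜.cost z = 0 := by linarith
    exact hz0 (𝒜.gen_cost S (by omega) z hzS hzl ((mul_eq_zero.1 h3).resolve_left hε))
  refine ⟨Z, y, hZU, ?_, hface⟩
  obtain ⟨z, hz⟩ := exists_edge hZc hZ0 hyl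
  refine bottom_of_slopes hZc hZ0 hyl hz hFZ fun g hg hgF => ?_
  have h1 := hmove (sg t g • z g) (by simp [(hz g hg).1])
    (fun h hh => by
      rw [map_smul, (hz g hg).2.2.1 h (hFZ hh) (fun e => hgF (e ▸ hh)), smul_zero])
    (fun h hh h0 => by
      have hhZ : h ∈ Z := Finset.mem_filter.2 ⟨hh, h0⟩
      rw [map_smul, smul_eq_mul]
      by_cases e : h = g
      · subst e
        rw [(hz h hg).2.1, mul_one, sg_mul_self]
        norm_num
      · rw [(hz g hg).2.2.1 h hhZ e]; simp)
  rw [map_smul, smul_eq_mul] at h1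
  exact lt_of_le_of_ne h1 (mul_ne_zero hε (mul_ne_zero sg_ne_zero (hz g hg).2.2.2)).symm

end GenericArrangement

namespace GenericArrangement

variable {d : ℕ} {α : Type*} (𝒜 : GenericArrangement d α)

/-- The triples `(F, J, t)` such that `F` is the zero set of a `k`-codimensional face of the cell
with pattern `t`, `J ⊆ F` has `j` elements, and all cells obtained from `t` by changing signs in `J`
are present. -/
def flags (X : Finset (Fin (d + 1) → ℝ)) (U : Finset α) (k j : ℕ) :
    Finset (Finset α × Finset α × Finset α) :=
  (U.powersetCard k ×ˢ cubes U (patterns 𝒜.f X U) j).filter fun q =>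
    q.2.1 ⊆ q.1 ∧ ∃ y, 𝒜.Face U q.2.2 q.1 y

variable {𝒜} {X : Finset (Fin (d + 1) → ℝ)} {U : Finset α} {k j : ℕ}

theorem mem_flags {q : Finset α × Finset α × Finset α} : q ∈ 𝒜.flags X U k j ↔
    (q.1 ⊆ U ∧ q.1.card = k) ∧ q.2.1 ⊆ q.1 ∧ q.2.1.card = j ∧
      (∀ S ⊆ q.2.1, symmDiff q.2.2 S ∈ patterns 𝒜.f X U) ∧ ∃ y, 𝒜.Face U q.2.2 q.1 y := by
  simp only [flags, Finset.mem_filter, Finset.mem_product, Finset.mem_powersetCard, mem_cubes]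
  constructor
  · rintro ⟨⟨⟨h1, h2⟩, -, h4, h5⟩, h6, h7⟩
    exact ⟨⟨h1, h2⟩, h6, h4, h5, h7⟩
  · rintro ⟨⟨h1, h2⟩, h6, h4, h5, h7⟩
    exact ⟨⟨⟨h1, h2⟩, h6.trans h1, h4, h5⟩, h6, h7⟩

theorem subset_of_patterns (hX : ∀ x ∈ X, ∀ e ∈ 𝒜.E, 0 < 𝒜.f e x) (hEU : 𝒜.E ⊆ U)
    {t : Finset α} (ht : t ∈ patterns 𝒜.f X U) : 𝒜.E ⊆ t := by
  obtain ⟨x, hx, rfl⟩ := Finset.mem_image.1 ht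
  exact fun e he => Finset.mem_filter.2 ⟨hEU he, hX x hx e he⟩

theorem flags_pattern {q : Finset α × Finset α × Finset α} (hq : q ∈ 𝒜.flags X U k j) :
    q.2.2 ∈ patterns 𝒜.f X U := by
  have := (mem_flags.1 hq).2.2.2.1 ∅ (by simp)
  rwa [← Finset.bot_eq_empty, symmDiff_bot] at this

theorem card_flags_le_pow (k j : ℕ) :
    (𝒜.flags X U k j).card ≤
      2 ^ U.card * (2 ^ j * (d + 2).choose j * (patterns 𝒜.f X U).card) := by
  refine (Finset.card_filter_le _ _).trans ?_
  rw [Finset.card_product]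
  refine Nat.mul_le_mul ?_ ?_
  · rw [← Finset.card_powerset]
    exact Finset.card_le_card fun F hF =>
      Finset.mem_powerset.2 (Finset.mem_powersetCard.1 hF).1
  · refine card_cubes_le U _ (d + 2) j (fun t ht => patterns_subset ht) fun s hs => ?_
    have := card_of_shatters_patterns 𝒜.f X U s hs
    simp at this
    omega

theorem segment_face {t F : Finset α} {y y' : Fin (d + 1) → ℝ} {h : α} (hh : h ∈ U)
    (hF : h ∉ F) (ht : h ∉ t)
    (hy : 𝒜.Face U (insert h t) F y) (hy' : 𝒜.Face U t F y') :
    ∃ y, 𝒜.Face U t (insert h F) y := by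
  have e1 := hy.2 h hh hF
  have e2 := hy'.2 h hh hF
  rw [sg_of_mem (Finset.mem_insert_self _ _), one_mul] at e1
  rw [sg_of_notMem ht] at e2
  refine ⟨(-𝒜.f h y') • y + (𝒜.f h y) • y', fun g hg => ?_, fun g hg hgF => ?_⟩
  · rw [map_add, map_smul, map_smul, smul_eq_mul, smul_eq_mul]
    rcases Finset.mem_insert.1 hg with rfl | hg
    · ring
    · rw [hy.1 g hg, hy'.1 g hg]; ring
  · rw [Finset.mem_insert, not_or] at hgF
    have e3 := hy.2 g hg hgF.2
    have e4 := hy'.2 g hg hgF.2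
    rw [sg_congr (t' := t) (by simp [hgF.1])] at e3
    rw [map_add, map_smul, map_smul, smul_eq_mul, smul_eq_mul]
    have e5 := mul_pos (show 0 < -𝒜.f h y' by linarith) e3
    have e6 := mul_pos e1 e4
    linarith

theorem symmDiff_erase_inter {t S : Finset α} {h : α} (ht : t ⊆ U) (hS : h ∉ S) (hSU : S ⊆ U) :
    symmDiff (t.erase h) S = symmDiff t S ∩ (U.erase h) := by
  ext y
  simp only [Finset.mem_symmDiff, Finset.mem_erase, Finset.mem_inter]
  by_cases hy : y = h
  · subst hy; simp [hS]
  · have := @ht y; have := @hSU y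
    tauto

theorem erase_mem_flags {q : Finset α × Finset α × Finset α} (hq : q ∈ 𝒜.flags X U k j) {h : α}
    (hh : h ∉ q.1) : (q.1, q.2.1, q.2.2.erase h) ∈ 𝒜.flags X (U.erase h) k j := by
  have ht := patterns_subset (flags_pattern hq)
  rw [mem_flags] at hq ⊢
  obtain ⟨⟨h1, h2⟩, h3, h4, h5, y, hy⟩ := hq
  refine ⟨⟨fun g hg => Finset.mem_erase.2 ⟨fun e => hh (e ▸ hg), h1 hg⟩, h2⟩, h3, h4,
    fun S hS => ?_, y, hy.1, fun g hg hgF => ?_⟩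
  · dsimp only at hS ⊢
    rw [symmDiff_erase_inter ht (fun hm => hh (h3 (hS hm))) ((hS.trans h3).trans h1)]
    exact inter_mem_patterns (Finset.erase_subset _ _) (h5 S hS)
  · rw [Finset.mem_erase] at hg
    have := hy.2 g hg.2 hgF
    rwa [sg_congr (t' := q.2.2.erase h) (by simp [hg.1])] at this

theorem card_flags_notMem_le {h : α} (hh : h ∈ U) :
    ((𝒜.flags X U k j).filter fun q => h ∉ q.1).card ≤
      (𝒜.flags X (U.erase h) k j).card +
        ((𝒜.flags X U (k + 1) (j + 1)).filter fun q => h ∈ q.2.1).card := by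
  set A := (𝒜.flags X U k j).filter fun q => h ∉ q.1 with hA
  set A1 := A.filter fun q => h ∈ q.2.2 with hA1
  set A2 := A.filter fun q => h ∉ q.2.2 with hA2
  have hcard : A.card = A1.card + A2.card := by
    rw [hA1, hA2, Finset.card_filter_add_card_filter_not]
  set φ : Finset α × Finset α × Finset α → Finset α × Finset α × Finset α :=
    fun q => (q.1, q.2.1, q.2.2.erase h) with hφ
  have hmemA : ∀ q ∈ A, φ q ∈ 𝒜.flags X (U.erase h) k j := fun q hq =>
    erase_mem_flags (Finset.mem_filter.1 hq).1 (Finset.mem_filter.1 hq).2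
  have c1 : (A1.image φ).card = A1.card := by
    refine Finset.card_image_of_injOn fun q hq q' hq' e => ?_
    have m := (Finset.mem_filter.1 hq).2
    have m' := (Finset.mem_filter.1 hq').2
    simp only [hφ, Prod.mk.injEq] at e
    refine Prod.ext e.1 (Prod.ext e.2.1 ?_)
    rw [← Finset.insert_erase m, ← Finset.insert_erase m', e.2.2]
  have c2 : (A2.image φ).card = A2.card := by
    refine Finset.card_image_of_injOn fun q hq q' hq' e => ?_
    have m := (Finset.mem_filter.1 hq).2
    have m' := (Finset.mem_filter.1 hq').2
    simp only [hφ, Prod.mk.injEq] at e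
    refine Prod.ext e.1 (Prod.ext e.2.1 ?_)
    have := e.2.2
    rwa [Finset.erase_eq_of_notMem m, Finset.erase_eq_of_notMem m'] at this
  have c3 : (A1.image φ ∪ A2.image φ).card ≤ (𝒜.flags X (U.erase h) k j).card := by
    refine Finset.card_le_card (Finset.union_subset ?_ ?_) <;> intro q hq <;>
      obtain ⟨q', hq', rfl⟩ := Finset.mem_image.1 hq <;>
      exact hmemA _ (Finset.mem_filter.1 hq').1
  have c4 : (A1.image φ ∩ A2.image φ).card ≤
      ((𝒜.flags X U (k + 1) (j + 1)).filter fun q => h ∈ q.2.1).card := by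
    refine Finset.card_le_card_of_injOn (fun q => (insert h q.1, insert h q.2.1, q.2.2)) ?_ ?_
    · intro q hq
      rw [Finset.mem_coe, Finset.mem_inter, Finset.mem_image, Finset.mem_image] at hq
      obtain ⟨⟨q1, hq1, e1⟩, q2, hq2, e2⟩ := hq
      have hφ2 : φ q2 = q2 := by
        simp [hφ, Finset.erase_eq_of_notMem (Finset.mem_filter.1 hq2).2]
      rw [hφ2] at e2
      subst e2
      rw [hA1, Finset.mem_filter, hA, Finset.mem_filter] at hq1
      rw [hA2, Finset.mem_filter, hA, Finset.mem_filter] at hq2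
      obtain ⟨⟨m1, n1⟩, o1⟩ := hq1
      obtain ⟨⟨m2, n2⟩, o2⟩ := hq2
      obtain ⟨F1, J1, t1⟩ := q1
      obtain ⟨F2, J2, t2⟩ := q2
      simp only [hφ, Prod.mk.injEq] at e1
      obtain ⟨rfl, rfl, rfl⟩ := e1
      rw [mem_flags] at m1 m2
      dsimp only at m1 m2 n1 n2 o1 o2 ⊢
      obtain ⟨⟨a1, a2⟩, a3, a4, a5, y, hy⟩ := m1
      obtain ⟨-, -, -, b5, y', hy'⟩ := m2
      have hJ : h ∉ J1 := fun hm => n1 (a3 hm)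
      rw [Finset.mem_coe, Finset.mem_filter, mem_flags]
      refine ⟨⟨⟨Finset.insert_subset hh a1, ?_⟩, Finset.insert_subset_insert _ a3, ?_, ?_, ?_⟩,
        Finset.mem_insert_self _ _⟩
      · dsimp only; rw [Finset.card_insert_of_notMem n1, a2]
      · dsimp only; rw [Finset.card_insert_of_notMem hJ, a4]
      · intro S hS
        dsimp only at hS ⊢
        by_cases hhS : h ∈ S
        · have hS' : S.erase h ⊆ J1 := fun g hg =>
            (Finset.mem_insert.1 (hS (Finset.mem_of_mem_erase hg))).resolve_left
              (Finset.ne_of_mem_erase hg)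
          convert a5 (S.erase h) hS' using 1
          ext g
          simp only [Finset.mem_symmDiff, Finset.mem_erase]
          by_cases hg : g = h
          · subst hg; simp [hhS, o1]
          · simp [hg]
        · exact b5 S ((Finset.subset_insert_iff_of_notMem hhS).1 hS)
      · dsimp only
        refine segment_face hh n1 o2 (y := y) ?_ hy'
        rw [Finset.insert_erase o1]; exact hy
    · intro q hq q' hq' e
      rw [Finset.mem_coe, Finset.mem_inter, Finset.mem_image] at hq hq'
      obtain ⟨⟨q1, hq1, e1⟩, -⟩ := hq
      obtain ⟨⟨q2, hq2, e2⟩, -⟩ := hq'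
      have n1 : h ∉ q.1 := e1 ▸ (Finset.mem_filter.1 (Finset.mem_filter.1 hq1).1).2
      have n2 : h ∉ q'.1 := e2 ▸ (Finset.mem_filter.1 (Finset.mem_filter.1 hq2).1).2
      have s1 : q.2.1 ⊆ q.1 := e1 ▸
        (mem_flags.1 (Finset.mem_filter.1 (Finset.mem_filter.1 hq1).1).1).2.1
      have s2 : q'.2.1 ⊆ q'.1 := e2 ▸
        (mem_flags.1 (Finset.mem_filter.1 (Finset.mem_filter.1 hq2).1).1).2.1
      simp only [Prod.mk.injEq] at e
      refine Prod.ext ?_ (Prod.ext ?_ e.2.2)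
      · rw [← Finset.erase_insert n1, ← Finset.erase_insert n2, e.1]
      · rw [← Finset.erase_insert (fun hm => n1 (s1 hm)),
          ← Finset.erase_insert (fun hm => n2 (s2 hm)), e.2.1]
  have c5 := Finset.card_union_add_card_inter (A1.image φ) (A2.image φ)
  omega

theorem flags_recursion (k j : ℕ) :
    ((U \ 𝒜.E).card - k) * (𝒜.flags X U k j).card ≤
      ∑ h ∈ U \ 𝒜.E, (𝒜.flags X (U.erase h) k j).card +
        (j + 1) * (𝒜.flags X U (k + 1) (j + 1)).card := by
  have h1 : ((U \ 𝒜.E).card - k) * (𝒜.flags X U k j).card ≤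
      ∑ h ∈ U \ 𝒜.E, ((𝒜.flags X U k j).filter fun q => h ∉ q.1).card := by
    simp only [Finset.card_filter]
    rw [Finset.sum_comm, mul_comm, ← smul_eq_mul]
    refine Finset.card_nsmul_le_sum _ _ _ fun q hq => ?_
    rw [← Finset.card_filter]
    have hc := (mem_flags.1 hq).1.2
    have : (U \ 𝒜.E) \ q.1 = (U \ 𝒜.E).filter fun h => h ∉ q.1 := by
      ext; simp
    rw [← this]
    have := Finset.le_card_sdiff q.1 (U \ 𝒜.E)
    omega
  have h2 : ∑ h ∈ U \ 𝒜.E, ((𝒜.flags X U (k + 1) (j + 1)).filter fun q => h ∈ q.2.1).card ≤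
      (j + 1) * (𝒜.flags X U (k + 1) (j + 1)).card := by
    simp only [Finset.card_filter]
    rw [Finset.sum_comm, mul_comm, ← smul_eq_mul]
    refine Finset.sum_le_card_nsmul _ _ _ fun q hq => ?_
    rw [← Finset.card_filter]
    have hc := (mem_flags.1 hq).2.2.1
    rw [← hc]
    exact Finset.card_le_card fun h hh => (Finset.mem_filter.1 hh).2
  refine h1.trans (le_trans ?_ (Nat.add_le_add_left h2 _))
  rw [← Finset.sum_add_distrib]
  exact Finset.sum_le_sum fun h hh => card_flags_notMem_le (Finset.mem_sdiff.1 hh).1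

theorem card_flags_le_two_mul_of_bottom {S : Finset (Finset α × Finset α × Finset α)}
    (hS : ∀ q ∈ 𝒜.flags X U d j, ∃ q' ∈ S, ∃ b : Bool, q'.2 = q.2 ∧
      ∃ y, 𝒜.Face U q.2.2 q.1 y ∧ 𝒜.Bottom (if b then 1 else -1) q'.1 q.2.2 q.1 y) :
    (𝒜.flags X U d j).card ≤ 2 * S.card := by
  have hS' : ∀ q, ∃ p : (Finset α × Finset α × Finset α) × Bool, q ∈ 𝒜.flags X U d j →
      p.1 ∈ S ∧ p.1.2 = q.2 ∧ ∃ y, 𝒜.Face U q.2.2 q.1 y ∧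
        𝒜.Bottom (if p.2 then 1 else -1) p.1.1 q.2.2 q.1 y := by
    intro q
    by_cases hq : q ∈ 𝒜.flags X U d j
    · obtain ⟨q', hq', b, h⟩ := hS q hq
      exact ⟨(q', b), fun _ => ⟨hq', h⟩⟩
    · exact ⟨(q, true), fun h => absurd h hq⟩
  choose φ hφ using hS'
  have hle : (𝒜.flags X U d j).card ≤ (S ×ˢ (Finset.univ : Finset Bool)).card := by
    refine Finset.card_le_card_of_injOn φ ?_ ?_
    · intro q hq
      exact Finset.mem_product.2 ⟨(hφ q hq).1, Finset.mem_univ _⟩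
    · intro q hq q' hq' e
      obtain ⟨-, h2, y, hy, hb⟩ := hφ q hq
      obtain ⟨-, h2', y', hy', hb'⟩ := hφ q' hq'
      rw [e] at h2 hb
      have h3 : q.2 = q'.2 := h2.symm.trans h2'
      refine Prod.ext ?_ h3
      rw [h3] at hb hy
      exact (hb.unique hb' (mem_flags.1 hq).1.1 (mem_flags.1 hq').1.1 hy.nonneg hy'.nonneg).1
  refine hle.trans (le_of_eq ?_)
  rw [Finset.card_product]
  simp [mul_comm]

section Charging

variable (hX : ∀ x ∈ X, ∀ e ∈ 𝒜.E, 0 < 𝒜.f e x) (hEU : 𝒜.E ⊆ U)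
include hX hEU

theorem flags_exists_level {q : Finset α × Finset α × Finset α} (hq : q ∈ 𝒜.flags X U k j)
    (hk : k ≤ d) : ∃ y, 𝒜.Face U q.2.2 q.1 y ∧ 𝒜.level y = 1 := by
  have hE := subset_of_patterns hX hEU (flags_pattern hq)
  obtain ⟨⟨-, hc⟩, -, -, -, y, hy⟩ := mem_flags.1 hq
  exact hy.exists_level hEU hE (by omega)

theorem card_flags_pred_le (hd : 1 ≤ d) :
    (𝒜.flags X U (d - 1) j).card ≤ d * (𝒜.flags X U d j).card := by
  have hsub : 𝒜.flags X U (d - 1) j ⊆ (𝒜.flags X U d j).biUnion fun q =>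
      q.1.image fun g => (q.1.erase g, q.2) := by
    intro q hq
    have hE := subset_of_patterns hX hEU (flags_pattern hq)
    obtain ⟨y, hy, hl⟩ := flags_exists_level hX hEU hq (by omega)
    obtain ⟨⟨h1, h2⟩, h3, h4, h5, -⟩ := mem_flags.1 hq
    obtain ⟨Z, y', hZU, hb, hf⟩ := exists_bottom hEU hE h1 hy.nonneg hy.1 (ne_zero_of_level hl)
      one_ne_zero
    rw [Finset.mem_biUnion]
    refine ⟨(Z, q.2), mem_flags.2 ⟨⟨hZU, hb.card⟩, h3.trans hb.sub, h4, h5, y', hf⟩, ?_⟩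
    rw [Finset.mem_image]
    have hcs : (Z \ q.1).card = 1 := by
      rw [Finset.card_sdiff_of_subset hb.sub, hb.card, h2]; omega
    obtain ⟨g, hg⟩ := Finset.card_eq_one.1 hcs
    have hgm : g ∈ Z \ q.1 := by rw [hg]; simp
    refine ⟨g, (Finset.mem_sdiff.1 hgm).1, ?_⟩
    refine Prod.ext ?_ rfl
    dsimp only
    rw [← Finset.sdiff_singleton_eq_erase, ← hg, Finset.sdiff_sdiff_eq_self hb.sub]
  refine (Finset.card_le_card hsub).trans (Finset.card_biUnion_le.trans ?_)
  rw [mul_comm, ← smul_eq_mul]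
  refine Finset.sum_le_card_nsmul _ _ _ fun q hq => ?_
  refine Finset.card_image_le.trans ?_
  rw [(mem_flags.1 hq).1.2]

/-- The data of a flag at a vertex: normalised point and edge directions. -/
theorem flags_edge {q : Finset α × Finset α × Finset α} (hq : q ∈ 𝒜.flags X U d j) :
    ∃ y, ∃ z : α → Fin (d + 1) → ℝ, 𝒜.Face U q.2.2 q.1 y ∧ 𝒜.level y = 1 ∧
      ∀ g ∈ q.1, 𝒜.level (z g) = 0 ∧ 𝒜.f g (z g) = 1 ∧
      (∀ h ∈ q.1, h ≠ g → 𝒜.f h (z g) = 0) ∧ 𝒜.cost (z g) ≠ 0 := by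
  obtain ⟨y, hy, hl⟩ := flags_exists_level hX hEU hq le_rfl
  obtain ⟨z, hz⟩ := exists_edge (mem_flags.1 hq).1.2 hy.1 hl
  exact ⟨y, z, hy, hl, hz⟩

theorem card_flags_top_le (hd : 1 ≤ d) :
    (𝒜.flags X U d (d - 1)).card ≤ 2 * (cubes U (patterns 𝒜.f X U) (d - 1)).card := by
  have hS := card_flags_le_two_mul_of_bottom (𝒜 := 𝒜) (X := X) (U := U) (j := d - 1)
    (S := (cubes U (patterns 𝒜.f X U) (d - 1)).image fun p => (p.1, p)) ?_
  · exact hS.trans (Nat.mul_le_mul_left _ Finset.card_image_le)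
  intro q hq
  obtain ⟨y, z, hy, hl, hz⟩ := flags_edge hX hEU hq
  obtain ⟨⟨h1, h2⟩, h3, h4, h5, -⟩ := mem_flags.1 hq
  have hcs : (q.1 \ q.2.1).card = 1 := by
    rw [Finset.card_sdiff_of_subset h3, h2, h4]; omega
  obtain ⟨g, hg⟩ := Finset.card_eq_one.1 hcs
  have hgm : g ∈ q.1 \ q.2.1 := by rw [hg]; simp
  have hgq := (Finset.mem_sdiff.1 hgm).1
  have hne : sg q.2.2 g * 𝒜.cost (z g) ≠ 0 := mul_ne_zero sg_ne_zero (hz g hgq).2.2.2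
  refine ⟨(q.2.1, q.2), Finset.mem_image.2 ⟨q.2, mem_cubes.2 ⟨h3.trans h1, h4, h5⟩, rfl⟩,
    decide (0 < sg q.2.2 g * 𝒜.cost (z g)), rfl, y, hy, ?_⟩
  refine bottom_of_slopes h2 hy.1 hl hz h3 fun g' hg' hn => ?_
  have e : g' = g := by
    have : g' ∈ q.1 \ q.2.1 := Finset.mem_sdiff.2 ⟨hg', hn⟩
    rw [hg] at this
    simpa using this
  subst e
  by_cases hpos : 0 < sg q.2.2 g' * 𝒜.cost (z g')
  · simp [hpos]
  · have := lt_of_le_of_ne (not_lt.1 hpos) hne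
    simp [hpos, this]

theorem card_flags_le_two_mul (hj : j + 3 ≤ d) :
    (𝒜.flags X U d j).card ≤ 2 * (𝒜.flags X U (d - 2) j).card := by
  refine card_flags_le_two_mul_of_bottom ?_
  intro q hq
  obtain ⟨y, z, hy, hl, hz⟩ := flags_edge hX hEU hq
  obtain ⟨⟨h1, h2⟩, h3, h4, h5, -⟩ := mem_flags.1 hq
  have hcs : 2 < (q.1 \ q.2.1).card := by
    rw [Finset.card_sdiff_of_subset h3, h2, h4]; omega
  obtain ⟨g, hg, g', hg', hgg', hsgn⟩ := Finset.exists_ne_map_eq_of_card_lt_of_maps_to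
    (t := (Finset.univ : Finset Bool)) (by simpa using hcs)
    (f := fun g => decide (0 < sg q.2.2 g * 𝒜.cost (z g))) (fun _ _ => Finset.mem_univ _)
  rw [Finset.mem_sdiff] at hg hg'
  set F := (q.1.erase g).erase g' with hF
  have hFq : F ⊆ q.1 := (Finset.erase_subset _ _).trans (Finset.erase_subset _ _)
  have hmF : ∀ h ∈ q.1, h ∉ F → h = g ∨ h = g' := by
    intro h hh hn
    by_contra hno
    push Not at hno
    exact hn (Finset.mem_erase.2 ⟨hno.2, Finset.mem_erase.2 ⟨hno.1, hh⟩⟩)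
  have hgF : g ∉ F := by simp [hF]
  have hgF' : g' ∉ F := by simp [hF]
  have hFc : F.card = d - 2 := by
    rw [hF, Finset.card_erase_of_mem (Finset.mem_erase.2 ⟨hgg'.symm, hg'.1⟩),
      Finset.card_erase_of_mem hg.1, h2]
    omega
  have hJF : q.2.1 ⊆ F := by
    intro h hh
    refine Finset.mem_erase.2 ⟨fun e => hg'.2 (e ▸ hh), Finset.mem_erase.2
      ⟨fun e => hg.2 (e ▸ hh), h3 hh⟩⟩
  refine ⟨(F, q.2), ?_, decide (0 < sg q.2.2 g * 𝒜.cost (z g)), rfl, y, hy, ?_⟩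
  · rw [mem_flags]
    refine ⟨⟨hFq.trans h1, hFc⟩, hJF, h4, h5, ?_⟩
    set v := sg q.2.2 g • z g + sg q.2.2 g' • z g' with hv
    obtain ⟨s, hs, hpos⟩ := exists_pos_forall_pos (U \ q.1) (fun h => sg q.2.2 h * 𝒜.f h y)
      (fun h => sg q.2.2 h * 𝒜.f h v) fun h hh =>
        hy.2 h (Finset.mem_sdiff.1 hh).1 (Finset.mem_sdiff.1 hh).2
    refine ⟨y + s • v, fun h hh => ?_, fun h hh hhF => ?_⟩
    · have e1 : h ≠ g := fun e => hgF (e ▸ hh)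
      have e2 : h ≠ g' := fun e => hgF' (e ▸ hh)
      simp only [hv, map_add, map_smul, hy.1 h (hFq hh), (hz g hg.1).2.2.1 h (hFq hh) e1,
        (hz g' hg'.1).2.2.1 h (hFq hh) e2, smul_zero, add_zero]
    · by_cases hhq : h ∈ q.1
      · rcases hmF h hhq hhF with rfl | rfl
        · simp only [hv, map_add, map_smul, hy.1 h hhq, (hz h hg.1).2.1,
            (hz g' hg'.1).2.2.1 h hhq hgg', smul_eq_mul, zero_add, mul_one]
          have := sg_mul_self (t := q.2.2) (h := h)
          nlinarith
        · simp only [hv, map_add, map_smul, hy.1 h hhq, (hz h hg'.1).2.1,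
            (hz g hg.1).2.2.1 h hhq hgg'.symm, smul_eq_mul, zero_add, mul_one]
          have := sg_mul_self (t := q.2.2) (h := h)
          nlinarith
      · have := hpos h (Finset.mem_sdiff.2 ⟨hh, hhq⟩)
        rw [map_add, map_smul, smul_eq_mul]
        dsimp only
        linarith
  · refine bottom_of_slopes h2 hy.1 hl hz hFq fun h hh hn => ?_
    have hne : sg q.2.2 h * 𝒜.cost (z h) ≠ 0 := mul_ne_zero sg_ne_zero (hz h hh).2.2.2
    have hsame : decide (0 < sg q.2.2 g * 𝒜.cost (z g)) =
        decide (0 < sg q.2.2 h * 𝒜.cost (z h)) := by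
      rcases hmF h hh hn with rfl | rfl
      · rfl
      · exact hsgn
    rw [hsame]
    by_cases hpos : 0 < sg q.2.2 h * 𝒜.cost (z h)
    · simp [hpos]
    · have := lt_of_le_of_ne (not_lt.1 hpos) hne
      simp [hpos, this]

end Charging

end GenericArrangement

theorem succ_pow_le_descFactorial {n k : ℕ} (h : k + 1 ≤ n) :
    (n + 1) ^ (k + 1) ≤ (k + 2) ^ (k + 1) * n.descFactorial (k + 1) := by
  have h1 := Nat.pow_sub_le_descFactorial n (k + 1)
  have h2 : n + 1 ≤ (k + 2) * (n + 1 - (k + 1)) := by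
    obtain ⟨m, rfl⟩ := Nat.exists_eq_add_of_le h
    rw [show k + 1 + m + 1 - (k + 1) = m + 1 by omega]
    nlinarith [Nat.zero_le (k * m)]
  calc (n + 1) ^ (k + 1) ≤ ((k + 2) * (n + 1 - (k + 1))) ^ (k + 1) := Nat.pow_le_pow_left h2 _
    _ = (k + 2) ^ (k + 1) * (n + 1 - (k + 1)) ^ (k + 1) := mul_pow _ _ _
    _ ≤ _ := Nat.mul_le_mul_left _ h1

theorem recursion_bound {α : Type*} {K k : ℕ} {c₀ G : ℝ} (hc₀ : 0 ≤ c₀) (hG : 0 ≤ G)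
    {L S : ℕ → ℝ} (hS0 : ∀ n, 0 ≤ S n)
    (hSm : ∀ n, S n ≤ S (n + 1))
    (hS : ∀ n : ℕ, ((n : ℝ) + 2) ^ K * L (n + 1) ≤ ((n : ℝ) + 2) ^ (k + 1) * (S (n + 1) - S n))
    (P : Finset α → Prop) (hP : ∀ R, P R → ∀ h ∈ R, P (R.erase h)) (φ : Finset α → ℝ)
    (hbase : ∀ R, P R → R.card ≤ k → φ R ≤ c₀)
    (hrec : ∀ R, P R → k < R.card → ((R.card : ℝ) - k) * φ R ≤
      ∑ h ∈ R, φ (R.erase h) + G * (((R.card : ℝ) + 1) ^ K * L R.card)) (R : Finset α)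
    (hR : P R) :
    φ R ≤ ((R.card : ℝ) + 1) ^ k * (c₀ + G * (k + 2) ^ (k + 1) * S R.card) := by
  set s : ℕ → ℝ := fun n => c₀ + G * (k + 2) ^ (k + 1) * S n with hs
  have hs0 : ∀ n, c₀ ≤ s n := fun n =>
    le_add_of_nonneg_right (mul_nonneg (by positivity) (hS0 n))
  have key : ∀ m : ℕ, ∀ R, P R → R.card = k + m →
      φ R ≤ ((k + m).descFactorial k : ℝ) * s (k + m) := by
    intro m
    induction m with
    | zero =>
      intro R hR hc
      have h1 : (1 : ℝ) ≤ ((k + 0).descFactorial k : ℝ) := by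
        exact_mod_cast Nat.pos_of_ne_zero (by simp [Nat.descFactorial_self, Nat.factorial_ne_zero])
      refine (hbase R hR (by omega)).trans ((hs0 (k + 0)).trans ?_)
      nlinarith [hc₀.trans (hs0 (k + 0))]
    | succ m ih =>
      intro R hR hc
      set N := k + m with hN
      rw [show k + (m + 1) = N + 1 by omega] at hc ⊢
      have h1 := hrec R hR (by omega)
      have h2 : ∑ h ∈ R, φ (R.erase h) ≤ ((N : ℝ) + 1) * ((N.descFactorial k : ℝ) * s N) := by
        refine (Finset.sum_le_card_nsmul R _ _ fun h hh =>
          ih _ (hP R hR h hh) (by rw [Finset.card_erase_of_mem hh, hc]; omega)).trans ?_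
        rw [hc, nsmul_eq_mul]; push_cast; rfl
      have h3 : ((N : ℝ) + 1 - k) * ((N + 1).descFactorial k : ℝ) =
          (N + 1) * (N.descFactorial k : ℝ) := by
        have := Nat.succ_descFactorial N k
        have h' : ((N + 1 - k : ℕ) : ℝ) = (N : ℝ) + 1 - k := by
          rw [Nat.cast_sub (by omega)]; push_cast; ring
        rw [← h']; exact_mod_cast this
      have h4 : ((N + 1).descFactorial (k + 1) : ℝ) =
          ((N : ℝ) + 1 - k) * ((N + 1).descFactorial k : ℝ) := by
        have h' : ((N + 1 - k : ℕ) : ℝ) = (N : ℝ) + 1 - k := by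
          rw [Nat.cast_sub (by omega)]; push_cast; ring
        rw [Nat.descFactorial_succ, ← h']; push_cast; ring
      have h5 : ((N : ℝ) + 2) ^ (k + 1) ≤
          (k + 2) ^ (k + 1) * ((N + 1).descFactorial (k + 1) : ℝ) := by
        have := succ_pow_le_descFactorial (n := N + 1) (k := k) (by omega)
        have h' : (((N + 1 + 1) ^ (k + 1) : ℕ) : ℝ) ≤
          (((k + 2) ^ (k + 1) * (N + 1).descFactorial (k + 1) : ℕ) : ℝ) := by exact_mod_cast this
        push_cast at h'
        rw [show (N : ℝ) + 1 + 1 = N + 2 by ring] at h'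
        exact h'
      have hpos : 0 < (N : ℝ) + 1 - k := by
        rw [hN]; push_cast; linarith [(Nat.cast_nonneg m : (0 : ℝ) ≤ m)]
      have h6 : G * (((N : ℝ) + 2) ^ K * L (N + 1)) ≤ ((N : ℝ) + 1 - k) *
          ((N + 1).descFactorial k : ℝ) * (s (N + 1) - s N) := by
        rw [← h4]
        calc G * (((N : ℝ) + 2) ^ K * L (N + 1))
            ≤ G * (((N : ℝ) + 2) ^ (k + 1) * (S (N + 1) - S N)) :=
              mul_le_mul_of_nonneg_left (hS N) hG
          _ ≤ G * ((k + 2) ^ (k + 1) * ((N + 1).descFactorial (k + 1) : ℝ) *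
                (S (N + 1) - S N)) := by
              have := sub_nonneg.2 (hSm N)
              gcongr
          _ = _ := by simp only [hs]; ring
      rw [hc] at h1
      push_cast at h1
      rw [show (N : ℝ) + 1 + 1 = N + 2 by ring] at h1
      refine le_of_mul_le_mul_left ?_ hpos
      have h7 : ((N : ℝ) + 1 - k) * ((N + 1).descFactorial k : ℝ) * s N =
          (N + 1) * ((N.descFactorial k : ℝ) * s N) := by rw [h3]; ring
      linarith
  have hs' := hc₀.trans (hs0 R.card)
  rcases le_or_gt R.card k with h | h
  · refine (hbase R hR h).trans ((hs0 R.card).trans ?_)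
    refine le_mul_of_one_le_left hs' (one_le_pow₀ (by linarith [(Nat.cast_nonneg R.card : (0 : ℝ) ≤ _)]))
  · obtain ⟨m, hm⟩ := Nat.exists_eq_add_of_le h.le
    refine (key m R hR hm).trans ?_
    rw [← hm]
    refine mul_le_mul_of_nonneg_right ?_ hs'
    calc (R.card.descFactorial k : ℝ) ≤ ((R.card ^ k : ℕ) : ℝ) := by
          exact_mod_cast Nat.descFactorial_le_pow _ _
      _ ≤ _ := by push_cast; gcongr; linarith

theorem growth_log {K k : ℕ} (hk : k ≤ K) (n : ℕ) : ((n : ℝ) + 2) ^ K * 1 ≤ ((n : ℝ) + 2) ^ (k + 1) *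
    (((((n + 1 : ℕ) : ℝ) + 1) ^ (K - k) * (1 + Real.log (((n + 1 : ℕ) : ℝ) + 1))) -
      ((n : ℝ) + 1) ^ (K - k) * (1 + Real.log ((n : ℝ) + 1))) := by
  obtain ⟨M, rfl⟩ := Nat.exists_eq_add_of_le hk
  have hn : (0 : ℝ) ≤ n := Nat.cast_nonneg n
  rw [Nat.add_sub_cancel_left]
  push_cast
  rw [show (n : ℝ) + 1 + 1 = n + 2 by ring]
  have hl : 1 / ((n : ℝ) + 2) ≤ Real.log (n + 2) - Real.log (n + 1) := by
    have := Real.log_le_sub_one_of_pos (show (0 : ℝ) < (n + 1) / (n + 2) by positivity)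
    rw [Real.log_div (by positivity) (by positivity)] at this
    have e : ((n : ℝ) + 1) / (n + 2) - 1 = -(1 / (n + 2)) := by field_simp; ring
    linarith
  have hl1 : 0 ≤ Real.log ((n : ℝ) + 1) := Real.log_nonneg (by linarith)
  have h1 : ((n : ℝ) + 1) ^ M * (1 + Real.log (n + 1)) ≤
      ((n : ℝ) + 2) ^ M * (1 + Real.log (n + 1)) := by
    gcongr; linarith
  have h2 : ((n : ℝ) + 2) ^ M * (1 / (n + 2)) ≤
      ((n : ℝ) + 2) ^ M * (Real.log (n + 2) - Real.log (n + 1)) := by gcongr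
  calc ((n : ℝ) + 2) ^ (k + M) * 1 =
      ((n : ℝ) + 2) ^ (k + 1) * (((n : ℝ) + 2) ^ M * (1 / (n + 2))) := by
        field_simp; ring
    _ ≤ _ := by
        refine mul_le_mul_of_nonneg_left ?_ (by positivity)
        linarith

theorem growth_pow {K k : ℕ} (hk : k + 1 ≤ K) (n : ℕ) :
    ((n : ℝ) + 2) ^ K * (1 + Real.log (((n + 1 : ℕ) : ℝ) + 1)) ≤ ((n : ℝ) + 2) ^ (k + 1) *
    (((((n + 1 : ℕ) : ℝ) + 1) ^ (K - k) * (1 + Real.log (((n + 1 : ℕ) : ℝ) + 1))) -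
      ((n : ℝ) + 1) ^ (K - k) * (1 + Real.log ((n : ℝ) + 1))) := by
  obtain ⟨M, rfl⟩ := Nat.exists_eq_add_of_le hk
  have hn : (0 : ℝ) ≤ n := Nat.cast_nonneg n
  rw [show k + 1 + M - k = M + 1 by omega]
  push_cast
  rw [show (n : ℝ) + 1 + 1 = n + 2 by ring]
  have hl1 : 0 ≤ Real.log ((n : ℝ) + 1) := Real.log_nonneg (by linarith)
  have hl : Real.log ((n : ℝ) + 1) ≤ Real.log (n + 2) :=
    Real.log_le_log (by linarith) (by linarith)
  have h1 : ((n : ℝ) + 1) ^ (M + 1) * (1 + Real.log (n + 1)) ≤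
      (((n : ℝ) + 2) ^ M * (n + 1)) * (1 + Real.log (n + 2)) := by
    rw [pow_succ]
    gcongr
    linarith
  calc ((n : ℝ) + 2) ^ (k + 1 + M) * (1 + Real.log (n + 2)) =
      ((n : ℝ) + 2) ^ (k + 1) * (((n : ℝ) + 2) ^ M * (1 + Real.log (n + 2))) := by ring
    _ ≤ _ := by
        refine mul_le_mul_of_nonneg_left ?_ (by positivity)
        rw [pow_succ (_ + 2 : ℝ)]
        linarith

theorem growth_mono (M n : ℕ) : ((n : ℝ) + 1) ^ M * (1 + Real.log ((n : ℝ) + 1)) ≤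
    (((n + 1 : ℕ) : ℝ) + 1) ^ M * (1 + Real.log (((n + 1 : ℕ) : ℝ) + 1)) := by
  have hn : (0 : ℝ) ≤ n := Nat.cast_nonneg n
  have hl1 : 0 ≤ Real.log ((n : ℝ) + 1) := Real.log_nonneg (by linarith)
  push_cast
  gcongr <;> linarith

namespace GenericArrangement

/-- The number of flags of type `(k, j)` grows at most like `n ^ K * L n` if the number of
patterns grows at most like `n ^ K`. -/
def FlagBound (d K k j : ℕ) (L : ℕ → ℝ) : Prop :=
  ∃ C : ℝ, 0 ≤ C ∧ ∀ (α : Type) (𝒜 : GenericArrangement d α) (X : Finset (Fin (d + 1) → ℝ)) (A : ℝ),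
    (∀ x ∈ X, ∀ e ∈ 𝒜.E, 0 < 𝒜.f e x) →
    (∀ R : Finset α, Disjoint R 𝒜.E →
      ((patterns 𝒜.f X (𝒜.E ∪ R)).card : ℝ) ≤ A * ((R.card : ℝ) + 1) ^ K) →
    ∀ R : Finset α, Disjoint R 𝒜.E → ((𝒜.flags X (𝒜.E ∪ R) k j).card : ℝ) ≤
      C * A * (((R.card : ℝ) + 1) ^ K * L R.card)

variable {d K k j : ℕ}

theorem nonneg_of_pattern_bound {α : Type} {𝒜 : GenericArrangement d α}
    {X : Finset (Fin (d + 1) → ℝ)} {A : ℝ}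
    (h : ∀ R : Finset α, Disjoint R 𝒜.E →
      ((patterns 𝒜.f X (𝒜.E ∪ R)).card : ℝ) ≤ A * ((R.card : ℝ) + 1) ^ K) : 0 ≤ A := by
  have := h ∅ (by simp)
  simp at this
  exact (Nat.cast_nonneg _).trans this

theorem FlagBound.step {L S : ℕ → ℝ} (hkK : k ≤ K) (h : FlagBound d K (k + 1) (j + 1) L)
    (hS1 : ∀ n, 1 ≤ S n)
    (hSm : ∀ n : ℕ, ((n : ℝ) + 1) ^ (K - k) * S n ≤ (((n + 1 : ℕ) : ℝ) + 1) ^ (K - k) * S (n + 1))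
    (hS : ∀ n : ℕ, ((n : ℝ) + 2) ^ K * L (n + 1) ≤ ((n : ℝ) + 2) ^ (k + 1) *
      (((((n + 1 : ℕ) : ℝ) + 1) ^ (K - k) * S (n + 1)) - ((n : ℝ) + 1) ^ (K - k) * S n)) :
    FlagBound d K k j S := by
  obtain ⟨C, hC, h⟩ := h
  set B : ℝ := 2 ^ (d + 1 + k) * (2 ^ j * (d + 2).choose j * ((k : ℝ) + 1) ^ K) with hB
  refine ⟨B + (j + 1) * C * (k + 2) ^ (k + 1), by positivity, fun α 𝒜 X A hX hA R hR => ?_⟩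
  have hA0 := nonneg_of_pattern_bound hA
  have key := recursion_bound (K := K) (k := k) (c₀ := A * B) (G := (j + 1) * (C * A)) (L := L)
    (S := fun n => ((n : ℝ) + 1) ^ (K - k) * S n)
    (by positivity) (by positivity) (fun n => mul_nonneg (by positivity) (by linarith [hS1 n])) hSm hS
    (fun R : Finset α => Disjoint R 𝒜.E) (fun R hR h _ => hR.mono_left (Finset.erase_subset _ _))
    (fun R => ((𝒜.flags X (𝒜.E ∪ R) k j).card : ℝ)) ?_ ?_ R hR
  · refine key.trans ?_
    have hn : (0 : ℝ) ≤ R.card := Nat.cast_nonneg _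
    have e : ((R.card : ℝ) + 1) ^ K = ((R.card : ℝ) + 1) ^ k * ((R.card : ℝ) + 1) ^ (K - k) := by
      rw [← pow_add]; congr 1; omega
    rw [e]
    have h1 : 1 ≤ ((R.card : ℝ) + 1) ^ (K - k) * S R.card :=
      one_le_mul_of_one_le_of_one_le (one_le_pow₀ (by linarith)) (hS1 _)
    have h2 : A * B * 1 ≤ A * B * (((R.card : ℝ) + 1) ^ (K - k) * S R.card) :=
      mul_le_mul_of_nonneg_left h1 (by positivity)
    calc _ ≤ ((R.card : ℝ) + 1) ^ k * (A * B * (((R.card : ℝ) + 1) ^ (K - k) * S R.card) +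
          (j + 1) * (C * A) * (k + 2) ^ (k + 1) * (((R.card : ℝ) + 1) ^ (K - k) * S R.card)) := by
            refine mul_le_mul_of_nonneg_left ?_ (by positivity)
            linarith
      _ = _ := by ring
  · intro R hR hc
    have h1 := 𝒜.card_flags_le_pow (X := X) (U := 𝒜.E ∪ R) k j
    have h2 : (𝒜.E ∪ R).card ≤ d + 1 + k := by
      refine (Finset.card_union_le _ _).trans ?_
      rw [𝒜.card_E]; omega
    have h3 : ((patterns 𝒜.f X (𝒜.E ∪ R)).card : ℝ) ≤ A * ((k : ℝ) + 1) ^ K :=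
      (hA R hR).trans (by gcongr)
    calc ((𝒜.flags X (𝒜.E ∪ R) k j).card : ℝ) ≤ ((2 ^ (𝒜.E ∪ R).card * (2 ^ j * (d + 2).choose j *
          (patterns 𝒜.f X (𝒜.E ∪ R)).card) : ℕ) : ℝ) := by exact_mod_cast h1
      _ ≤ 2 ^ (d + 1 + k) * (2 ^ j * (d + 2).choose j * (A * ((k : ℝ) + 1) ^ K)) := by
          push_cast
          gcongr
          norm_num
      _ = A * B := by rw [hB]; ring
  · intro R hR hc
    have h1 := flags_recursion (𝒜 := 𝒜) (X := X) (U := 𝒜.E ∪ R) k j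
    have e1 : (𝒜.E ∪ R) \ 𝒜.E = R := by
      rw [Finset.union_sdiff_cancel_left hR.symm]
    rw [e1] at h1
    have h2 : (((R.card - k : ℕ) * (𝒜.flags X (𝒜.E ∪ R) k j).card : ℕ) : ℝ) ≤ ((
      ∑ h ∈ R, (𝒜.flags X ((𝒜.E ∪ R).erase h) k j).card +
        (j + 1) * (𝒜.flags X (𝒜.E ∪ R) (k + 1) (j + 1)).card : ℕ) : ℝ) := by exact_mod_cast h1
    rw [Nat.cast_mul, Nat.cast_sub hc.le] at h2
    refine h2.trans ?_
    push_cast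
    refine add_le_add (le_of_eq (Finset.sum_congr rfl fun h hh => ?_)) ?_
    · rw [Finset.erase_union_distrib, Finset.erase_eq_of_notMem (Finset.disjoint_left.1 hR hh)]
    · rw [mul_assoc]
      exact mul_le_mul_of_nonneg_left (h α 𝒜 X A hX hA R hR) (by positivity)

theorem flagBound_top (hd : 1 ≤ d) : FlagBound d K d (d - 1) fun _ => 1 := by
  refine ⟨2 * (2 ^ (d - 1) * (d + 2).choose (d - 1)), by positivity,
    fun α 𝒜 X A hX hA R hR => ?_⟩
  have h1 := card_flags_top_le hX (Finset.subset_union_left (s₂ := R)) hd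
  have h2 := card_cubes_le (𝒜.E ∪ R) (patterns 𝒜.f X (𝒜.E ∪ R)) (d + 2) (d - 1)
    (fun t ht => patterns_subset ht) fun s hs => by
      have := card_of_shatters_patterns 𝒜.f X (𝒜.E ∪ R) s hs
      simp at this
      omega
  have h3 := h1.trans (Nat.mul_le_mul_left 2 h2)
  calc ((𝒜.flags X (𝒜.E ∪ R) d (d - 1)).card : ℝ) ≤ ((2 * (2 ^ (d - 1) * (d + 2).choose (d - 1) *
        (patterns 𝒜.f X (𝒜.E ∪ R)).card) : ℕ) : ℝ) := by exact_mod_cast h3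
    _ ≤ 2 * (2 ^ (d - 1) * (d + 2).choose (d - 1) * (A * ((R.card : ℝ) + 1) ^ K)) := by
        push_cast
        gcongr
        exact hA R hR
    _ = _ := by ring

theorem FlagBound.of_le {L : ℕ → ℝ} {k' : ℕ} {c : ℕ} (h : FlagBound d K k' j L)
    (hle : ∀ (α : Type) (𝒜 : GenericArrangement d α) (X : Finset (Fin (d + 1) → ℝ)) (U : Finset α),
      (∀ x ∈ X, ∀ e ∈ 𝒜.E, 0 < 𝒜.f e x) → 𝒜.E ⊆ U →
      (𝒜.flags X U k j).card ≤ c * (𝒜.flags X U k' j).card) : FlagBound d K k j L := by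
  obtain ⟨C, hC, h⟩ := h
  refine ⟨c * C, by positivity, fun α 𝒜 X A hX hA R hR => ?_⟩
  have h1 := hle α 𝒜 X _ hX (Finset.subset_union_left (s₂ := R))
  have h2 := h α 𝒜 X A hX hA R hR
  calc ((𝒜.flags X (𝒜.E ∪ R) k j).card : ℝ) ≤ c * ((𝒜.flags X (𝒜.E ∪ R) k' j).card : ℝ) := by
        exact_mod_cast h1
    _ ≤ c * (C * A * (((R.card : ℝ) + 1) ^ K * L R.card)) := by gcongr
    _ = _ := by ring

theorem flagBound (hd : 3 ≤ d) (hK : d - 1 ≤ K) :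
    FlagBound d K d 0 fun n => 1 + Real.log ((n : ℝ) + 1) := by
  have hlog : ∀ n : ℕ, 1 ≤ 1 + Real.log ((n : ℝ) + 1) := fun n =>
    le_add_of_nonneg_right (Real.log_nonneg (by linarith [(Nat.cast_nonneg n : (0 : ℝ) ≤ n)]))
  have key : ∀ i, i ≤ d - 2 →
      FlagBound d K (d - 1) (d - 2 - i) fun n => 1 + Real.log ((n : ℝ) + 1) := by
    intro i
    induction i with
    | zero =>
      intro _
      have h := flagBound_top (d := d) (K := K) (by omega)
      rw [show d - 1 = d - 2 + 1 by omega] at h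
      refine FlagBound.step (k := d - 1) (L := fun _ => 1) hK ?_ hlog (growth_mono _)
        (growth_log hK)
      rw [show d - 1 + 1 = d by omega]
      exact h
    | succ i ih =>
      intro hi
      have h := ih (by omega)
      have h1 : FlagBound d K (d - 2) (d - 2 - (i + 1)) fun n => 1 + Real.log ((n : ℝ) + 1) := by
        refine FlagBound.step (L := fun n => 1 + Real.log ((n : ℝ) + 1)) (by omega) ?_ hlog
          (growth_mono _) (growth_pow (by omega))
        rw [show d - 2 + 1 = d - 1 by omega, show d - 2 - (i + 1) + 1 = d - 2 - i by omega]
        exact h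
      have h2 : FlagBound d K d (d - 2 - (i + 1)) fun n => 1 + Real.log ((n : ℝ) + 1) :=
        h1.of_le fun α 𝒜 X U hX hE => card_flags_le_two_mul hX hE (by omega)
      exact h2.of_le fun α 𝒜 X U hX hE => card_flags_pred_le hX hE (by omega)
  have h0 : FlagBound d K (d - 2) 0 fun n => 1 + Real.log ((n : ℝ) + 1) := by
    refine FlagBound.step (L := fun n => 1 + Real.log ((n : ℝ) + 1)) (by omega) ?_ hlog
      (growth_mono _) (growth_pow (by omega))
    rw [show d - 2 + 1 = d - 1 by omega]
    have := key (d - 3) (by omega)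
    rwa [show d - 2 - (d - 3) = 0 + 1 by omega] at this
  exact h0.of_le fun α 𝒜 X U hX hE => card_flags_le_two_mul hX hE (by omega)

end GenericArrangement

namespace GenericArrangement

variable {d : ℕ} {α : Type} (𝒜 : GenericArrangement d α)

/-- The normalised point on which all functionals in `Z` vanish. -/
def vert (Z : Finset α) : Fin (d + 1) → ℝ :=
  if h : ∃ y, 𝒜.level y = 1 ∧ ∀ h ∈ Z, 𝒜.f h y = 0 then h.choose else 0

/-- Combinatorial description of a simplicial cone of a bottom-vertex triangulation: `τ.1 i` is the
set of functionals vanishing on the `i`-th ray, and the cone is pulled successively from the faces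
cut out by `τ.2`. -/
abbrev Config (d : ℕ) (α : Type) := (Fin (d + 1) → Finset α) × (Fin d → α)

/-- The functionals that vanish on the `i`-th face of a configuration. -/
def Config.face (τ : Config d α) (i : ℕ) : Finset α :=
  (Finset.univ.filter fun j : Fin d => (j : ℕ) < i).image τ.2

theorem Config.mem_face {τ : Config d α} {i : ℕ} {h : α} :
    h ∈ τ.face i ↔ ∃ j : Fin d, (j : ℕ) < i ∧ τ.2 j = h := by
  simp [Config.face]

theorem Config.face_congr {τ τ' : Config d α} {i : ℕ}
    (h : ∀ j : Fin d, (j : ℕ) < i → τ.2 j = τ'.2 j) : τ.face i = τ'.face i := by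
  ext g
  simp only [Config.mem_face]
  constructor
  · rintro ⟨j, hj, rfl⟩; exact ⟨j, hj, (h j hj).symm⟩
  · rintro ⟨j, hj, rfl⟩; exact ⟨j, hj, h j hj⟩

theorem Config.face_succ (τ : Config d α) {i : ℕ} (hi : i < d) :
    τ.face (i + 1) = insert (τ.2 ⟨i, hi⟩) (τ.face i) := by
  ext g
  simp only [Config.mem_face, Finset.mem_insert]
  constructor
  · rintro ⟨j, hj, rfl⟩
    rcases Nat.lt_succ_iff_lt_or_eq.1 hj with h | h
    · exact Or.inr ⟨j, h, rfl⟩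
    · subst h; exact Or.inl rfl
  · rintro (rfl | ⟨j, hj, rfl⟩)
    · exact ⟨⟨i, hi⟩, by simp, rfl⟩
    · exact ⟨j, by omega, rfl⟩

/-- The `i`-th ray of the configuration is a valid bottom vertex for the cell with pattern `t`. -/
structure GoodAt (U t : Finset α) (τ : Config d α) (i : Fin (d + 1)) : Prop where
  sub : τ.1 i ⊆ U
  bottom : 𝒜.Bottom 1 (τ.face i) t (τ.1 i) (𝒜.vert (τ.1 i))
  nonneg : ∀ h ∈ U, 0 ≤ sg t h * 𝒜.f h (𝒜.vert (τ.1 i))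
  notMem : ∀ hi : (i : ℕ) < d, τ.2 ⟨i, hi⟩ ∉ τ.1 i

/-- The configuration is a cone of the triangulation of the cell with pattern `t`. -/
def Good (U t : Finset α) (τ : Config d α) : Prop := ∀ i, 𝒜.GoodAt U t τ i

variable {𝒜} {U t : Finset α} {τ : Config d α}

theorem vert_eq {Z : Finset α} {y : Fin (d + 1) → ℝ} (hZ : Z.card = d)
    (hy : ∀ h ∈ Z, 𝒜.f h y = 0) (hl : 𝒜.level y = 1) : 𝒜.vert Z = y := by
  have h : ∃ y, 𝒜.level y = 1 ∧ ∀ h ∈ Z, 𝒜.f h y = 0 := ⟨y, hl, hy⟩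
  unfold vert
  rw [dif_pos h]
  have := eq_smul_of_zero hZ hy hl h.choose_spec.2
  rwa [h.choose_spec.1, one_smul] at this

theorem GoodAt.pos {i : Fin (d + 1)} (h : 𝒜.GoodAt U t τ i) {g : α} (hg : g ∈ U)
    (hgZ : g ∉ τ.1 i) : 0 < sg t g * 𝒜.f g (𝒜.vert (τ.1 i)) :=
  lt_of_le_of_ne (h.nonneg g hg)
    (mul_ne_zero sg_ne_zero (apply_ne_zero h.bottom.card h.bottom.zero h.bottom.level hgZ)).symm

theorem Good.face_sub_of_lt (h : 𝒜.Good U t τ) {i : Fin d} {j : Fin (d + 1)}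
    (hij : (i : ℕ) < j) : τ.2 i ∈ τ.1 j :=
  (h j).bottom.sub (Config.mem_face.2 ⟨i, hij, rfl⟩)

theorem Good.mem (h : 𝒜.Good U t τ) (i : Fin d) : τ.2 i ∈ U :=
  (h (Fin.last d)).sub (h.face_sub_of_lt (by simp))

theorem Good.last_eq (h : 𝒜.Good U t τ) {g : α} (hg : g ∈ τ.1 (Fin.last d)) :
    ∃ j, τ.2 j = g := by
  have hinj : Function.Injective τ.2 := by
    have key : ∀ i j : Fin d, i < j → τ.2 i ≠ τ.2 j := by
      intro i j hij e
      have h1 := h.face_sub_of_lt (i := i) (j := j.castSucc) (by simpa using hij)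
      rw [e] at h1
      exact (h j.castSucc).notMem (by simp) h1
    intro i j e
    rcases lt_trichotomy i j with hlt | rfl | hlt
    · exact absurd e (key i j hlt)
    · rfl
    · exact absurd e.symm (key j i hlt)
  have hsub : Finset.univ.image τ.2 ⊆ τ.1 (Fin.last d) := by
    intro g hg
    obtain ⟨j, -, rfl⟩ := Finset.mem_image.1 hg
    exact h.face_sub_of_lt (by simp)
  have heq := Finset.eq_of_subset_of_card_le hsub (by
    rw [(h _).bottom.card, Finset.card_image_of_injective _ hinj]; simp)
  rw [← heq] at hg
  obtain ⟨j, -, hj⟩ := Finset.mem_image.1 hg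
  exact ⟨j, hj⟩

theorem Good.linearIndependent (h : 𝒜.Good U t τ) :
    LinearIndependent ℝ fun i => 𝒜.vert (τ.1 i) := by
  rw [Fintype.linearIndependent_iff]
  intro c hc
  have key : ∀ n : ℕ, ∀ i : Fin (d + 1), (i : ℕ) = n → c i = 0 := by
    intro n
    induction n using Nat.strong_induction_on with
    | _ n ih =>
      intro i hi
      obtain ⟨φ, hφ, hφi⟩ : ∃ φ : (Fin (d + 1) → ℝ) →ₗ[ℝ] ℝ,
          (∀ j, i < j → φ (𝒜.vert (τ.1 j)) = 0) ∧ φ (𝒜.vert (τ.1 i)) ≠ 0 := by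
        by_cases hid : (i : ℕ) < d
        · refine ⟨𝒜.f (τ.2 ⟨i, hid⟩), fun j hj =>
            (h j).bottom.zero _ (h.face_sub_of_lt hj), ?_⟩
          exact apply_ne_zero (h i).bottom.card (h i).bottom.zero (h i).bottom.level
            ((h i).notMem hid)
        · refine ⟨𝒜.level, fun j hj => ?_, by rw [(h i).bottom.level]; exact one_ne_zero⟩
          have h1 := j.isLt
          have h2 : (i : ℕ) < j := hj
          omega
      have h1 := congrArg φ hc
      rw [map_sum, map_zero, Finset.sum_eq_single i] at h1
      · rw [map_smul, smul_eq_mul] at h1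
        exact (mul_eq_zero.1 h1).resolve_right hφi
      · intro j _ hji
        rw [map_smul, smul_eq_mul]
        rcases lt_or_gt_of_ne hji with hlt | hgt
        · rw [ih j (by have : (j : ℕ) < i := hlt; omega) j rfl, zero_mul]
        · rw [hφ j hgt, mul_zero]
      · exact fun hn => absurd (Finset.mem_univ i) hn
  exact fun i => key i i rfl

theorem Good.pos_of_mem_cone (h : 𝒜.Good U t τ) {c : Fin (d + 1) → ℝ} (hc : ∀ i, 0 < c i) {g : α}
    (hg : g ∈ U) : 0 < sg t g * 𝒜.f g (∑ i, c i • 𝒜.vert (τ.1 i)) := by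
  have e : sg t g * 𝒜.f g (∑ i, c i • 𝒜.vert (τ.1 i)) =
      ∑ i, c i * (sg t g * 𝒜.f g (𝒜.vert (τ.1 i))) := by
    rw [map_sum, Finset.mul_sum]
    exact Finset.sum_congr rfl fun i _ => by rw [map_smul, smul_eq_mul]; ring
  rw [e]
  refine Finset.sum_pos' (fun i _ => mul_nonneg (hc i).le ((h i).nonneg g hg)) ?_
  by_contra hno
  push Not at hno
  have hz : ∀ i, 𝒜.f g (𝒜.vert (τ.1 i)) = 0 := by
    intro i
    by_contra hne
    have h1 := hno i (Finset.mem_univ i)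
    have h2 := lt_of_le_of_ne ((h i).nonneg g hg) (mul_ne_zero sg_ne_zero hne).symm
    exact absurd (mul_pos (hc i) h2) (not_lt.2 h1)
  have hmem : g ∈ τ.1 (Fin.last d) := by
    by_contra hn
    exact absurd (hz _) (apply_ne_zero (h _).bottom.card (h _).bottom.zero (h _).bottom.level hn)
  obtain ⟨j, rfl⟩ := h.last_eq hmem
  exact absurd (hz j.castSucc) (apply_ne_zero (h _).bottom.card (h _).bottom.zero
    (h _).bottom.level ((h j.castSucc).notMem (by simp)))

/-- The cones of the triangulation of the cells over `U` that contain a point of `X`. -/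
def simplices (𝒜 : GenericArrangement d α) [Fintype α] (X : Finset (Fin (d + 1) → ℝ))
    (U : Finset α) : Finset (Config d α) :=
  Finset.univ.filter fun τ => ∃ t ∈ patterns 𝒜.f X U, 𝒜.Good U t τ

theorem Good.eq_of_face (h : 𝒜.Good U t τ) {τ' : Config d α} (h' : 𝒜.Good U t τ')
    {i : Fin (d + 1)} (hf : τ.face i = τ'.face i) : τ.1 i = τ'.1 i := by
  have hb := (h i).bottom
  rw [hf] at hb
  exact (hb.unique (h' i).bottom (h i).sub (h' i).sub (h i).nonneg (h' i).nonneg).1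

theorem Good.face_of_good (h : 𝒜.GoodAt U t τ i) : 𝒜.Face U t (τ.1 i) (𝒜.vert (τ.1 i)) :=
  ⟨h.bottom.zero, fun _ hg hgZ => h.pos hg hgZ⟩

theorem card_simplices_le [Fintype α] (X : Finset (Fin (d + 1) → ℝ)) (U : Finset α) :
    (𝒜.simplices X U).card ≤ d ^ d * (𝒜.flags X U d 0).card := by
  have hS : ∀ τ : Config d α, ∃ t, τ ∈ 𝒜.simplices X U →
      t ∈ patterns 𝒜.f X U ∧ 𝒜.Good U t τ := by
    intro τ
    by_cases hτ : τ ∈ 𝒜.simplices X U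
    · obtain ⟨t, ht, hg⟩ := (Finset.mem_filter.1 hτ).2
      exact ⟨t, fun _ => ⟨ht, hg⟩⟩
    · exact ⟨∅, fun h => absurd h hτ⟩
  choose t ht using hS
  have hle : (𝒜.simplices X U).card ≤ ((𝒜.flags X U d 0).sigma fun q =>
      Fintype.piFinset fun _ : Fin d => q.1).card := by
    refine Finset.card_le_card_of_injOn (fun τ => ⟨(τ.1 (Fin.last d), ∅, t τ), τ.2⟩) ?_ ?_
    · intro τ hτ
      obtain ⟨h1, h2⟩ := ht τ hτ
      have hl := h2 (Fin.last d)
      simp only [Finset.coe_sigma, Set.mem_sigma_iff, Finset.mem_coe, Fintype.mem_piFinset]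
      refine ⟨mem_flags.2 ⟨⟨hl.sub, hl.bottom.card⟩, Finset.empty_subset _, rfl, ?_, _,
        Good.face_of_good hl⟩, fun i => h2.face_sub_of_lt (by simp)⟩
      intro S hS
      rw [Finset.subset_empty.1 hS, ← Finset.bot_eq_empty, symmDiff_bot]
      exact h1
    · intro τ hτ τ' hτ' e
      simp only [Sigma.mk.injEq, Prod.mk.injEq, heq_eq_eq, true_and] at e
      obtain ⟨-, h2⟩ := ht τ hτ
      obtain ⟨-, h2'⟩ := ht τ' hτ'
      rw [e.1.2] at h2
      refine Prod.ext (funext fun i => h2.eq_of_face h2' ?_) e.2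
      exact Config.face_congr fun j _ => congrFun e.2 j
  refine hle.trans (le_of_eq ?_)
  rw [Finset.card_sigma, Finset.sum_const_nat (m := d ^ d), mul_comm]
  intro q hq
  rw [Fintype.card_piFinset, Finset.prod_const, (mem_flags.1 hq).1.2]
  simp

/-- The part of a conic combination of the rays of `τ` with indices at least `n`. -/
def tail (𝒜 : GenericArrangement d α) (τ : Config d α) (c : Fin (d + 1) → ℝ) (n : ℕ) :
    Fin (d + 1) → ℝ :=
  ∑ j ∈ Finset.univ.filter (fun j : Fin (d + 1) => n ≤ j), c j • 𝒜.vert (τ.1 j)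

theorem tail_zero (c : Fin (d + 1) → ℝ) : 𝒜.tail τ c 0 = ∑ j, c j • 𝒜.vert (τ.1 j) := by
  simp [tail]

theorem tail_eq (c : Fin (d + 1) → ℝ) {n : ℕ} (hn : n < d + 1) :
    𝒜.tail τ c n = c ⟨n, hn⟩ • 𝒜.vert (τ.1 ⟨n, hn⟩) + 𝒜.tail τ c (n + 1) := by
  have e : (Finset.univ.filter fun j : Fin (d + 1) => n ≤ (j : ℕ)) =
      insert ⟨n, hn⟩ (Finset.univ.filter fun j : Fin (d + 1) => n + 1 ≤ (j : ℕ)) := by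
    ext j
    simp only [Finset.mem_filter, Finset.mem_univ, true_and, Finset.mem_insert, Fin.ext_iff]
    omega
  rw [tail, e, Finset.sum_insert (by simp)]
  rfl

theorem Good.tail_nonneg (h : 𝒜.Good U t τ) {c : Fin (d + 1) → ℝ} (hc : ∀ i, 0 < c i) (n : ℕ) {g : α}
    (hg : g ∈ U) : 0 ≤ sg t g * 𝒜.f g (𝒜.tail τ c n) := by
  rw [tail, map_sum, Finset.mul_sum]
  refine Finset.sum_nonneg fun i _ => ?_
  rw [map_smul, smul_eq_mul, mul_left_comm]
  exact mul_nonneg (hc i).le ((h i).nonneg g hg)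

theorem Good.tail_eq_zero (h : 𝒜.Good U t τ) (c : Fin (d + 1) → ℝ) {i : Fin d} :
    𝒜.f (τ.2 i) (𝒜.tail τ c (i + 1)) = 0 := by
  rw [tail, map_sum]
  refine Finset.sum_eq_zero fun j hj => ?_
  rw [map_smul, (h j).bottom.zero _ (h.face_sub_of_lt (Finset.mem_filter.1 hj).2), smul_zero]

theorem Good.mem_of_tail_eq_zero (h : 𝒜.Good U t τ) {c : Fin (d + 1) → ℝ} (hc : ∀ i, 0 < c i) {n : ℕ}
    {g : α} (hg : g ∈ U) (h0 : 𝒜.f g (𝒜.tail τ c n) = 0) (j : Fin (d + 1)) (hj : n ≤ j) :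
    g ∈ τ.1 j := by
  by_contra hn
  have h1 := (h j).pos hg hn
  have h2 : 0 < sg t g * 𝒜.f g (𝒜.tail τ c n) := by
    rw [tail, map_sum, Finset.mul_sum]
    refine Finset.sum_pos' (fun i _ => ?_) ⟨j, Finset.mem_filter.2 ⟨Finset.mem_univ _, hj⟩, ?_⟩
    · rw [map_smul, smul_eq_mul, mul_left_comm]
      exact mul_nonneg (hc i).le ((h i).nonneg g hg)
    · rw [map_smul, smul_eq_mul, mul_left_comm]
      exact mul_pos (hc j) h1
  rw [h0, mul_zero] at h2
  exact lt_irrefl _ h2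

theorem Good.coeff_le (h : 𝒜.Good U t τ) {i : Fin d} {c c' : ℝ} {a a' : Fin (d + 1) → ℝ}
    (he : c • 𝒜.vert (τ.1 i.castSucc) + a = c' • 𝒜.vert (τ.1 i.castSucc) + a')
    (ha : 𝒜.f (τ.2 i) a = 0) (ha' : 0 ≤ sg t (τ.2 i) * 𝒜.f (τ.2 i) a') : c' ≤ c := by
  have h1 := (h i.castSucc).pos (h.mem i) ((h i.castSucc).notMem (by simp))
  have h2 := congrArg (fun x => sg t (τ.2 i) * 𝒜.f (τ.2 i) x) he
  simp only [map_add, map_smul, smul_eq_mul, ha, add_zero] at h2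
  by_contra hlt
  push Not at hlt
  nlinarith [mul_pos (sub_pos.2 hlt) h1]

theorem Good.unique {τ' : Config d α} {t' : Finset α} (htU : t ⊆ U) (htU' : t' ⊆ U)
    (h : 𝒜.Good U t τ) (h' : 𝒜.Good U t' τ')
    {c c' : Fin (d + 1) → ℝ} (hc : ∀ i, 0 < c i) (hc' : ∀ i, 0 < c' i)
    (he : ∑ i, c i • 𝒜.vert (τ.1 i) = ∑ i, c' i • 𝒜.vert (τ'.1 i)) : τ = τ' := by
  have htt : t = t' := by
    have key : ∀ g ∈ U, (g ∈ t ↔ g ∈ t') := by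
      intro g hg
      have h1 := h.pos_of_mem_cone hc hg
      have h2 := h'.pos_of_mem_cone hc' hg
      rw [← he] at h2
      unfold sg at h1 h2
      split_ifs at h1 h2 <;> first | tauto | linarith
    ext g
    constructor
    · exact fun hg => (key g (htU hg)).1 hg
    · exact fun hg => (key g (htU' hg)).2 hg
  subst htt
  have key : ∀ n, n ≤ d → (∀ j : Fin d, (j : ℕ) < n → τ.2 j = τ'.2 j) ∧
      𝒜.tail τ c n = 𝒜.tail τ' c' n := by
    intro n
    induction n with
    | zero => exact fun _ => ⟨fun j hj => absurd hj (Nat.not_lt_zero _), by rw [tail_zero, tail_zero, he]⟩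
    | succ n ih =>
      intro hn
      obtain ⟨ih1, ih2⟩ := ih (by omega)
      set i : Fin d := ⟨n, by omega⟩ with hi
      have hZ : τ.1 i.castSucc = τ'.1 i.castSucc := h.eq_of_face h' (Config.face_congr ih1)
      rw [tail_eq c (by omega : n < d + 1), tail_eq c' (by omega : n < d + 1)] at ih2
      change c i.castSucc • 𝒜.vert (τ.1 i.castSucc) + _ =
        c' i.castSucc • 𝒜.vert (τ'.1 i.castSucc) + _ at ih2
      have hcc : c i.castSucc = c' i.castSucc := by
        refine le_antisymm ?_ ?_
        · have ih3 := ih2.symm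
          rw [hZ] at ih3
          exact h'.coeff_le ih3 (h'.tail_eq_zero c' (i := i)) (h.tail_nonneg hc _ (h'.mem i))
        · rw [← hZ] at ih2
          exact h.coeff_le ih2 (h.tail_eq_zero c (i := i)) (h'.tail_nonneg hc' _ (h.mem i))
      rw [hcc, hZ, add_right_inj] at ih2
      refine ⟨fun j hj => ?_, ih2⟩
      rcases Nat.lt_succ_iff_lt_or_eq.1 hj with hlt | heq
      · exact ih1 j hlt
      · have hji : j = i := Fin.ext heq
        rw [hji]
        have h0 : 𝒜.f (τ'.2 i) (𝒜.tail τ c (n + 1)) = 0 := by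
          rw [ih2]; exact h'.tail_eq_zero c' (i := i)
        have hm := h.mem_of_tail_eq_zero hc (h'.mem i) h0
        obtain ⟨k, hk⟩ := h.last_eq (hm (Fin.last d) (by simpa using hn))
        have h1 : ¬ n + 1 ≤ (k : ℕ) := fun hle => by
          have := hm k.castSucc hle
          rw [← hk] at this
          exact (h k.castSucc).notMem (by simp) this
        have h2 : ¬ (k : ℕ) < n := fun hlt => by
          have := h.face_sub_of_lt (i := k) (j := i.castSucc) hlt
          rw [hk, hZ] at this
          exact (h' i.castSucc).notMem i.isLt this
        have h3 : k = i := Fin.ext (by simp only [hi]; omega)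
        rw [← hk, h3]
  have h2 : τ.2 = τ'.2 := funext fun j => (key d le_rfl).1 j j.isLt
  exact Prod.ext (funext fun i => h.eq_of_face h' (Config.face_congr fun j _ => congrFun h2 j)) h2

/-- Moving from `w` away from `y` until a new functional vanishes. -/
theorem exists_exit {Z F : Finset α} {y w : Fin (d + 1) → ℝ} (hEU : 𝒜.E ⊆ U) (hZc : Z.card = d)
    (hZ : F ⊆ Z) (hy : 𝒜.Face U t Z y) (hw : ∀ h ∈ U, 0 ≤ sg t h * 𝒜.f h w)
    (hwF : ∀ h ∈ F, 𝒜.f h w = 0) (hne : ∀ c : ℝ, w ≠ c • y) :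
    ∃ l : ℝ, 0 ≤ l ∧ ∃ g ∈ U, g ∉ Z ∧ (∀ h ∈ U, 0 ≤ sg t h * 𝒜.f h (w - l • y)) ∧
      (∀ h ∈ insert g F, 𝒜.f h (w - l • y) = 0) ∧ w - l • y ≠ 0 := by
  obtain ⟨e, he, heZ⟩ := exists_notMem_E (𝒜 := 𝒜) hZc
  obtain ⟨g, hg, hmin⟩ := Finset.exists_min_image (U \ Z)
    (fun h => (sg t h * 𝒜.f h w) / (sg t h * 𝒜.f h y)) ⟨e, Finset.mem_sdiff.2 ⟨hEU he, heZ⟩⟩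
  rw [Finset.mem_sdiff] at hg
  have hgy := hy.2 g hg.1 hg.2
  refine ⟨(sg t g * 𝒜.f g w) / (sg t g * 𝒜.f g y), div_nonneg (hw g hg.1) hgy.le, g, hg.1, hg.2,
    fun h hh => ?_, fun h hh => ?_, sub_ne_zero.2 (hne _)⟩
  · by_cases hhZ : h ∈ Z
    · rw [map_sub, map_smul, hy.1 h hhZ, smul_zero, sub_zero]; exact hw h hh
    · have h1 := hmin h (Finset.mem_sdiff.2 ⟨hh, hhZ⟩)
      rw [le_div_iff₀ (hy.2 h hh hhZ)] at h1
      rw [map_sub, map_smul, smul_eq_mul]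
      linarith
  · rw [map_sub, map_smul, smul_eq_mul]
    rcases Finset.mem_insert.1 hh with rfl | hh
    · have hs := sg_ne_zero (t := t) (h := h)
      have : 𝒜.f h y ≠ 0 := fun h0 => by rw [h0, mul_zero] at hgy; exact lt_irrefl _ hgy
      field_simp
      ring
    · rw [hwF h hh, hy.1 h (hZ hh)]; ring

theorem exists_not_multiple {Z F : Finset α} {y : Fin (d + 1) → ℝ} (hZc : Z.card = d)
    (hl : 𝒜.level y = 1) (hZ : F ⊆ Z) (hF : F.card < d) (hy : 𝒜.Face U t Z y) :
    ∃ w, (∀ h ∈ U, 0 ≤ sg t h * 𝒜.f h w) ∧ (∀ h ∈ F, 𝒜.f h w = 0) ∧ ∀ c : ℝ, w ≠ c • y := by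
  obtain ⟨z, hz⟩ := exists_edge hZc hy.1 hl
  obtain ⟨g, hgZ, hgF⟩ := Finset.exists_mem_notMem_of_card_lt_card (hF.trans_eq hZc.symm)
  obtain ⟨hz1, hz2, hz3, -⟩ := hz g hgZ
  set v := sg t g • z g with hv
  obtain ⟨s, hs, hpos⟩ := exists_pos_forall_pos (U \ Z) (fun h => sg t h * 𝒜.f h y)
    (fun h => sg t h * 𝒜.f h v) fun h hh =>
      hy.2 h (Finset.mem_sdiff.1 hh).1 (Finset.mem_sdiff.1 hh).2
  have hgw : 𝒜.f g (y + s • v) = s * sg t g := by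
    simp only [hv, map_add, map_smul, hy.1 g hgZ, hz2, smul_eq_mul]; ring
  refine ⟨y + s • v, fun h hh => ?_, fun h hh => ?_, fun c hc => ?_⟩
  · by_cases hhZ : h ∈ Z
    · by_cases hhg : h = g
      · subst hhg
        rw [hgw]
        have := sg_mul_self (t := t) (h := h)
        nlinarith
      · simp only [hv, map_add, map_smul, hy.1 h hhZ, hz3 h hhZ hhg, smul_zero, add_zero, mul_zero,
          le_refl]
    · have := hpos h (Finset.mem_sdiff.2 ⟨hh, hhZ⟩)
      rw [map_add, map_smul, smul_eq_mul]
      linarith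
  · have hhg : h ≠ g := fun e => hgF (e ▸ hh)
    simp only [hv, map_add, map_smul, hy.1 h (hZ hh), hz3 h (hZ hh) hhg, smul_zero, add_zero]
  · rw [hc, map_smul, hy.1 g hgZ, smul_zero] at hgw
    exact (mul_ne_zero hs.ne' sg_ne_zero) hgw.symm

theorem GoodAt.congr {τ' : Config d α} {i : Fin (d + 1)} (h : 𝒜.GoodAt U t τ i)
    (h1 : τ.1 i = τ'.1 i) (h2 : ∀ j : Fin d, (j : ℕ) ≤ i → τ.2 j = τ'.2 j) :
    𝒜.GoodAt U t τ' i := by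
  have hf : τ.face i = τ'.face i := Config.face_congr fun j hj => h2 j hj.le
  obtain ⟨a, b, c, e⟩ := h
  rw [h1] at a b c e
  rw [hf] at b
  exact ⟨a, b, c, fun hi => by rw [← h2 ⟨i, hi⟩ le_rfl]; exact e hi⟩

theorem tail_congr {τ' : Config d α} {c c' : Fin (d + 1) → ℝ} {n : ℕ}
    (h1 : ∀ j : Fin (d + 1), n ≤ j → τ.1 j = τ'.1 j) (h2 : ∀ j : Fin (d + 1), n ≤ j → c j = c' j) :
    𝒜.tail τ c n = 𝒜.tail τ' c' n :=
  Finset.sum_congr rfl fun j hj => by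
    rw [h1 j (Finset.mem_filter.1 hj).2, h2 j (Finset.mem_filter.1 hj).2]

theorem exists_config (hEU : 𝒜.E ⊆ U) (hEt : 𝒜.E ⊆ t) : ∀ m n : ℕ, n + m = d → ∀ τ : Config d α,
    τ.face n ⊆ U → (τ.face n).card = n →
    ∀ w x : Fin (d + 1) → ℝ, w ≠ 0 → (∀ h ∈ U, 0 ≤ sg t h * 𝒜.f h w) →
      (∀ h ∈ τ.face n, 𝒜.f h w = 0) → (x = w ∨ x = 0) →
    ∃ τ' : Config d α, (∀ j : Fin d, (j : ℕ) < n → τ.2 j = τ'.2 j) ∧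
      (∀ j : Fin (d + 1), n ≤ j → 𝒜.GoodAt U t τ' j) ∧
      ∃ c : Fin (d + 1) → ℝ, (∀ j, 0 ≤ c j) ∧ 𝒜.tail τ' c n = x := by
  intro m
  induction m with
  | zero =>
    intro n hn τ hFU hFc w x hw0 hw hwF hx
    obtain ⟨Z, y, hZU, hb, hf⟩ := exists_bottom hEU hEt hFU hw hwF hw0 one_ne_zero (ε := 1)
    have hnd : n = d := by omega
    subst hnd
    have hv := vert_eq hb.card hb.zero hb.level
    have hFZ : τ.face n = Z := Finset.eq_of_subset_of_card_le hb.sub (by rw [hb.card, hFc])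
    have hxl : 0 ≤ 𝒜.level x := by
      rcases hx with rfl | rfl
      · exact (level_pos_of_nonneg hEU hEt hw hw0).le
      · simp
    have hxy : x = 𝒜.level x • y := by
      refine eq_smul_of_zero hb.card hb.zero hb.level fun h hh => ?_
      rcases hx with rfl | rfl
      · exact hwF h (hFZ ▸ hh)
      · simp
    refine ⟨(Function.update τ.1 (Fin.last n) Z, τ.2), fun _ _ => rfl, fun j hj => ?_,
      fun _ => 𝒜.level x, fun _ => hxl, ?_⟩
    · have hjl : j = Fin.last n := Fin.ext (by have := j.isLt; simp; omega)
      subst hjl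
      refine ⟨?_, ?_, ?_, ?_⟩
      · simpa using hZU
      · simp only [Function.update_self, hv]; exact hb
      · simp only [Function.update_self, hv]; exact hf.nonneg
      · intro hi; simp at hi
    · rw [tail_eq _ (Nat.lt_succ_self n)]
      have e : 𝒜.tail (Function.update τ.1 (Fin.last n) Z, τ.2) (fun _ => 𝒜.level x) (n + 1) = 0 := by
        refine Finset.sum_eq_zero fun j hj => ?_
        have := (Finset.mem_filter.1 hj).2
        have := j.isLt
        omega
      have e2 : (⟨n, Nat.lt_succ_self n⟩ : Fin (n + 1)) = Fin.last n := rfl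
      rw [e, add_zero, e2]
      simp only [Function.update_self, hv]
      exact hxy.symm
  | succ m ih =>
    intro n hn τ hFU hFc w x hw0 hw hwF hx
    obtain ⟨Z, y, hZU, hb, hf⟩ := exists_bottom hEU hEt hFU hw hwF hw0 one_ne_zero (ε := 1)
    have hv := vert_eq hb.card hb.zero hb.level
    have hnd : n < d := by omega
    have hn1 : n < d + 1 := by omega
    obtain ⟨c₀, w₂, x₁, g, hc₀, hgU, hgZ, hw₂, hw₂F, hw₂0, hx₁, hxe⟩ :
        ∃ (c₀ : ℝ) (w₂ x₁ : Fin (d + 1) → ℝ) (g : α), 0 ≤ c₀ ∧ g ∈ U ∧ g ∉ Z ∧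
          (∀ h ∈ U, 0 ≤ sg t h * 𝒜.f h w₂) ∧ (∀ h ∈ insert g (τ.face n), 𝒜.f h w₂ = 0) ∧ w₂ ≠ 0 ∧
          (x₁ = w₂ ∨ x₁ = 0) ∧ x = c₀ • y + x₁ := by
      by_cases hm : ∃ c : ℝ, w = c • y
      · obtain ⟨c, hc⟩ := hm
        obtain ⟨w₁, h1, h2, h3⟩ := exists_not_multiple hb.card hb.level hb.sub (by omega) hf
        obtain ⟨l, -, g, hgU, hgZ, h4, h5, h6⟩ := exists_exit hEU hb.card hb.sub hf h1 h2 h3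
        have hl := level_pos_of_nonneg hEU hEt hw hw0
        rw [hc, map_smul, hb.level, smul_eq_mul, mul_one] at hl
        rcases hx with rfl | rfl
        · exact ⟨c, _, 0, g, hl.le, hgU, hgZ, h4, h5, h6, Or.inr rfl, by rw [hc, add_zero]⟩
        · exact ⟨0, _, 0, g, le_rfl, hgU, hgZ, h4, h5, h6, Or.inr rfl, by simp⟩
      · push Not at hm
        obtain ⟨l, hl, g, hgU, hgZ, h4, h5, h6⟩ := exists_exit hEU hb.card hb.sub hf hw hwF hm
        rcases hx with rfl | rfl
        · exact ⟨l, _, _, g, hl, hgU, hgZ, h4, h5, h6, Or.inl rfl, by abel⟩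
        · exact ⟨0, _, 0, g, le_rfl, hgU, hgZ, h4, h5, h6, Or.inr rfl, by simp⟩
    set τ₁ : Config d α := (τ.1, Function.update τ.2 ⟨n, hnd⟩ g) with hτ₁
    have hagree : ∀ j : Fin d, (j : ℕ) < n → τ.2 j = τ₁.2 j := by
      intro j hj
      have : j ≠ ⟨n, hnd⟩ := fun e => by rw [e] at hj; exact lt_irrefl _ hj
      simp [hτ₁, this]
    have hface : τ₁.face (n + 1) = insert g (τ.face n) := by
      rw [Config.face_succ _ hnd, ← Config.face_congr hagree]
      simp [hτ₁]
    have hgF : g ∉ τ.face n := fun h => hgZ (hb.sub h)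
    obtain ⟨τ', h1, h2, c, hc, hct⟩ := ih (n + 1) (by omega) τ₁
      (by rw [hface]; exact Finset.insert_subset hgU hFU)
      (by rw [hface, Finset.card_insert_of_notMem hgF, hFc]) w₂ x₁ hw₂0 hw₂
      (by rw [hface]; exact hw₂F) hx₁
    have hj1 : ∀ j : Fin (d + 1), n + 1 ≤ (j : ℕ) → j ≠ ⟨n, hn1⟩ := by
      intro j hj e
      rw [e] at hj
      simp at hj
    have hτ'2 : ∀ j : Fin d, (j : ℕ) < n → τ.2 j = τ'.2 j := fun j hj =>
      (hagree j hj).trans (h1 j (by omega))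
    refine ⟨(Function.update τ'.1 ⟨n, hn1⟩ Z, τ'.2), hτ'2, fun j hj => ?_,
      Function.update c ⟨n, hn1⟩ c₀, fun j => ?_, ?_⟩
    · rcases Nat.eq_or_lt_of_le hj with he | hlt
      · have hjn : j = ⟨n, hn1⟩ := Fin.ext he.symm
        rw [hjn]
        have hfe : Config.face (Function.update τ'.1 (⟨n, hn1⟩ : Fin (d + 1)) Z, τ'.2) n =
            τ.face n := Config.face_congr fun j hj => (hτ'2 j hj).symm
        refine ⟨?_, ?_, ?_, fun hi => ?_⟩
        · simpa using hZU
        · simp only [Function.update_self, hv, hfe]; exact hb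
        · simp only [Function.update_self, hv]; exact hf.nonneg
        · have : τ'.2 ⟨n, hnd⟩ = g := by
            rw [← h1 ⟨n, hnd⟩ (by simp)]
            simp [hτ₁]
          simp only [Function.update_self, this]
          exact hgZ
      · exact (h2 j hlt).congr (by simp [hj1 j hlt]) fun _ _ => rfl
    · by_cases hj : j = ⟨n, hn1⟩
      · rw [hj]; simpa using hc₀
      · simpa [hj] using hc j
    · rw [tail_eq _ (hn1), hxe, ← hct]
      simp only [Function.update_self, hv]
      congr 1
      refine tail_congr (fun j hj => ?_) fun j hj => ?_
      · simp [hj1 j hj]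
      · simp [hj1 j hj]

/-- Every point of a cell is covered by the cones of the triangulation of the cell. -/
theorem exists_good_of_nonneg [Nonempty α] (hEU : 𝒜.E ⊆ U) (hEt : 𝒜.E ⊆ t) {x : Fin (d + 1) → ℝ}
    (hx0 : x ≠ 0) (hx : ∀ h ∈ U, 0 ≤ sg t h * 𝒜.f h x) :
    ∃ τ : Config d α, 𝒜.Good U t τ ∧ ∃ c : Fin (d + 1) → ℝ, (∀ j, 0 ≤ c j) ∧
      ∑ j, c j • 𝒜.vert (τ.1 j) = x := by
  have hf : Config.face ((fun _ => ∅, fun _ => Classical.arbitrary α) : Config d α) 0 = ∅ := by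
    ext; simp [Config.mem_face]
  obtain ⟨τ, -, h1, c, hc, h2⟩ := exists_config hEU hEt d 0 (by omega)
    (fun _ => ∅, fun _ => Classical.arbitrary α) (by rw [hf]; simp) (by rw [hf]; simp) x x hx0 hx
    (by rw [hf]; simp) (Or.inl rfl)
  exact ⟨τ, fun i => h1 i (Nat.zero_le _), c, hc, by rw [← h2, tail_zero]⟩

end GenericArrangement

/-- The open cone cut out by the rows of `a`. -/
def openCone {d : ℕ} (a : Fin (d + 1) → Fin (d + 1) → ℝ) : Set (Fin (d + 1) → ℝ) :=
  {x | ∀ k, 0 < a k ⬝ᵥ x}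

/-- The closed cone cut out by the rows of `a`. -/
def closedCone {d : ℕ} (a : Fin (d + 1) → Fin (d + 1) → ℝ) : Set (Fin (d + 1) → ℝ) :=
  {x | ∀ k, 0 ≤ a k ⬝ᵥ x}

/-- The functional `f` vanishes somewhere on the open cone of `a`. -/
def Crosses {d : ℕ} (a : Fin (d + 1) → Fin (d + 1) → ℝ) (f : (Fin (d + 1) → ℝ) →ₗ[ℝ] ℝ) : Prop :=
  ∃ x ∈ openCone a, f x = 0

theorem exists_rows {d : ℕ} {y : Fin (d + 1) → Fin (d + 1) → ℝ} (hy : LinearIndependent ℝ y) :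
    ∃ a : Fin (d + 1) → Fin (d + 1) → ℝ, (∀ k, ‖a k‖ = 1) ∧
      (∀ x ∈ openCone a, ∃ c : Fin (d + 1) → ℝ, (∀ k, 0 < c k) ∧ ∑ k, c k • y k = x) ∧
      ∀ c : Fin (d + 1) → ℝ, (∀ k, 0 ≤ c k) → ∑ k, c k • y k ∈ closedCone a := by
  set b := basisOfLinearIndependentOfCardEqFinrank hy (by simp) with hb
  have hby : ∀ k, b k = y k := fun k => by simp [hb]
  set a₀ : Fin (d + 1) → Fin (d + 1) → ℝ := fun k j => b.coord k (Pi.single j 1) with ha₀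
  have hdot : ∀ k x, a₀ k ⬝ᵥ x = b.coord k x := by
    intro k x
    conv_rhs => rw [← Finset.univ_sum_single x]
    rw [map_sum, dotProduct]
    refine Finset.sum_congr rfl fun j _ => ?_
    have : (Pi.single j (x j) : Fin (d + 1) → ℝ) = x j • Pi.single j 1 := by
      rw [← Pi.single_smul, smul_eq_mul, mul_one]
    rw [this, map_smul, smul_eq_mul, mul_comm]
  have hne : ∀ k, 0 < ‖a₀ k‖ := by
    intro k
    rw [norm_pos_iff]
    intro h0
    have := hdot k (b k)
    rw [h0, zero_dotProduct] at this
    simp at this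
  have hdot' : ∀ k x, (‖a₀ k‖⁻¹ • a₀ k) ⬝ᵥ x = ‖a₀ k‖⁻¹ * b.coord k x := by
    intro k x
    rw [smul_dotProduct, hdot, smul_eq_mul]
  refine ⟨fun k => ‖a₀ k‖⁻¹ • a₀ k, fun k => ?_, fun x hx => ?_, fun c hc k => ?_⟩
  · rw [norm_smul, norm_inv, norm_norm, inv_mul_cancel₀ (hne k).ne']
  · refine ⟨fun k => b.coord k x, fun k => ?_, ?_⟩
    · have := hx k
      rw [hdot'] at this
      exact pos_of_mul_pos_right this (inv_nonneg.2 (hne k).le)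
    · simp_rw [← hby]
      exact b.sum_repr x
  · dsimp only
    rw [hdot']
    refine mul_nonneg (inv_nonneg.2 (hne k).le) ?_
    simp_rw [← hby]
    rw [map_sum, Finset.sum_eq_single k]
    · simpa using hc k
    · intro j _ hj
      simp [hj]
    · exact fun h => absurd (Finset.mem_univ k) h

namespace GenericArrangement

variable {d K : ℕ}

/-- The functionals that vanish somewhere on the open cone of a configuration. -/
def crossing {α : Type} [Fintype α] (𝒜 : GenericArrangement d α) (τ : Config d α) : Finset α :=
  (Finset.univ \ 𝒜.E).filter fun h => ∃ c : Fin (d + 1) → ℝ, (∀ k, 0 < c k) ∧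
    𝒜.f h (∑ k, c k • 𝒜.vert (τ.1 k)) = 0

theorem simplices_mono {α : Type} [Fintype α] {𝒜 : GenericArrangement d α}
    {X : Finset (Fin (d + 1) → ℝ)} {U U' : Finset α} (hU : U' ⊆ U) {τ : Config d α}
    (hτ : τ ∈ 𝒜.simplices X U) (hD : ∀ i, τ.1 i ⊆ U') : τ ∈ 𝒜.simplices X U' := by
  obtain ⟨t, ht, hg⟩ := (Finset.mem_filter.1 hτ).2
  refine Finset.mem_filter.2 ⟨Finset.mem_univ _, t ∩ U', inter_mem_patterns hU ht, fun i => ?_⟩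
  have hsg : ∀ h ∈ U', sg (t ∩ U') h = sg t h := fun h hh => sg_congr (by simp [hh])
  obtain ⟨h1, h2, h3, h4⟩ := hg i
  refine ⟨hD i, ⟨h2.card, h2.sub, h2.zero, h2.level, fun x hx hl hs hc =>
    h2.opt x hx hl (fun g hgZ => ?_) hc⟩, fun h hh => ?_, h4⟩
  · rw [← hsg g (hD i hgZ)]; exact hs g hgZ
  · rw [hsg h hh]; exact h3 h (hU hh)

theorem exists_cutting (hd : 3 ≤ d) (hK : d - 1 ≤ K) : ∃ C : ℝ, 0 ≤ C ∧
    ∀ (α : Type) [Fintype α] (𝒜 : GenericArrangement d α) (X : Finset (Fin (d + 1) → ℝ)) (A : ℝ),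
    (∀ x ∈ X, ∀ e ∈ 𝒜.E, 0 < 𝒜.f e x) →
    (∀ R : Finset α, Disjoint R 𝒜.E →
      ((patterns 𝒜.f X (𝒜.E ∪ R)).card : ℝ) ≤ A * ((R.card : ℝ) + 1) ^ K) →
    ∀ p : α → ℝ, (∀ h, 0 ≤ p h) → (∀ h, p h ≤ 1) → ∀ r : ℝ, 1 ≤ r →
    ∑ h ∈ Finset.univ \ 𝒜.E, p h ≤ r →
    ∃ (m : ℕ) (a : Fin m → Fin (d + 1) → Fin (d + 1) → ℝ), (∀ i k, ‖a i k‖ = 1) ∧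
      ∑ i, Real.exp ((∑ h ∈ (Finset.univ \ 𝒜.E).filter fun h => Crosses (a i) (𝒜.f h), p h) / 2) ≤
        C * A * (r ^ K * (1 + Real.log r)) ∧
      (∀ i, ∀ h ∉ 𝒜.E, p h = 1 → ¬ Crosses (a i) (𝒜.f h)) ∧
      (∀ i j, i ≠ j → Disjoint (openCone (a i)) (openCone (a j))) ∧
      (∀ i, ∀ x ∈ openCone (a i), ∀ e ∈ 𝒜.E, 0 ≤ 𝒜.f e x) ∧
      ∀ x ∈ X, ∀ x', x' ≠ 0 → (∀ h, 0 ≤ sg (posSet 𝒜.f Finset.univ x) h * 𝒜.f h x') →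
        ∃ i, x' ∈ closedCone (a i) := by
  obtain ⟨C₁, hC₁, hflag⟩ := flagBound hd hK
  obtain ⟨C₂, hC₂, hexp⟩ := expect_poly_log_le K
  refine ⟨2 ^ ((d + 1) * d) * (d ^ d * C₁ * C₂), by positivity, fun α _ 𝒜 X A hX hA p hp0 hp1 r hr hpr => ?_⟩
  have hA0 := nonneg_of_pattern_bound hA
  have : Nonempty α := by
    have : 𝒜.E.Nonempty := Finset.card_pos.1 (by rw [𝒜.card_E]; omega)
    exact ⟨this.choose⟩
  set Y : Finset α := Finset.univ \ 𝒜.E with hY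
  have hdisj : ∀ R ⊆ Y, Disjoint R 𝒜.E := fun R hR =>
    Finset.disjoint_of_subset_left hR Finset.sdiff_disjoint
  set D : Config d α → Finset α := fun τ => (Finset.univ : Finset (Fin (d + 1))).biUnion
    fun i => if (τ.1 i).card ≤ d then τ.1 i else ∅ with hDdef
  have hM : ∀ τ, (D τ ∩ Y).card ≤ (d + 1) * d := by
    intro τ
    refine (Finset.card_le_card Finset.inter_subset_left).trans (Finset.card_biUnion_le.trans ?_)
    refine (Finset.sum_le_card_nsmul _ _ d fun i _ => ?_).trans (by simp)
    split_ifs with h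
    · exact h
    · simp
  have hP : ∀ R ⊆ Y, ∀ τ ∈ 𝒜.simplices X (𝒜.E ∪ R), D τ ∩ Y ⊆ R ∧ Disjoint (𝒜.crossing τ) R := by
    intro R hR τ hτ
    obtain ⟨t, ht, hg⟩ := (Finset.mem_filter.1 hτ).2
    refine ⟨fun h hh => ?_, Finset.disjoint_left.2 fun h hh hhR => ?_⟩
    · obtain ⟨h1, h2⟩ := Finset.mem_inter.1 hh
      obtain ⟨i, -, hi⟩ := Finset.mem_biUnion.1 h1
      rw [if_pos (hg i).bottom.card.le] at hi
      exact (Finset.mem_union.1 ((hg i).sub hi)).resolve_left (Finset.mem_sdiff.1 h2).2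
    · obtain ⟨-, c, hc, h0⟩ := Finset.mem_filter.1 hh
      have := hg.pos_of_mem_cone hc (Finset.mem_union_right 𝒜.E hhR)
      rw [h0, mul_zero] at this
      exact lt_irrefl _ this
  have hmono : ∀ R ⊆ Y, ∀ τ ∈ 𝒜.simplices X (𝒜.E ∪ R), ∀ R' ⊆ R, D τ ∩ Y ⊆ R' →
      τ ∈ 𝒜.simplices X (𝒜.E ∪ R') := by
    intro R hR τ hτ R' hR' hD
    obtain ⟨t, ht, hg⟩ := (Finset.mem_filter.1 hτ).2
    refine simplices_mono (Finset.union_subset_union_right hR') hτ fun i h hh => ?_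
    by_cases hE : h ∈ 𝒜.E
    · exact Finset.mem_union_left _ hE
    · refine Finset.mem_union_right _ (hD (Finset.mem_inter.2 ⟨Finset.mem_biUnion.2
        ⟨i, Finset.mem_univ _, ?_⟩, by simp [hY, hE]⟩))
      rwa [if_pos (hg i).bottom.card.le]
  obtain ⟨R, hRY, hR1, hRs⟩ := exists_sample Y p (fun h _ => hp0 h) (fun h _ => hp1 h)
    (fun R => 𝒜.simplices X (𝒜.E ∪ R)) D 𝒜.crossing (fun τ => Finset.filter_subset _ _)
    ((d + 1) * d) hM hP hmono
  set T := 𝒜.simplices X (𝒜.E ∪ R) with hT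
  have hgood : ∀ τ : T, ∃ t ∈ patterns 𝒜.f X (𝒜.E ∪ R), 𝒜.Good (𝒜.E ∪ R) t τ := fun τ =>
    (Finset.mem_filter.1 τ.2).2
  choose t ht hg using hgood
  choose a ha1 ha2 ha3 using fun τ : T => exists_rows (hg τ).linearIndependent
  have hposR : ∀ τ : T, ∀ x ∈ openCone (a τ), ∀ h ∈ 𝒜.E ∪ R, 0 < sg (t τ) h * 𝒜.f h x := by
    intro τ x hx h hh
    obtain ⟨c, hc, rfl⟩ := ha2 τ x hx
    exact (hg τ).pos_of_mem_cone hc hh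
  set e := T.equivFin with he
  refine ⟨T.card, fun i => a (e.symm i), fun i k => ha1 _ k, ?_, fun i h hhE hh1 => ?_,
    fun i j hij => ?_, fun i x hx h hh => ?_, fun x hx x' hx0 hx' => ?_⟩
  · rw [e.symm.sum_comp (fun τ => Real.exp ((∑ h ∈ Y.filter fun h => Crosses (a τ) (𝒜.f h), p h) / 2))]
    have h1 : ∑ τ : T, Real.exp ((∑ h ∈ Y.filter fun h => Crosses (a τ) (𝒜.f h), p h) / 2) ≤
        ∑ τ ∈ T, Real.exp ((∑ h ∈ 𝒜.crossing τ, p h) / 2) := by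
      rw [← Finset.sum_coe_sort T]
      refine Finset.sum_le_sum fun τ _ => Real.exp_le_exp.2 (div_le_div_of_nonneg_right ?_ (by norm_num))
      refine Finset.sum_le_sum_of_subset_of_nonneg (fun h hh => ?_) fun h _ _ => hp0 h
      obtain ⟨hhY, x, hx, h0⟩ := Finset.mem_filter.1 hh
      obtain ⟨c, hc, rfl⟩ := ha2 τ x hx
      exact Finset.mem_filter.2 ⟨hhY, c, hc, h0⟩
    refine h1.trans (hRs.trans ?_)
    have h2 := expect_mono (Y := Y) (p := fun h => p h / 2)
      (G := fun R => ((𝒜.simplices X (𝒜.E ∪ R)).card : ℝ))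
      (G' := fun R => (d ^ d * C₁ * A) * (((R.card : ℝ) + 1) ^ K * (1 + Real.log (R.card + 1))))
      (fun h _ => by have := hp0 h; positivity) (fun h _ => by have := hp1 h; linarith)
      (fun R hR => by
        have := hflag α 𝒜 X A hX hA R (hdisj R hR)
        have h3 : ((𝒜.simplices X (𝒜.E ∪ R)).card : ℝ) ≤ d ^ d * ((𝒜.flags X (𝒜.E ∪ R) d 0).card : ℝ) := by
          exact_mod_cast card_simplices_le X (𝒜.E ∪ R)
        refine h3.trans ((mul_le_mul_of_nonneg_left this (by positivity)).trans (le_of_eq ?_))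
        ring)
    rw [expect_const_mul] at h2
    have h3 := hexp α Y (fun h => p h / 2) (fun h _ => by have := hp0 h; positivity)
      (fun h _ => by have := hp1 h; linarith) r hr (by
        rw [← Finset.sum_div]
        have : 0 ≤ ∑ h ∈ Y, p h := Finset.sum_nonneg fun h _ => hp0 h
        linarith)
    calc 2 ^ ((d + 1) * d) * expect Y (fun h => p h / 2) _
        ≤ 2 ^ ((d + 1) * d) * ((d ^ d * C₁ * A) * (C₂ * (r ^ K * (1 + Real.log r)))) :=
          mul_le_mul_of_nonneg_left (h2.trans (mul_le_mul_of_nonneg_left h3 (by positivity)))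
            (by positivity)
      _ = _ := by ring
  · rintro ⟨x, hx, h0⟩
    have := hposR _ x hx h (Finset.mem_union_right _ (hR1 h (by simp [hY, hhE]) hh1))
    rw [h0, mul_zero] at this
    exact lt_irrefl _ this
  · refine Set.disjoint_left.2 fun x hx hx' => hij ?_
    obtain ⟨c, hc, h1⟩ := ha2 _ x hx
    obtain ⟨c', hc', h2⟩ := ha2 _ x hx'
    have := Good.unique (patterns_subset (ht _)) (patterns_subset (ht _)) (hg (e.symm i)) (hg (e.symm j))
      hc hc' (h1.trans h2.symm)
    exact e.symm.injective (Subtype.ext this)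
  · have := hposR _ x hx h (Finset.mem_union_left _ hh)
    rw [sg_of_mem (subset_of_patterns hX Finset.subset_union_left (ht _) hh), one_mul] at this
    exact this.le
  · have htm : posSet 𝒜.f (𝒜.E ∪ R) x ∈ patterns 𝒜.f X (𝒜.E ∪ R) := Finset.mem_image_of_mem _ hx
    obtain ⟨τ, hτ, c, hc, rfl⟩ := exists_good_of_nonneg (t := posSet 𝒜.f (𝒜.E ∪ R) x)
      Finset.subset_union_left
      (subset_of_patterns hX Finset.subset_union_left htm) hx0 (fun h hh => by
        have := hx' h
        have hs : sg (posSet 𝒜.f Finset.univ x) h = sg (posSet 𝒜.f (𝒜.E ∪ R) x) h := by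
          refine sg_congr ?_
          simp only [posSet, Finset.mem_filter]
          exact and_congr_left fun _ => iff_of_true (Finset.mem_univ _) hh
        rwa [hs] at this)
    have hτT : τ ∈ T := Finset.mem_filter.2 ⟨Finset.mem_univ _, _, htm, hτ⟩
    refine ⟨e ⟨τ, hτT⟩, ?_⟩
    simp only [e.symm_apply_apply]
    exact ha3 ⟨τ, hτT⟩ c hc

end GenericArrangement

theorem exists_near_notMem_submodules {W : Type*} [NormedAddCommGroup W] [NormedSpace ℝ W]
    [FiniteDimensional ℝ W] (P : Finset (Submodule ℝ W)) (hP : ∀ V ∈ P, V ≠ ⊤) (x : W) {ε : ℝ}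
    (hε : 0 < ε) : ∃ y, ‖y - x‖ < ε ∧ ∀ V ∈ P, y ∉ V := by
  have hd : Dense (⋂ V ∈ P, ((V : Set W)ᶜ)) := by
    refine dense_biInter_of_isOpen (fun V _ => V.closed_of_finiteDimensional.isOpen_compl)
      P.countable_toSet fun V hV => ?_
    rw [← interior_eq_empty_iff_dense_compl]
    by_contra hne
    exact hP V hV (V.eq_top_of_nonempty_interior' (Set.nonempty_iff_ne_empty.2 hne))
  obtain ⟨y, hy, hyx⟩ := hd.exists_dist_lt x hε
  refine ⟨y, by rwa [← dist_eq_norm, dist_comm], fun V hV => ?_⟩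
  exact (Set.mem_iInter₂.1 hy V hV)

/-- Any finite family of vectors can be perturbed, keeping an independent subfamily fixed, so that
all small subfamilies are independent. -/
theorem exists_generic {W : Type*} [NormedAddCommGroup W] [NormedSpace ℝ W]
    [FiniteDimensional ℝ W] {J : Type*} [Fintype J] (T₀ : Finset J) (u₀ : J → W)
    (h₀ : LinearIndepOn ℝ u₀ (T₀ : Set J)) {ε : ℝ} (hε : 0 < ε) :
    ∃ u : J → W, (∀ j ∈ T₀, u j = u₀ j) ∧ (∀ j, ‖u j - u₀ j‖ < ε) ∧
      ∀ S : Finset J, S.card ≤ Module.finrank ℝ W → LinearIndepOn ℝ u (S : Set J) := by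
  suffices H : ∀ T : Finset J, ∃ u : J → W, (∀ j ∈ T₀, u j = u₀ j) ∧ (∀ j, ‖u j - u₀ j‖ < ε) ∧
      ∀ S : Finset J, S ⊆ T₀ ∪ T → S.card ≤ Module.finrank ℝ W →
        LinearIndepOn ℝ u (S : Set J) by
    obtain ⟨u, h1, h2, h3⟩ := H Finset.univ
    exact ⟨u, h1, h2, fun S hS => h3 S (fun j _ => by simp) hS⟩
  intro T
  induction T using Finset.induction_on with
  | empty =>
    refine ⟨u₀, fun _ _ => rfl, fun j => by simpa using hε, fun S hS _ => h₀.mono ?_⟩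
    simpa using hS
  | insert g T hg ih =>
    obtain ⟨u, h1, h2, h3⟩ := ih
    by_cases hg0 : g ∈ T₀
    · refine ⟨u, h1, h2, fun S hS => h3 S (hS.trans fun j hj => ?_)⟩
      rcases Finset.mem_union.1 hj with h | h
      · exact Finset.mem_union_left _ h
      · rcases Finset.mem_insert.1 h with rfl | h
        · exact Finset.mem_union_left _ hg0
        · exact Finset.mem_union_right _ h
    · obtain ⟨y, hy, hyP⟩ := exists_near_notMem_submodules
        (((Finset.univ : Finset (Finset J)).filter fun S => S.card < Module.finrank ℝ W).image
          fun S : Finset J => Submodule.span ℝ (u '' (S : Set J))) (by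
            intro V hV htop
            obtain ⟨S, hS, rfl⟩ := Finset.mem_image.1 hV
            have h4 := (finrank_span_finset_le_card (R := ℝ) (S.image u)).trans Finset.card_image_le
            rw [Finset.coe_image, Set.finrank, htop, finrank_top] at h4
            exact absurd (Finset.mem_filter.1 hS).2 (not_lt.2 h4)) (u₀ g) hε
      have hne : ∀ j, j ≠ g → Function.update u g y j = u j := fun j hj => Function.update_of_ne hj _ _
      refine ⟨Function.update u g y, fun j hj => ?_, fun j => ?_, fun S hS hSc => ?_⟩
      · rw [hne j (fun h => hg0 (h ▸ hj)), h1 j hj]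
      · by_cases hj : j = g
        · subst hj; simpa using hy
        · rw [hne j hj]; exact h2 j
      · have hsub : S.erase g ⊆ T₀ ∪ T := by
          intro j hj
          obtain ⟨hjg, hj⟩ := Finset.mem_erase.1 hj
          rcases Finset.mem_union.1 (hS hj) with h | h
          · exact Finset.mem_union_left _ h
          · exact Finset.mem_union_right _ ((Finset.mem_insert.1 h).resolve_left hjg)
        have hE : Set.EqOn u (Function.update u g y) (S.erase g : Finset J) := fun j hj =>
          (hne j (Finset.mem_erase.1 hj).1).symm
        have h5 : LinearIndepOn ℝ (Function.update u g y) (S.erase g : Finset J) :=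
          (h3 _ hsub ((Finset.card_erase_le).trans hSc)).congr hE
        by_cases hgS : g ∈ S
        · rw [← Finset.insert_erase hgS, Finset.coe_insert]
          refine h5.insert ?_
          rw [← hE.image_eq, Function.update_self]
          refine hyP _ (Finset.mem_image_of_mem _ (Finset.mem_filter.2 ⟨Finset.mem_univ _, ?_⟩))
          exact (Finset.card_erase_lt_of_mem hgS).trans_le hSc
        · rwa [Finset.erase_eq_of_notMem hgS] at h5

/-- The functional `x ↦ v ⬝ᵥ x`. -/
def dotL {d : ℕ} (v : Fin (d + 1) → ℝ) : (Fin (d + 1) → ℝ) →ₗ[ℝ] ℝ := dotProductBilin ℝ ℝ v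

@[simp] theorem dotL_apply {d : ℕ} (v x : Fin (d + 1) → ℝ) : dotL v x = v ⬝ᵥ x := rfl

theorem eq_zero_of_dotProduct_eq_zero {d : ℕ} {J : Type*} {u : J → Fin (d + 1) → ℝ} {S : Finset J}
    (hS : LinearIndepOn ℝ u (S : Set J)) (hc : S.card = d + 1) {x : Fin (d + 1) → ℝ}
    (hx : ∀ j ∈ S, u j ⬝ᵥ x = 0) : x = 0 := by
  have htop : Submodule.span ℝ (u '' S) = ⊤ := by
    have h1 : Fintype.card S = Module.finrank ℝ (Fin (d + 1) → ℝ) := by simp [hc]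
    have h2 := LinearIndependent.span_eq_top_of_card_eq_finrank' (b := fun j : S => u j) hS h1
    rw [← h2]
    congr 1
    ext y; simp
  have h3 : Submodule.span ℝ (u '' S) ≤ LinearMap.ker ((dotProductBilin ℝ ℝ).flip x) := by
    rw [Submodule.span_le]
    rintro _ ⟨j, hj, rfl⟩
    exact hx j hj
  have h4 : x ⬝ᵥ x = 0 := h3 (htop ▸ Submodule.mem_top : x ∈ _)
  exact dotProduct_self_eq_zero.1 h4

theorem linearIndepOn_single {d : ℕ} {J : Type*} (u : Fin (d + 1) ⊕ J → Fin (d + 1) → ℝ)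
    (hu : ∀ i, u (Sum.inl i) = Pi.single i 1) :
    LinearIndepOn ℝ u ((Finset.univ.map Function.Embedding.inl :
      Finset (Fin (d + 1) ⊕ J)) : Set (Fin (d + 1) ⊕ J)) := by
  rw [Finset.coe_map, Finset.coe_univ]
  refine LinearIndepOn.image_of_comp Sum.inl u (linearIndepOn_univ_iff.2 ?_)
  have : u ∘ Sum.inl = Pi.basisFun ℝ (Fin (d + 1)) := by
    ext i : 1
    simp [hu]
  rw [this]
  exact (Pi.basisFun ℝ (Fin (d + 1))).linearIndependent

theorem mem_patterns {W α : Type*} [AddCommGroup W] [Module ℝ W] {f : α → W →ₗ[ℝ] ℝ} {X : Finset W}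
    {U t : Finset α} : t ∈ patterns f X U ↔ ∃ x ∈ X, posSet f U x = t := Finset.mem_image

/-- The cutting theorem for a slight perturbation of the given functionals. -/
theorem exists_cutting_perturbed {d K : ℕ} (hd : 3 ≤ d) (hK : d - 1 ≤ K) : ∃ C : ℝ, 0 ≤ C ∧
    ∀ (ι : Type) [Fintype ι] (v : ι → Fin (d + 1) → ℝ) (X : Finset (Fin (d + 1) → ℝ)) (A : ℝ),
    (∀ x ∈ X, ∀ i, 0 < x i) → (∀ x ∈ X, ∀ h, v h ⬝ᵥ x ≠ 0) →
    (∀ R : Finset ι, ((patterns (fun h => dotL (v h)) X R).card : ℝ) ≤ A * ((R.card : ℝ) + 1) ^ K) →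
    ∀ p : ι → ℝ, (∀ h, 0 ≤ p h) → (∀ h, p h ≤ 1) → ∀ r : ℝ, 1 ≤ r → ∑ h, p h ≤ r →
    ∀ ε : ℝ, 0 < ε → ∃ u : ι → Fin (d + 1) → ℝ, (∀ h, ‖u h - v h‖ < ε) ∧
    ∃ (m : ℕ) (a : Fin m → Fin (d + 1) → Fin (d + 1) → ℝ), (∀ i k, ‖a i k‖ = 1) ∧
      ∑ i, Real.exp ((∑ h with Crosses (a i) (dotL (u h)), p h) / 2) ≤
        C * A * (r ^ K * (1 + Real.log r)) ∧
      (∀ i h, p h = 1 → ¬ Crosses (a i) (dotL (u h))) ∧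
      (∀ i j, i ≠ j → Disjoint (openCone (a i)) (openCone (a j))) ∧
      (∀ i, ∀ x ∈ openCone (a i), ∀ k, 0 ≤ x k) ∧
      ∀ x ∈ X, ∀ x', x' ≠ 0 → (∀ k, 0 ≤ x' k) →
        (∀ h, 0 ≤ (v h ⬝ᵥ x) * (u h ⬝ᵥ x')) → ∃ i, x' ∈ closedCone (a i) := by
  obtain ⟨C, hC, hcut⟩ := GenericArrangement.exists_cutting hd hK
  refine ⟨C, hC, fun ι _ v X A hX hXv hA p hp0 hp1 r hr hpr ε hε => ?_⟩
  -- the signs on `X` survive perturbations smaller than `δ`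
  obtain ⟨δ, hδ, hδX⟩ : ∃ δ > 0, ∀ u : ι → Fin (d + 1) → ℝ, (∀ h, ‖u h - v h‖ < δ) →
      ∀ x ∈ X, ∀ h, 0 < (v h ⬝ᵥ x) * (u h ⬝ᵥ x) := by
    have hopen : IsOpen {u : ι → Fin (d + 1) → ℝ | ∀ x ∈ X, ∀ h, 0 < (v h ⬝ᵥ x) * (u h ⬝ᵥ x)} := by
      have : {u : ι → Fin (d + 1) → ℝ | ∀ x ∈ X, ∀ h, 0 < (v h ⬝ᵥ x) * (u h ⬝ᵥ x)} =
          ⋂ x ∈ X, ⋂ h, {u | 0 < (v h ⬝ᵥ x) * (u h ⬝ᵥ x)} := by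
        ext u; simp
      rw [this]
      refine isOpen_biInter_finset fun x _ => isOpen_iInter_of_finite fun h =>
        isOpen_lt continuous_const ?_
      fun_prop
    obtain ⟨δ, hδ, hb⟩ := Metric.isOpen_iff.1 hopen v
      (fun x hx h => mul_self_pos.2 (hXv x hx h))
    refine ⟨δ, hδ, fun u hu => hb ?_⟩
    rw [Metric.mem_ball, dist_pi_lt_iff hδ]
    exact fun h => by rw [dist_eq_norm]; exact hu h
  obtain ⟨u, hu0, hu1, hu2⟩ := exists_generic (W := Fin (d + 1) → ℝ)
    (J := Fin (d + 1) ⊕ (ι ⊕ Bool)) (Finset.univ.map Function.Embedding.inl)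
    (Sum.elim (fun i => Pi.single i 1) (Sum.elim v fun b => if b then fun _ => 1 else 0))
    (linearIndepOn_single _ fun i => rfl) (lt_min (lt_min hε hδ) (by norm_num : (0 : ℝ) < 1 / 2))
  have hfr : Module.finrank ℝ (Fin (d + 1) → ℝ) = d + 1 := by simp
  rw [hfr] at hu2
  set ℓ := u (Sum.inr (Sum.inr true)) with hℓ
  set κ := u (Sum.inr (Sum.inr false)) with hκ
  have hℓ1 : ∀ i, 1 / 2 < ℓ i := by
    intro i
    have h1 := (norm_le_pi_norm _ i).trans_lt ((hu1 (Sum.inr (Sum.inr true))).trans_le (min_le_right _ _))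
    simp only [Sum.elim_inr, if_true, Pi.sub_apply, Real.norm_eq_abs] at h1
    have := (abs_lt.1 h1).1
    linarith
  have huv : ∀ h, ‖u (Sum.inr (Sum.inl h)) - v h‖ < ε ∧ ‖u (Sum.inr (Sum.inl h)) - v h‖ < δ := fun h =>
    lt_min_iff.1 ((hu1 (Sum.inr (Sum.inl h))).trans_le (min_le_left _ _))
  -- the indices of the arrangement
  let φ : Fin (d + 1) ⊕ ι ↪ Fin (d + 1) ⊕ (ι ⊕ Bool) :=
    ⟨Sum.map id Sum.inl, Sum.map_injective.2 ⟨Function.injective_id, Sum.inl_injective⟩⟩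
  have hsingle : ∀ i x, u (Sum.inl i) ⬝ᵥ x = x i := by
    intro i x
    rw [hu0 _ (by simp)]
    simp
  have hlev : ∀ x : Fin (d + 1) → ℝ, (∀ i, 0 ≤ x i) → ∀ i, x i / 2 ≤ ℓ ⬝ᵥ x := by
    intro x hx i
    have h1 : ℓ i * x i ≤ ℓ ⬝ᵥ x := Finset.single_le_sum (f := fun i => ℓ i * x i)
      (fun j _ => mul_nonneg ((by norm_num : (0 : ℝ) ≤ 1 / 2).trans (hℓ1 j).le) (hx j))
      (Finset.mem_univ i)
    nlinarith [hℓ1 i, hx i]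
  have hE0 : ∀ x : Fin (d + 1) → ℝ, (∀ e ∈ (Finset.univ.map Function.Embedding.inl :
      Finset (Fin (d + 1) ⊕ ι)), 0 ≤ dotL (u (φ e)) x) ↔ ∀ i, 0 ≤ x i := by
    intro x
    simp only [Finset.mem_map, Finset.mem_univ, true_and, forall_exists_index,
      forall_apply_eq_imp_iff]
    exact forall_congr' fun i => by rw [← hsingle i x]; rfl
  have hcont : ∀ v : Fin (d + 1) → ℝ, Continuous (dotL v) := fun v =>
    (dotL v).continuous_of_finiteDimensional
  let 𝒜 : GenericArrangement d (Fin (d + 1) ⊕ ι) :=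
    { f := fun j => dotL (u (φ j))
      level := dotL ℓ
      cost := dotL κ
      E := Finset.univ.map Function.Embedding.inl
      card_E := by simp
      compact := by
        refine (isCompact_Icc (a := (0 : Fin (d + 1) → ℝ)) (b := fun _ => 2)).of_isClosed_subset ?_ ?_
        · simp only [Set.ofPred_and, Set.ofPred_forall]
          exact (isClosed_biInter fun e _ => isClosed_le continuous_const (hcont _)).inter
            (isClosed_eq (hcont _) continuous_const)
        · rintro x ⟨h1, h2⟩
          rw [hE0] at h1
          refine ⟨h1, fun i => ?_⟩
          have := hlev x h1 i
          rw [dotL_apply] at h2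
          linarith
      level_pos := by
        intro x hx hx0
        rw [hE0] at hx
        obtain ⟨i, hi⟩ := Function.ne_iff.1 hx0
        have h1 : 0 < x i := lt_of_le_of_ne (hx i) (Ne.symm hi)
        have := hlev x hx i
        rw [dotL_apply]
        linarith
      gen := by
        intro S hS x hx
        refine eq_zero_of_dotProduct_eq_zero (u := u) (S := S.map φ) (hu2 _ ?_) ?_ ?_
        · simp [hS]
        · simp [hS]
        · intro j hj
          obtain ⟨i, hi, rfl⟩ := Finset.mem_map.1 hj
          exact hx i hi
      gen_cost := by
        intro S hS x hx hl hc
        have hn1 : Sum.inr (Sum.inr true) ∉ S.map φ := by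
          intro h
          obtain ⟨i, -, hi⟩ := Finset.mem_map.1 h
          rcases i with i | i <;> simp [φ] at hi
        have hn2 : Sum.inr (Sum.inr false) ∉ insert (Sum.inr (Sum.inr true)) (S.map φ) := by
          intro h
          rcases Finset.mem_insert.1 h with h | h
          · simp at h
          obtain ⟨i, -, hi⟩ := Finset.mem_map.1 h
          rcases i with i | i <;> simp [φ] at hi
        have hcard : (insert (Sum.inr (Sum.inr false))
            (insert (Sum.inr (Sum.inr true)) (S.map φ))).card = d + 1 := by
          rw [Finset.card_insert_of_notMem hn2, Finset.card_insert_of_notMem hn1, Finset.card_map]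
          omega
        refine eq_zero_of_dotProduct_eq_zero (u := u) (hu2 _ hcard.le) hcard ?_
        intro j hj
        rcases Finset.mem_insert.1 hj with rfl | hj
        · exact hc
        rcases Finset.mem_insert.1 hj with rfl | hj
        · exact hl
        · obtain ⟨i, hi, rfl⟩ := Finset.mem_map.1 hj
          exact hx i hi }
  have hfr' : ∀ h x, 𝒜.f (Sum.inr h) x = u (Sum.inr (Sum.inl h)) ⬝ᵥ x := fun h x => rfl
  have hfl : ∀ i x, 𝒜.f (Sum.inl i) x = x i := fun i x => hsingle i x
  have hmemE : ∀ j, j ∈ 𝒜.E ↔ ∃ i, j = Sum.inl i := fun j => by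
    change j ∈ Finset.univ.map Function.Embedding.inl ↔ _
    simp [eq_comm]
  have hYeq : ∀ _ : DecidableEq (Fin (d + 1) ⊕ ι), Finset.univ \ 𝒜.E =
      Finset.univ.map (Function.Embedding.inr : ι ↪ Fin (d + 1) ⊕ ι) := by
    intro _
    ext j
    simp only [Finset.mem_sdiff, Finset.mem_univ, true_and, hmemE, Finset.mem_map,
      Function.Embedding.inr_apply]
    rcases j with i | h <;> simp
  have hposu : ∀ x ∈ X, ∀ h, (0 < u (Sum.inr (Sum.inl h)) ⬝ᵥ x ↔ 0 < v h ⬝ᵥ x) := by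
    intro x hx h
    have := hδX (fun h => u (Sum.inr (Sum.inl h))) (fun h => (huv h).2) x hx h
    constructor
    · intro h1; exact pos_of_mul_pos_left this h1.le
    · intro h1; exact pos_of_mul_pos_right this h1.le
  have hX' : ∀ x ∈ X, ∀ e ∈ 𝒜.E, 0 < 𝒜.f e x := by
    intro x hx e he
    obtain ⟨i, rfl⟩ := (hmemE e).1 he
    rw [hfl]; exact hX x hx i
  have hA' : ∀ R : Finset (Fin (d + 1) ⊕ ι), Disjoint R 𝒜.E →
      ((patterns 𝒜.f X (𝒜.E ∪ R)).card : ℝ) ≤ A * ((R.card : ℝ) + 1) ^ K := by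
    intro R hR
    set R' : Finset ι := Finset.univ.filter fun h => Sum.inr h ∈ R with hR'
    have hRR : R = R'.map Function.Embedding.inr := by
      ext j
      rcases j with i | h
      · simp only [Finset.mem_map, Function.Embedding.inr_apply, reduceCtorEq, and_false,
          exists_false, iff_false]
        exact fun h => Finset.disjoint_left.1 hR h ((hmemE _).2 ⟨i, rfl⟩)
      · simp [hR']
    have hsub : patterns 𝒜.f X (𝒜.E ∪ R) ⊆ (patterns (fun h => dotL (v h)) X R').image
        fun t => 𝒜.E ∪ t.map Function.Embedding.inr := by
      intro t ht
      obtain ⟨x, hx, rfl⟩ := mem_patterns.1 ht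
      rw [Finset.mem_image]
      refine ⟨_, mem_patterns.2 ⟨x, hx, rfl⟩, ?_⟩
      ext j
      rcases j with i | h
      · simp [posSet, hmemE, hfl, hX x hx i]
      · simp [posSet, hmemE, hfr', hposu x hx, hR']
    have h7 := (Finset.card_le_card hsub).trans Finset.card_image_le
    have h8 : R'.card = R.card := by rw [hRR, Finset.card_map]
    rw [← h8]
    exact (Nat.cast_le.2 h7).trans (hA R')
  obtain ⟨m, a, h1, h2, h3, h4, h5, h6⟩ := hcut _ 𝒜 X A hX'
    (fun R hR => by convert hA' R hR) (Sum.elim 0 p)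
    (by rintro (i | h); exacts [le_rfl, hp0 h]) (by rintro (i | h); exacts [zero_le_one, hp1 h]) r hr
    (by rw [hYeq, Finset.sum_map]; exact hpr)
  refine ⟨fun h => u (Sum.inr (Sum.inl h)), fun h => (huv h).1, m, a, h1, ?_, fun i h hh => ?_, h4,
    fun i x hx k => ?_, fun x hx x' hx0 hx' hs => ?_⟩
  · refine le_of_eq_of_le (Finset.sum_congr rfl fun i _ => ?_) h2
    rw [hYeq, Finset.filter_map, Finset.sum_map]
    rfl
  · exact h3 i (Sum.inr h) (by simp [hmemE]) hh
  · rw [← hfl k x]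
    exact h5 i x hx _ ((hmemE _).2 ⟨k, rfl⟩)
  · refine h6 x hx x' hx0 fun j => ?_
    rcases j with i | h
    · rw [sg_of_mem (by simp [posSet, hfl, hX x hx i]), one_mul, hfl]
      exact hx' i
    · have hh := hs h
      by_cases hv : 0 < v h ⬝ᵥ x
      · rw [sg_of_mem (by simp [posSet, hfr', hposu x hx, hv]), one_mul, hfr']
        exact nonneg_of_mul_nonneg_right hh hv
      · rw [sg_of_notMem (by simp [posSet, hfr', hposu x hx]; exact not_lt.1 hv), hfr']
        have := lt_of_le_of_ne (not_lt.1 hv) (hXv x hx h)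
        nlinarith

section OpenCones

open Filter Topology

theorem isOpen_openCone {d : ℕ} (a : Fin (d + 1) → Fin (d + 1) → ℝ) : IsOpen (openCone a) := by
  simp only [openCone, Set.ofPred_forall]
  exact isOpen_iInter_of_finite fun k =>
    isOpen_lt continuous_const (dotL (a k)).continuous_of_finiteDimensional

theorem eventually_mem_openCone {d : ℕ} {a : ℕ → Fin (d + 1) → Fin (d + 1) → ℝ}
    {b : Fin (d + 1) → Fin (d + 1) → ℝ} (h : Tendsto a atTop (𝓝 b)) {x : Fin (d + 1) → ℝ}
    (hx : x ∈ openCone b) : ∀ᶠ n in atTop, x ∈ openCone (a n) := by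
  have : ∀ k, ∀ᶠ n in atTop, 0 < a n k ⬝ᵥ x := by
    intro k
    have h1 : Tendsto (fun n => a n k ⬝ᵥ x) atTop (𝓝 (b k ⬝ᵥ x)) := by
      have h2 : Continuous fun c : Fin (d + 1) → Fin (d + 1) → ℝ => c k ⬝ᵥ x := by fun_prop
      exact (h2.tendsto b).comp h
    exact h1.eventually_const_lt (hx k)
  exact eventually_all.2 this

theorem convex_openCone {d : ℕ} (a : Fin (d + 1) → Fin (d + 1) → ℝ) : Convex ℝ (openCone a) := by
  intro x hx y hy s t hs ht hst k
  rw [dotProduct_add, dotProduct_smul, dotProduct_smul, smul_eq_mul, smul_eq_mul]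
  rcases hs.eq_or_lt with rfl | hs
  · rw [zero_add] at hst; subst hst; simpa using hy k
  · have := mul_pos hs (hx k); have := mul_nonneg ht (hy k).le; linarith

/-- Crossing the open cone is stable under perturbation. -/
theorem eventually_crosses {d : ℕ} {a : ℕ → Fin (d + 1) → Fin (d + 1) → ℝ}
    {b : Fin (d + 1) → Fin (d + 1) → ℝ} (h : Tendsto a atTop (𝓝 b)) {u : ℕ → Fin (d + 1) → ℝ}
    {v : Fin (d + 1) → ℝ} (hu : Tendsto u atTop (𝓝 v)) (hv : v ≠ 0) (hc : Crosses b (dotL v)) :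
    ∀ᶠ n in atTop, Crosses (a n) (dotL (u n)) := by
  obtain ⟨x, hx, hx0⟩ := hc
  rw [dotL_apply] at hx0
  have hvv : 0 < v ⬝ᵥ v := lt_of_le_of_ne (by simpa using dotProduct_star_self_nonneg v)
    (fun h => hv (dotProduct_self_eq_zero.1 h.symm))
  have hmem : ∀ᶠ s : ℝ in 𝓝 0, x + s • v ∈ openCone b := by
    have : Tendsto (fun s : ℝ => x + s • v) (𝓝 0) (𝓝 (x + (0 : ℝ) • v)) := by
      refine Continuous.tendsto ?_ 0
      fun_prop
    refine this ((isOpen_openCone b).mem_nhds ?_)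
    simpa using hx
  obtain ⟨s, hs, hball⟩ := Metric.eventually_nhds_iff.1 hmem
  have h1 : x + (s / 2) • v ∈ openCone b := hball (by simp [abs_of_pos hs]; linarith)
  have h2 : x + (-(s / 2)) • v ∈ openCone b := hball (by simp [abs_of_pos hs]; linarith)
  have hlim : ∀ y : Fin (d + 1) → ℝ, Tendsto (fun n => u n ⬝ᵥ y) atTop (𝓝 (v ⬝ᵥ y)) := by
    intro y
    have h2 : Continuous fun c : Fin (d + 1) → ℝ => c ⬝ᵥ y := by fun_prop
    exact (h2.tendsto v).comp hu
  have h3 : ∀ᶠ n in atTop, 0 < u n ⬝ᵥ (x + (s / 2) • v) := by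
    refine (hlim _).eventually_const_lt ?_
    rw [dotProduct_add, dotProduct_smul, hx0, zero_add, smul_eq_mul]
    positivity
  have h4 : ∀ᶠ n in atTop, u n ⬝ᵥ (x + (-(s / 2)) • v) < 0 := by
    refine (hlim _).eventually_lt_const ?_
    rw [dotProduct_add, dotProduct_smul, hx0, zero_add, smul_eq_mul]
    nlinarith
  filter_upwards [h3, h4, eventually_mem_openCone h h1, eventually_mem_openCone h h2] with n g3 g4 g1 g2
  exact (convex_openCone (a n)).isPreconnected.intermediate_value g2 g1
    (dotL (u n)).continuous_of_finiteDimensional.continuousOn ⟨g4.le, g3.le⟩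

/-- The cutting theorem for an arbitrary family of functionals on the positive orthant. -/
theorem exists_cutting_orthant {d K : ℕ} (hd : 3 ≤ d) (hK : d - 1 ≤ K) : ∃ C : ℝ, 0 ≤ C ∧
    ∀ (ι : Type) [Fintype ι] (v : ι → Fin (d + 1) → ℝ) (X : Finset (Fin (d + 1) → ℝ)) (A : ℝ),
    (∀ h, v h ≠ 0) → (∀ x ∈ X, ∀ i, 0 < x i) → (∀ x ∈ X, ∀ h, v h ⬝ᵥ x ≠ 0) →
    (∀ R : Finset ι, ((patterns (fun h => dotL (v h)) X R).card : ℝ) ≤ A * ((R.card : ℝ) + 1) ^ K) →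
    ∀ p : ι → ℝ, (∀ h, 0 ≤ p h) → (∀ h, p h ≤ 1) → ∀ r : ℝ, 1 ≤ r → ∑ h, p h ≤ r →
    ∃ (m : ℕ) (a : Fin m → Fin (d + 1) → Fin (d + 1) → ℝ), (∀ i k, ‖a i k‖ = 1) ∧
      ∑ i, Real.exp ((∑ h with Crosses (a i) (dotL (v h)), p h) / 2) ≤
        C * A * (r ^ K * (1 + Real.log r)) ∧
      (∀ i h, p h = 1 → ¬ Crosses (a i) (dotL (v h))) ∧
      (∀ i j, i ≠ j → Disjoint (openCone (a i)) (openCone (a j))) ∧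
      (∀ i, ∀ x ∈ openCone (a i), ∀ k, 0 ≤ x k) ∧
      ∀ x ∈ X, ∀ x', x' ≠ 0 → (∀ k, 0 ≤ x' k) →
        (∀ h, 0 < (v h ⬝ᵥ x) * (v h ⬝ᵥ x')) → ∃ i, x' ∈ closedCone (a i) := by
  obtain ⟨C, hC, hcut⟩ := exists_cutting_perturbed hd hK
  refine ⟨C, hC, fun ι _ v X A hv hX hXv hA p hp0 hp1 r hr hpr => ?_⟩
  choose u hu m a h1 h2 h3 h4 h5 h6 using fun n : ℕ =>
    hcut ι v X A hX hXv hA p hp0 hp1 r hr hpr (1 / ((n : ℝ) + 1)) (by positivity)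
  set B := C * A * (r ^ K * (1 + Real.log r)) with hB
  have hm : ∀ n, m n < ⌊B⌋₊ + 1 := by
    intro n
    have hle : (m n : ℝ) ≤ B := by
      refine le_trans ?_ (h2 n)
      calc (m n : ℝ) = ∑ i : Fin (m n), (1 : ℝ) := by simp
        _ ≤ _ := Finset.sum_le_sum fun i _ => Real.one_le_exp
          (div_nonneg (Finset.sum_nonneg fun h _ => hp0 h) (by norm_num))
    exact Nat.lt_succ_of_le (Nat.le_floor hle)
  obtain ⟨M, hM⟩ : ∃ M, ∃ᶠ n in atTop, m n = M := by
    by_contra hno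
    push Not at hno
    have h7 : ∀ᶠ n in atTop, ∀ M ∈ Finset.range (⌊B⌋₊ + 1), m n ≠ M :=
      (Finset.eventually_all _).2 fun M _ => by simpa using hno M
    obtain ⟨n, hn⟩ := h7.exists
    exact hn (m n) (Finset.mem_range.2 (hm n)) rfl
  have hulim : Tendsto u atTop (𝓝 v) := by
    rw [tendsto_pi_nhds]
    intro h
    rw [tendsto_iff_norm_sub_tendsto_zero]
    exact squeeze_zero (fun _ => norm_nonneg _) (fun n => (hu n h).le) tendsto_one_div_add_atTop_nhds_zero_nat
  have hex : ∃ᶠ n in atTop, ∃ b : Fin M → Fin (d + 1) → Fin (d + 1) → ℝ, (∀ i k, ‖b i k‖ = 1) ∧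
      ∑ i, Real.exp ((∑ h with Crosses (b i) (dotL (u n h)), p h) / 2) ≤ B ∧
      (∀ i h, p h = 1 → ¬ Crosses (b i) (dotL (u n h))) ∧
      (∀ i j, i ≠ j → Disjoint (openCone (b i)) (openCone (b j))) ∧
      (∀ i, ∀ x ∈ openCone (b i), ∀ k, 0 ≤ x k) ∧
      ∀ x ∈ X, ∀ x', x' ≠ 0 → (∀ k, 0 ≤ x' k) →
        (∀ h, 0 ≤ (v h ⬝ᵥ x) * (u n h ⬝ᵥ x')) → ∃ i, x' ∈ closedCone (b i) := by
    refine hM.mono fun n hn => ?_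
    subst hn
    exact ⟨a n, h1 n, h2 n, h3 n, h4 n, h5 n, h6 n⟩
  clear h1 h2 h3 h4 h5 h6 hm hM
  obtain ⟨φ, hφ, hφP⟩ := extraction_of_frequently_atTop hex
  choose b h1 h2 h3 h4 h5 h6 using hφP
  have hcomp : IsCompact (Set.univ.pi fun _ : Fin M => Set.univ.pi fun _ : Fin (d + 1) =>
      Metric.sphere (0 : Fin (d + 1) → ℝ) 1) :=
    isCompact_univ_pi fun _ => isCompact_univ_pi fun _ => isCompact_sphere _ _
  obtain ⟨c, hc, ψ, hψ, hlim⟩ := hcomp.tendsto_subseq (x := b)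
    (fun n i _ k _ => by simpa using h1 n i k)
  have hci : ∀ i, Tendsto (fun n => b (ψ n) i) atTop (𝓝 (c i)) := fun i => (tendsto_pi_nhds.1 hlim) i
  have huh : ∀ h, Tendsto (fun n => u (φ (ψ n)) h) atTop (𝓝 (v h)) := fun h =>
    (tendsto_pi_nhds.1 hulim h).comp (hφ.tendsto_atTop.comp hψ.tendsto_atTop)
  have hcr : ∀ᶠ n in atTop, ∀ i h, Crosses (c i) (dotL (v h)) →
      Crosses (b (ψ n) i) (dotL (u (φ (ψ n)) h)) := by
    rw [eventually_all]
    intro i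
    rw [eventually_all]
    intro h
    by_cases hcr : Crosses (c i) (dotL (v h))
    · exact (eventually_crosses (hci i) (huh h) (hv h) hcr).mono fun n hn _ => hn
    · exact Eventually.of_forall fun n h => absurd h hcr
  refine ⟨M, c, fun i k => by simpa using hc i trivial k trivial, ?_, fun i h hh hcross => ?_,
    fun i j hij => Set.disjoint_left.2 fun x hx hx' => ?_, fun i x hx k => ?_,
    fun x hx x' hx0 hx' hs => ?_⟩
  · obtain ⟨n, hn⟩ := hcr.exists
    refine le_trans (Finset.sum_le_sum fun i _ => Real.exp_le_exp.2
      (div_le_div_of_nonneg_right ?_ (by norm_num))) (h2 (ψ n))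
    refine Finset.sum_le_sum_of_subset_of_nonneg (fun h hh => ?_) fun h _ _ => hp0 h
    exact Finset.mem_filter.2 ⟨Finset.mem_univ _, hn i h (Finset.mem_filter.1 hh).2⟩
  · obtain ⟨n, hn⟩ := hcr.exists
    exact h3 (ψ n) i h hh (hn i h hcross)
  · obtain ⟨n, hn, hn'⟩ := ((eventually_mem_openCone (hci i) hx).and
      (eventually_mem_openCone (hci j) hx')).exists
    exact Set.disjoint_left.1 (h4 (ψ n) i j hij) hn hn'
  · obtain ⟨n, hn⟩ := (eventually_mem_openCone (hci i) hx).exists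
    exact h5 (ψ n) i x hn k
  · by_contra hno
    push Not at hno
    have hout : ∀ᶠ n in atTop, ∀ i, x' ∉ closedCone (b (ψ n) i) := by
      rw [eventually_all]
      intro i
      have := hno i
      simp only [closedCone, Set.mem_ofPred_eq, not_forall, not_le] at this
      obtain ⟨k, hk⟩ := this
      have hl : Tendsto (fun n => b (ψ n) i k ⬝ᵥ x') atTop (𝓝 (c i k ⬝ᵥ x')) := by
        have h2 : Continuous fun c : Fin (d + 1) → Fin (d + 1) → ℝ => c k ⬝ᵥ x' := by fun_prop
        exact (h2.tendsto (c i)).comp (hci i)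
      filter_upwards [hl.eventually_lt_const hk] with n hn hmem
      exact absurd (hmem k) (not_le.2 hn)
    have hsgn : ∀ᶠ n in atTop, ∀ h, 0 < (v h ⬝ᵥ x) * (u (φ (ψ n)) h ⬝ᵥ x') := by
      rw [eventually_all]
      intro h
      have hl : Tendsto (fun n => (v h ⬝ᵥ x) * (u (φ (ψ n)) h ⬝ᵥ x')) atTop
          (𝓝 ((v h ⬝ᵥ x) * (v h ⬝ᵥ x'))) := by
        have h2 : Continuous fun c : Fin (d + 1) → ℝ => (v h ⬝ᵥ x) * (c ⬝ᵥ x') := by fun_prop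
        exact (h2.tendsto (v h)).comp (huh h)
      exact hl.eventually_const_lt (hs h)
    obtain ⟨n, hn, hn'⟩ := (hout.and hsgn).exists
    obtain ⟨i, hi⟩ := h6 (ψ n) x hx x' hx0 hx' fun h => (hn' h).le
    exact hn i hi

end OpenCones

theorem exists_representatives {ι W : Type*} [Fintype ι] [AddCommGroup W] [Module ℝ W]
    (f : ι → W →ₗ[ℝ] ℝ) (Q : W → Prop) :
    ∃ X : Finset W, (∀ x ∈ X, Q x) ∧
      ∀ y, Q y → ∃ x ∈ X, ∀ h, (0 < f h x ↔ 0 < f h y) := by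
  refine ⟨Finset.univ.image fun t : {t : Finset ι // ∃ x, Q x ∧ posSet f Finset.univ x = t} =>
    t.2.choose, fun x hx => ?_, fun y hy => ?_⟩
  · obtain ⟨t, -, rfl⟩ := Finset.mem_image.1 hx
    exact t.2.choose_spec.1
  · set t : {t : Finset ι // ∃ x, Q x ∧ posSet f Finset.univ x = t} :=
      ⟨posSet f Finset.univ y, y, hy, rfl⟩
    refine ⟨t.2.choose, Finset.mem_image_of_mem _ (Finset.mem_univ t), fun h => ?_⟩
    have := Finset.ext_iff.1 t.2.choose_spec.2 h
    have h2 : ∀ z, h ∈ posSet f Finset.univ z ↔ 0 < f h z := fun z =>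
      Finset.mem_filter.trans (and_iff_right (Finset.mem_univ h))
    exact (h2 _).symm.trans (this.trans (h2 y))

theorem pos_of_mem_openCone {d : ℕ} {a : Fin (d + 1) → Fin (d + 1) → ℝ}
    (ha : ∀ x ∈ openCone a, ∀ k, 0 ≤ x k) {x : Fin (d + 1) → ℝ} (hx : x ∈ openCone a)
    (k : Fin (d + 1)) : 0 < x k := by
  refine lt_of_le_of_ne (ha x hx k) fun h0 => ?_
  have hev : ∀ᶠ s : ℝ in nhds 0, x + s • Pi.single k (1 : ℝ) ∈ openCone a := by
    have : Filter.Tendsto (fun s : ℝ => x + s • Pi.single k (1 : ℝ)) (nhds 0)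
        (nhds (x + (0 : ℝ) • Pi.single k (1 : ℝ))) := by
      refine Continuous.tendsto ?_ 0
      fun_prop
    refine this ((isOpen_openCone a).mem_nhds ?_)
    simpa using hx
  obtain ⟨s, hs, hball⟩ := Metric.eventually_nhds_iff.1 hev
  have h1 := ha _ (hball (y := -(s / 2)) (by simp [abs_of_pos hs]; linarith)) k
  simp [← h0] at h1
  linarith

theorem exists_log_constant (C : ℝ) (hC : 1 ≤ C) (N : ℕ) (hN : 1 ≤ N) :
    ∃ κ : ℝ, 1 ≤ κ ∧ ∀ x : ℝ, 1 ≤ x → 2 * Real.log (C * (κ * x ^ 2) ^ N) ≤ κ * x := by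
  have hc : 0 ≤ Real.log C := Real.log_nonneg hC
  have hN' : (1 : ℝ) ≤ N := by exact_mod_cast hN
  set t := 2 * Real.log C + 8 * N with ht
  have ht1 : 1 ≤ t := by linarith
  refine ⟨t ^ 2, one_le_pow₀ ht1, fun x hx => ?_⟩
  have hx0 : 0 < x := by linarith
  rw [Real.log_mul (by positivity) (by positivity), Real.log_pow,
    Real.log_mul (by positivity) (by positivity), Real.log_pow, Real.log_pow]
  have h1 := Real.log_le_sub_one_of_pos (show 0 < t by linarith)
  have h2 := Real.log_le_sub_one_of_pos hx0
  push_cast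
  have h3 : (N : ℝ) * (2 * Real.log t + 2 * Real.log x) ≤ N * (2 * t + 2 * x) :=
    mul_le_mul_of_nonneg_left (by linarith) (by linarith)
  have h5 : t * 1 ≤ t * x := mul_le_mul_of_nonneg_left hx (by linarith)
  have h6 : t ^ 2 * x = 2 * Real.log C * (t * x) + 8 * (N * (t * x)) := by
    rw [sq, ht]; ring
  have h7 : 1 ≤ t * x := by linarith
  have h8 : Real.log C * 1 ≤ Real.log C * (t * x) := mul_le_mul_of_nonneg_left h7 hc
  have h9 : (N : ℝ) * t ≤ N * (t * x) := mul_le_mul_of_nonneg_left (by linarith) (by linarith)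
  have h10 : (N : ℝ) * x ≤ N * (t * x) := mul_le_mul_of_nonneg_left (by nlinarith) (by linarith)
  nlinarith

/-- A cutting of the whole orthant with exponentially many pieces. -/
theorem exists_crude_cutting {d : ℕ} (hd : 3 ≤ d) : ∃ C : ℝ, 0 ≤ C ∧
    ∀ (ι : Type) [Fintype ι] (v : ι → Fin (d + 1) → ℝ), (∀ h, v h ≠ 0) →
    ∀ p : ι → ℝ, (∀ h, 0 ≤ p h) →
    ∃ (m : ℕ) (a : Fin m → Fin (d + 1) → Fin (d + 1) → ℝ), (∀ i k, a i k ≠ 0) ∧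
      (m : ℝ) ≤ C * Real.exp ((∑ h, p h) / 2) ∧
      (∀ i, ∑ h with Crosses (a i) (dotL (v h)), p h ≤ 1) ∧
      (∀ i j, i ≠ j → Disjoint (openCone (a i)) (openCone (a j))) ∧
      (∀ i, ∀ x ∈ openCone (a i), ∀ k, 0 < x k) ∧
      ∀ x, x ≠ 0 → (∀ k, 0 ≤ x k) → (∀ h, v h ⬝ᵥ x ≠ 0) → ∃ i, x ∈ closedCone (a i) := by
  obtain ⟨C, hC, hcut⟩ := exists_cutting_orthant (K := d + 1) hd (by omega)
  set C' := C * (d + 2) + 1 with hC'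
  have hC1 : 1 ≤ C' := by
    have : 0 ≤ C * (d + 2) := by positivity
    linarith
  obtain ⟨κ, hκ, hlog⟩ := exists_log_constant C' hC1 (d + 2) (by omega)
  refine ⟨C' * κ ^ (d + 2) * (2 ^ (2 * (d + 2)) * (2 * (d + 2)).factorial) + 1, by positivity,
    fun ι _ v hv p hp => ?_⟩
  set x := ∑ h, p h with hx
  have hx0 : 0 ≤ x := Finset.sum_nonneg fun h _ => hp h
  have hCpos : 0 ≤ C' * κ ^ (d + 2) * (2 ^ (2 * (d + 2)) * (2 * (d + 2)).factorial) := by positivity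
  rcases le_total x 1 with hx1 | hx1
  · have hdot : ∀ (k : Fin (d + 1)) (y : Fin (d + 1) → ℝ), (Pi.single k (1 : ℝ) : Fin (d + 1) → ℝ) ⬝ᵥ y = y k :=
      fun k y => by simp
    refine ⟨1, fun _ k => Pi.single k 1, fun i k => by simp, ?_, fun i => ?_, fun i j hij => ?_,
      fun i y hy k => ?_, fun y _ hy _ => ⟨0, fun k => ?_⟩⟩
    · have := Real.one_le_exp (x := x / 2) (by positivity)
      push_cast
      nlinarith
    · exact (Finset.sum_le_sum_of_subset_of_nonneg (Finset.filter_subset _ _)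
        fun h _ _ => hp h).trans hx1
    · exact absurd (Subsingleton.elim i j) hij
    · have := hy k
      rwa [hdot] at this
    · rw [hdot]; exact hy k
  · set s := κ * x ^ 2 with hs
    have hs1 : 1 ≤ s := by nlinarith
    set q : ι → ℝ := fun h => min 1 (s * p h / x) with hq
    have hxpos : 0 < x := by linarith
    have hq0 : ∀ h, 0 ≤ q h := fun h => le_min zero_le_one (by have := hp h; positivity)
    have hqs : ∑ h, q h ≤ s := by
      calc ∑ h, q h ≤ ∑ h, s * p h / x := Finset.sum_le_sum fun h _ => min_le_right _ _
        _ = s := by rw [← Finset.sum_div, ← Finset.mul_sum, ← hx]; field_simp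
    obtain ⟨X, hX, hXr⟩ := exists_representatives (fun h => dotL (v h))
      fun x : Fin (d + 1) → ℝ => (∀ i, 0 < x i) ∧ ∀ h, v h ⬝ᵥ x ≠ 0
    obtain ⟨m, a, h1, h2, h3, h4, h5, h6⟩ := hcut ι v X (d + 2) hv (fun x hx => (hX x hx).1)
      (fun x hx => (hX x hx).2) (fun R => by
        have := card_family_le R (patterns (fun h => dotL (v h)) X R) (d + 1)
          (fun t ht => patterns_subset ht)
          (fun S hS => by
            have := card_of_shatters_patterns _ X R S hS
            simpa using this)
        exact_mod_cast this) q hq0 (fun h => min_le_left _ _) s hs1 hqs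
    have hB : C * (d + 2) * (s ^ (d + 1) * (1 + Real.log s)) ≤ C' * s ^ (d + 2) := by
      have hl := Real.log_le_sub_one_of_pos (show 0 < s by linarith)
      have hs' : s ^ (d + 1) * (1 + Real.log s) ≤ s ^ (d + 2) := by
        rw [pow_succ s (d + 1)]
        exact mul_le_mul_of_nonneg_left (by linarith) (by positivity)
      have h8 : C * (d + 2) ≤ C' := by linarith
      exact mul_le_mul h8 hs' (mul_nonneg (by positivity)
        (by have := Real.log_nonneg hs1; linarith)) (by linarith)
    have hterm : ∀ i, Real.exp ((∑ h with Crosses (a i) (dotL (v h)), q h) / 2) ≤ C' * s ^ (d + 2) := fun i =>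
      (Finset.single_le_sum (f := fun i => Real.exp ((∑ h with Crosses (a i) (dotL (v h)), q h) / 2))
        (fun i _ => (Real.exp_pos _).le) (Finset.mem_univ i)).trans (h2.trans hB)
    refine ⟨m, a, fun i k h0 => ?_, ?_, fun i => ?_, h4,
      fun i y hy k => pos_of_mem_openCone (h5 i) hy k, fun y hy0 hy hyv => ?_⟩
    · have := h1 i k
      rw [h0, norm_zero] at this
      exact zero_ne_one this
    · have hm : (m : ℝ) ≤ C' * s ^ (d + 2) := by
        refine le_trans ?_ (h2.trans hB)
        calc (m : ℝ) = ∑ i : Fin m, (1 : ℝ) := by simp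
          _ ≤ _ := Finset.sum_le_sum fun i _ => Real.one_le_exp
            (div_nonneg (Finset.sum_nonneg fun h _ => hq0 h) (by norm_num))
      have hpow := Real.pow_div_factorial_le_exp (x / 2) (by positivity) (2 * (d + 2))
      rw [div_le_iff₀ (by positivity)] at hpow
      have he : C' * s ^ (d + 2) = C' * κ ^ (d + 2) * 2 ^ (2 * (d + 2)) * (x / 2) ^ (2 * (d + 2)) := by
        rw [hs, mul_pow, ← pow_mul, div_pow]; field_simp
      rw [he] at hm
      have h9 : C' * κ ^ (d + 2) * 2 ^ (2 * (d + 2)) * (x / 2) ^ (2 * (d + 2)) ≤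
        C' * κ ^ (d + 2) * 2 ^ (2 * (d + 2)) * (Real.exp (x / 2) * (2 * (d + 2)).factorial) :=
        mul_le_mul_of_nonneg_left hpow (by positivity)
      have h10 := Real.exp_pos (x / 2)
      nlinarith
    · have h7 : ∑ h with Crosses (a i) (dotL (v h)), q h ≤ κ * x := by
        have h8 := (Real.le_log_iff_exp_le (by positivity)).2 (hterm i)
        have := hlog x hx1
        rw [← hs] at this
        linarith
      have h8 : ∑ h with Crosses (a i) (dotL (v h)), p h =
          x / s * ∑ h with Crosses (a i) (dotL (v h)), q h := by
        rw [Finset.mul_sum]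
        refine Finset.sum_congr rfl fun h hh => ?_
        have h9 : q h ≠ 1 := fun h9 => h3 i h h9 (Finset.mem_filter.1 hh).2
        have h10 : q h = s * p h / x := by
          rcases min_choice 1 (s * p h / x) with h' | h'
          · exact absurd h' h9
          · exact h'
        rw [h10]; field_simp
      rw [h8]
      calc x / s * _ ≤ x / s * (κ * x) := mul_le_mul_of_nonneg_left h7 (by positivity)
        _ = 1 := by rw [hs]; field_simp
    · obtain ⟨z, hz, hzs⟩ : ∃ z : Fin (d + 1) → ℝ, (∀ i, 0 < z i) ∧ ∀ h, 0 < (v h ⬝ᵥ z) * (v h ⬝ᵥ y) := by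
        have hev : ∀ᶠ s : ℝ in nhds 0, ∀ h, 0 < (v h ⬝ᵥ (y + s • 1)) * (v h ⬝ᵥ y) := by
          rw [Filter.eventually_all]
          intro h
          have : Filter.Tendsto (fun s : ℝ => (v h ⬝ᵥ (y + s • 1)) * (v h ⬝ᵥ y)) (nhds 0)
              (nhds ((v h ⬝ᵥ (y + (0 : ℝ) • 1)) * (v h ⬝ᵥ y))) := by
            refine Continuous.tendsto ?_ 0
            fun_prop
          refine this.eventually_const_lt ?_
          rw [zero_smul, add_zero]
          exact mul_self_pos.2 (hyv h)
        obtain ⟨ε, hε, hball⟩ := Metric.eventually_nhds_iff.1 hev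
        refine ⟨y + (ε / 2) • 1, fun i => ?_, hball (by simp [abs_of_pos hε]; linarith)⟩
        have := hy i
        simp
        linarith
      obtain ⟨w, hw, hws⟩ := hXr z ⟨hz, fun h h0 => by
        have := hzs h
        rw [h0, zero_mul] at this
        exact lt_irrefl _ this⟩
      refine h6 w hw y hy0 hy fun h => ?_
      have h7 := hws h
      have h8 := hzs h
      have h9 := (hX w hw).2 h
      simp only [dotL_apply] at h7
      rcases lt_or_gt_of_ne h9 with h9 | h9
      · have h10 : ¬ 0 < v h ⬝ᵥ z := fun h10 => absurd (h7.2 h10) (not_lt.2 h9.le)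
        nlinarith [neg_of_mul_pos_right h8 (not_lt.1 h10)]
      · exact mul_pos h9 (pos_of_mul_pos_right h8 (h7.1 h9).le)

theorem mulVec_injective_of_openCone {d : ℕ} {a : Fin (d + 1) → Fin (d + 1) → ℝ}
    (hne : (openCone a).Nonempty) (ha : ∀ x ∈ openCone a, ∀ k, 0 ≤ x k) :
    Function.Injective (Matrix.of a).mulVec := by
  obtain ⟨y, hy⟩ := hne
  rw [← Matrix.coe_mulVecLin, ← LinearMap.ker_eq_bot, LinearMap.ker_eq_bot']
  intro x hx
  have h0 : ∀ k, a k ⬝ᵥ x = 0 := fun k => congrFun hx k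
  have hmem : ∀ s : ℝ, y + s • x ∈ openCone a := fun s k => by
    rw [dotProduct_add, dotProduct_smul, h0, smul_zero, add_zero]
    exact hy k
  ext k
  by_contra hk
  have := ha _ (hmem (-(y k + 1) / x k)) k
  simp at this
  rw [div_mul_cancel₀ _ hk] at this
  linarith

/-- A cone inside the orthant can be subdivided into exponentially many pieces of bounded
crossing weight. -/
theorem exists_refinement {d : ℕ} (hd : 3 ≤ d) : ∃ C : ℝ, 0 ≤ C ∧
    ∀ (ι : Type) [Fintype ι] (v : ι → Fin (d + 1) → ℝ), (∀ h, v h ≠ 0) →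
    ∀ p : ι → ℝ, (∀ h, 0 ≤ p h) →
    ∀ a : Fin (d + 1) → Fin (d + 1) → ℝ, (∀ k, a k ≠ 0) → (∀ x ∈ openCone a, ∀ k, 0 ≤ x k) →
    ∃ (m : ℕ) (b : Fin m → Fin (d + 1) → Fin (d + 1) → ℝ), (∀ i k, b i k ≠ 0) ∧
      (m : ℝ) ≤ C * Real.exp ((∑ h with Crosses a (dotL (v h)), p h) / 2) ∧
      (∀ i, ∑ h with Crosses (b i) (dotL (v h)), p h ≤ 1) ∧
      (∀ i j, i ≠ j → Disjoint (openCone (b i)) (openCone (b j))) ∧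
      (∀ i, openCone (b i) ⊆ openCone a) ∧
      ∀ x, x ≠ 0 → x ∈ closedCone a → (∀ h, v h ⬝ᵥ x ≠ 0) → ∃ i, x ∈ closedCone (b i) := by
  obtain ⟨C, hC, hcut⟩ := exists_crude_cutting hd
  refine ⟨C + 1, by positivity, fun ι _ v hv p hp a ha0 ha => ?_⟩
  rcases (openCone a).eq_empty_or_nonempty with he | hne
  · have hno : ∀ h, ¬ Crosses a (dotL (v h)) := fun h ⟨x, hx, _⟩ => by simp [he] at hx
    refine ⟨1, fun _ => a, fun _ => ha0, ?_, fun _ => ?_, fun i j hij => ?_,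
      fun _ => subset_rfl, fun x _ hx _ => ⟨0, hx⟩⟩
    · rw [Finset.filter_false_of_mem fun h _ => hno h]
      simpa using hC
    · rw [Finset.filter_false_of_mem fun h _ => hno h]
      simp
    · exact absurd (Subsingleton.elim i j) hij
  · set M : Matrix (Fin (d + 1)) (Fin (d + 1)) ℝ := Matrix.of a with hM
    have hinj := mulVec_injective_of_openCone hne ha
    have hunit : IsUnit M := Matrix.mulVec_injective_iff_isUnit.1 hinj
    have hdet : IsUnit M.det := (Matrix.isUnit_iff_isUnit_det M).1 hunit
    have hvinj : Function.Injective (fun u : Fin (d + 1) → ℝ => Matrix.vecMul u M) :=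
      Matrix.vecMul_injective_iff_isUnit.2 hunit
    have hvM : ∀ h, Matrix.vecMul (Matrix.vecMul (v h) M⁻¹) M = v h := fun h => by
      rw [Matrix.vecMul_vecMul, Matrix.nonsing_inv_mul _ hdet, Matrix.vecMul_one]
    set v' : ι → Fin (d + 1) → ℝ := fun h => Matrix.vecMul (v h) M⁻¹ with hv'
    have hdot : ∀ h x, v' h ⬝ᵥ M.mulVec x = v h ⬝ᵥ x := fun h x => by
      rw [Matrix.dotProduct_mulVec, hvM]
    have hv'0 : ∀ h, v' h ≠ 0 := fun h h0 => hv h (by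
      rw [← hvM h, show Matrix.vecMul (v h) M⁻¹ = 0 from h0, Matrix.zero_vecMul])
    set p' : ι → ℝ := fun h => if Crosses a (dotL (v h)) then p h else 0 with hp'
    have hp'0 : ∀ h, 0 ≤ p' h := fun h => by
      simp only [hp']; split_ifs; exacts [hp h, le_rfl]
    obtain ⟨m, b', h1, h2, h3, h4, h5, h6⟩ := hcut ι v' hv'0 p' hp'0
    set b : Fin m → Fin (d + 1) → Fin (d + 1) → ℝ := fun i k => Matrix.vecMul (b' i k) M with hb
    have hbdot : ∀ i k x, b i k ⬝ᵥ x = b' i k ⬝ᵥ M.mulVec x := fun i k x =>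
      (Matrix.dotProduct_mulVec _ _ _).symm
    have hopen : ∀ i x, x ∈ openCone (b i) ↔ M.mulVec x ∈ openCone (b' i) := fun i x =>
      forall_congr' fun k => by rw [hbdot]
    have hclosed : ∀ i x, x ∈ closedCone (b i) ↔ M.mulVec x ∈ closedCone (b' i) := fun i x =>
      forall_congr' fun k => by rw [hbdot]
    have hsub : ∀ i, openCone (b i) ⊆ openCone a := fun i x hx k => h5 i _ ((hopen i x).1 hx) k
    refine ⟨m, b, fun i k h0 => h1 i k (hvinj ?_), ?_, fun i => ?_, fun i j hij => ?_, hsub,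
      fun x hx0 hx hxv => ?_⟩
    · simpa [hb] using h0
    · have h7 : ∑ h, p' h = ∑ h with Crosses a (dotL (v h)), p h := by
        rw [Finset.sum_filter]
      rw [h7] at h2
      refine h2.trans (mul_le_mul_of_nonneg_right (by linarith) (Real.exp_pos _).le)
    · refine le_trans ?_ (h3 i)
      have hcr : ∀ h, Crosses (b i) (dotL (v h)) → Crosses a (dotL (v h)) ∧
          Crosses (b' i) (dotL (v' h)) := by
        rintro h ⟨x, hx, hx0⟩
        refine ⟨⟨x, hsub i hx, hx0⟩, M.mulVec x, (hopen i x).1 hx, ?_⟩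
        rw [dotL_apply, hdot]
        exact hx0
      have h8 : ∀ h, Crosses (b i) (dotL (v h)) → p h = p' h := fun h hh => by
        simp only [hp']
        rw [if_pos (hcr h hh).1]
      rw [Finset.sum_congr rfl fun h hh => h8 h (Finset.mem_filter.1 hh).2]
      refine Finset.sum_le_sum_of_subset_of_nonneg (fun h hh => ?_) fun h _ _ => hp'0 h
      exact Finset.mem_filter.2 ⟨Finset.mem_univ h, (hcr h (Finset.mem_filter.1 hh).2).2⟩
    · rw [Set.disjoint_left]
      exact fun x hx hx' => Set.disjoint_left.1 (h4 i j hij) ((hopen i x).1 hx) ((hopen j x).1 hx')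
    · obtain ⟨i, hi⟩ := h6 (M.mulVec x) (fun h0 => hx0 (hinj (by rw [h0, Matrix.mulVec_zero])))
        (fun k => hx k) fun h => by rw [hdot]; exact hxv h
      exact ⟨i, (hclosed i x).2 hi⟩

section Level

variable {E : Type*} [NormedAddCommGroup E] [NormedSpace ℝ E]

/-- The level set of a convex function, seen from a point where the function is smaller,
is parametrised continuously by directions. -/
theorem exists_radial_level {γ : E → ℝ} (hconv : ConvexOn ℝ Set.univ γ) (hcont : Continuous γ)
    {lam : ℝ} (hb : Bornology.IsBounded {x | γ x < lam}) {c : E} (hc : γ c < lam) :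
    ∃ ρ : E → ℝ, ContinuousOn ρ {0}ᶜ ∧ (∀ v, v ≠ 0 → γ (c + ρ v • v) = lam) ∧
      ∀ v, γ (c + v) = lam → ρ v = 1 := by
  set T : Set E := {v | γ (c + v) < lam} with hT
  have hcont' : Continuous fun v => γ (c + v) := by fun_prop
  have hTo : IsOpen T := isOpen_lt hcont' continuous_const
  have hT0 : T ∈ nhds (0 : E) := hTo.mem_nhds (by simpa [hT] using hc)
  have hTc : Convex ℝ T := by
    intro x hx y hy s t hs ht hst
    have h1 := hconv.2 (Set.mem_univ (c + x)) (Set.mem_univ (c + y)) hs ht hst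
    have h2 : s • (c + x) + t • (c + y) = c + (s • x + t • y) := by
      rw [smul_add, smul_add, add_add_add_comm, ← add_smul, hst, one_smul]
    rw [h2] at h1
    refine lt_of_le_of_lt h1 ?_
    simp only [smul_eq_mul]
    have hx' : γ (c + x) < lam := hx
    have hy' : γ (c + y) < lam := hy
    rcases hs.eq_or_lt with rfl | hs
    · rw [zero_add] at hst; subst hst; simpa using hy'
    · have : s * γ (c + x) < s * lam := mul_lt_mul_of_pos_left hx' hs
      have : t * γ (c + y) ≤ t * lam := mul_le_mul_of_nonneg_left hy'.le ht
      have : s * lam + t * lam = lam := by rw [← add_mul, hst, one_mul]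
      linarith
  have hTb : Bornology.IsBounded T := by
    obtain ⟨M, hM⟩ := hb.exists_norm_le
    refine isBounded_iff_forall_norm_le.2 ⟨M + ‖c‖, fun v hv => ?_⟩
    have := hM _ hv
    calc ‖v‖ = ‖(c + v) - c‖ := by rw [add_sub_cancel_left]
      _ ≤ ‖c + v‖ + ‖c‖ := norm_sub_le _ _
      _ ≤ M + ‖c‖ := by linarith
  have hTv : Bornology.IsVonNBounded ℝ T := (NormedSpace.isVonNBounded_iff ℝ).2 hTb
  have habs : Absorbent ℝ T := absorbent_nhds_zero hT0
  have hpos : ∀ v, v ≠ 0 → 0 < gauge T v := fun v hv => (gauge_pos habs hTv).2 hv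
  refine ⟨fun v => (gauge T v)⁻¹, ?_, fun v hv => ?_, fun v hv => ?_⟩
  · exact (continuous_gauge hTc hT0).continuousOn.inv₀ fun v hv => (hpos v hv).ne'
  · have h1 : gauge T ((gauge T v)⁻¹ • v) = 1 := by
      rw [gauge_smul_of_nonneg (inv_nonneg.2 (hpos v hv).le), smul_eq_mul,
        inv_mul_cancel₀ (hpos v hv).ne']
    have h2 := (gauge_eq_one_iff_mem_frontier hTc hT0).1 h1
    exact frontier_lt_subset_eq hcont' continuous_const h2
  · have h1 : v ∈ frontier T := by
      rw [hTo.frontier_eq]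
      refine ⟨?_, fun h => (show γ (c + v) < lam from h).ne hv⟩
      have ht : Filter.Tendsto (fun s : ℝ => s • v) (nhdsWithin 1 (Set.Iio 1)) (nhds ((1 : ℝ) • v)) :=
        ((continuous_id.smul continuous_const).tendsto 1).mono_left inf_le_left
      rw [one_smul] at ht
      refine mem_closure_of_tendsto ht ?_
      have hev : ∀ᶠ s : ℝ in nhdsWithin 1 (Set.Iio 1), 0 < s ∧ s < 1 :=
        Filter.Eventually.and (nhdsWithin_le_nhds (lt_mem_nhds one_pos)) self_mem_nhdsWithin
      filter_upwards [hev] with s hs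
      have h2 := hconv.2 (Set.mem_univ c) (Set.mem_univ (c + v)) (sub_nonneg.2 hs.2.le) hs.1.le
        (by ring)
      have h3 : (1 - s) • c + s • (c + v) = c + s • v := by
        rw [smul_add, ← add_assoc, ← add_smul]; simp
      rw [h3, hv] at h2
      refine lt_of_le_of_lt h2 ?_
      simp only [smul_eq_mul]
      nlinarith [hs.2]
    change (gauge T v)⁻¹ = 1
    rw [(gauge_eq_one_iff_mem_frontier hTc hT0).2 h1, inv_one]

theorem exists_preconnected_level {γ : E → ℝ} (hconv : ConvexOn ℝ Set.univ γ)
    (hcont : Continuous γ) {lam : ℝ} (hb : Bornology.IsBounded {x | γ x < lam}) {c u : E}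
    (hc : γ c < lam) (hu : u ≠ 0) (V : Submodule ℝ E) (huV : u ∈ V) :
    ∃ p : Bool → E, ∀ v ∈ V, γ (c + v) = lam → ∃ (ε : Bool) (S : Set E), IsPreconnected S ∧
      c + v ∈ S ∧ p ε ∈ S ∧ ∀ x ∈ S, x - c ∈ V ∧ γ x = lam := by
  obtain ⟨ρ, hρc, hρ, hρ1⟩ := exists_radial_level hconv hcont hb hc
  have key : ∀ v ∈ V, ∀ u' ∈ V, γ (c + v) = lam → (0 : E) ∉ segment ℝ v u' →
      ∃ S : Set E, IsPreconnected S ∧ c + v ∈ S ∧ c + ρ u' • u' ∈ S ∧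
        ∀ x ∈ S, x - c ∈ V ∧ γ x = lam := by
    intro v hv u' hu' hvl h0
    refine ⟨(fun w => c + ρ w • w) '' segment ℝ v u', ?_, ⟨v, left_mem_segment ℝ v u', ?_⟩,
      ⟨u', right_mem_segment ℝ v u', rfl⟩, ?_⟩
    · refine (convex_segment v u').isPreconnected.image _ ?_
      refine continuousOn_const.add ((hρc.mono fun w hw hw0 => h0 ?_).smul continuousOn_id)
      rwa [Set.mem_singleton_iff.1 hw0] at hw
    · simp [hρ1 v hvl]
    · rintro _ ⟨w, hw, rfl⟩
      have hwV : w ∈ V := V.convex.segment_subset hv hu' hw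
      refine ⟨by simpa using V.smul_mem _ hwV, hρ w fun hw0 => h0 (hw0 ▸ hw)⟩
  refine ⟨fun ε => if ε then c + ρ u • u else c + ρ (-u) • (-u), fun v hv hvl => ?_⟩
  have hv0 : v ≠ 0 := fun h => by rw [h, add_zero] at hvl; exact hc.ne hvl
  by_cases h1 : (0 : E) ∈ segment ℝ v u
  · have h2 : (0 : E) ∉ segment ℝ v (-u) := by
      rintro ⟨s', t', hs', ht', hst', h'⟩
      obtain ⟨s, t, hs, ht, hst, h⟩ := h1
      have e1 : s • v = -(t • u) := eq_neg_of_add_eq_zero_left h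
      have e2 : s' • v = t' • u := by
        have := eq_neg_of_add_eq_zero_left h'
        rwa [smul_neg, neg_neg] at this
      have e3 : (t' * s + t * s') • v = 0 := by
        rw [add_smul, mul_smul, mul_smul, e1, e2, smul_neg, ← mul_smul, ← mul_smul, mul_comm t t']
        simp
      have e4 := (smul_eq_zero.1 e3).resolve_right hv0
      have e5 : t' * s = 0 := by nlinarith [mul_nonneg ht' hs, mul_nonneg ht hs']
      have e6 : t * s' = 0 := by nlinarith [mul_nonneg ht' hs, mul_nonneg ht hs']
      have hsne : s ≠ 0 := fun h0 => by
        rw [h0, zero_smul, zero_eq_neg] at e1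
        rw [h0, zero_add] at hst
        rw [hst, one_smul] at e1
        exact hu e1
      have hs'ne : s' ≠ 0 := fun h0 => by
        rw [h0, zero_smul] at e2
        rw [h0, zero_add] at hst'
        rw [hst', one_smul] at e2
        exact hu e2.symm
      have e7 : t = 0 := (mul_eq_zero.1 e6).resolve_right hs'ne
      rw [e7, zero_smul, neg_zero] at e1
      exact hv0 ((smul_eq_zero.1 e1).resolve_left hsne)
    obtain ⟨S, h3, h4, h5, h6⟩ := key v hv (-u) (V.neg_mem huV) hvl h2
    exact ⟨false, S, h3, h4, by simpa using h5, h6⟩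
  · obtain ⟨S, h3, h4, h5, h6⟩ := key v hv u huV hvl h1
    exact ⟨true, S, h3, h4, by simpa using h5, h6⟩

end Level

section Faces

variable {E : Type*} [NormedAddCommGroup E] [InnerProductSpace ℝ E] {ι : Type*}

/-- The points on the hyperplanes of `F` and off all others, above those in `t`. -/
def face (a : ι → E) (b : ι → ℝ) (F t : Finset ι) : Set E :=
  {x | (∀ h ∈ F, ⟪x, a h⟫ = b h) ∧
    ∀ h ∉ F, (h ∈ t → b h < ⟪x, a h⟫) ∧ (h ∉ t → ⟪x, a h⟫ < b h)}

/-- The value `lam` lies strictly between two values of `γ` on `S`. -/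
def SplitBy (γ : E → ℝ) (lam : ℝ) (S : Set E) : Prop :=
  (∃ x ∈ S, γ x < lam) ∧ ∃ y ∈ S, lam < γ y

theorem convex_face (a : ι → E) (b : ι → ℝ) (F t : Finset ι) : Convex ℝ (face a b F t) := by
  intro x hx y hy s r hs hr hsr
  have hin : ∀ h, ⟪s • x + r • y, a h⟫ = s * ⟪x, a h⟫ + r * ⟪y, a h⟫ := fun h => by
    rw [inner_add_left, real_inner_smul_left, real_inner_smul_left]
  have hbb : ∀ h, b h = s * b h + r * b h := fun h => by rw [← add_mul, hsr, one_mul]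
  refine ⟨fun h hh => ?_, fun h hh => ⟨fun ht => ?_, fun ht => ?_⟩⟩
  · rw [hin, hx.1 h hh, hy.1 h hh, ← hbb]
  · have h1 := (hx.2 h hh).1 ht
    have h2 := (hy.2 h hh).1 ht
    rw [hin]
    rcases hs.eq_or_lt with rfl | hs
    · rw [zero_add] at hsr; subst hsr; simpa using h2
    · have := mul_lt_mul_of_pos_left h1 hs
      have := mul_le_mul_of_nonneg_left h2.le hr
      linarith [hbb h]
  · have h1 := (hx.2 h hh).2 ht
    have h2 := (hy.2 h hh).2 ht
    rw [hin]
    rcases hs.eq_or_lt with rfl | hs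
    · rw [zero_add] at hsr; subst hsr; simpa using h2
    · have := mul_lt_mul_of_pos_left h1 hs
      have := mul_le_mul_of_nonneg_left h2.le hr
      linarith [hbb h]

theorem exists_level_of_splitBy {γ : E → ℝ} (hcont : Continuous γ) {lam : ℝ} {S : Set E}
    (hS : Convex ℝ S) (h : SplitBy γ lam S) : ∃ q ∈ S, γ q = lam := by
  obtain ⟨⟨x, hx, hx'⟩, y, hy, hy'⟩ := h
  obtain ⟨q, hq, hq'⟩ := hS.isPreconnected.intermediate_value hx hy hcont.continuousOn
    ⟨hx'.le, hy'.le⟩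
  exact ⟨q, hq, hq'⟩

theorem card_lt_of_splitBy [FiniteDimensional ℝ E] {γ : E → ℝ} {lam : ℝ} (a : ι → E) (b : ι → ℝ)
    (hgen : ∀ S : Finset ι, S.card ≤ Module.finrank ℝ E → LinearIndepOn ℝ a (S : Set ι))
    {F t : Finset ι} (h : SplitBy γ lam (face a b F t)) : F.card < Module.finrank ℝ E := by
  by_contra hlt
  obtain ⟨S, hSF, hS⟩ := Finset.exists_subset_card_eq (not_lt.1 hlt)
  obtain ⟨⟨x, hx, hxl⟩, y, hy, hyl⟩ := h
  have htop : Submodule.span ℝ (a '' S) = ⊤ := by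
    have h2 := LinearIndependent.span_eq_top_of_card_eq_finrank' (b := fun j : S => a j)
      (hgen S hS.le) (by simp [hS])
    rw [← h2]
    congr 1
    ext y; simp
  have h3 : Submodule.span ℝ (a '' S) ≤ LinearMap.ker (innerₛₗ ℝ (x - y)) := by
    rw [Submodule.span_le]
    rintro _ ⟨j, hj, rfl⟩
    have : ⟪x - y, a j⟫ = 0 := by
      rw [inner_sub_left, hx.1 j (hSF hj), hy.1 j (hSF hj), sub_self]
    exact this
  have h4 : ⟪x - y, x - y⟫ = 0 := h3 (htop ▸ Submodule.mem_top : x - y ∈ _)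
  have h5 : x = y := sub_eq_zero.1 (inner_self_eq_zero.1 h4)
  rw [h5] at hxl
  exact lt_asymm hxl hyl

variable [Fintype ι]

theorem isOpen_strict_side (a : ι → E) (b : ι → ℝ) (F t : Finset ι) :
    IsOpen {x : E | ∀ h ∉ F, (h ∈ t → b h < ⟪x, a h⟫) ∧ (h ∉ t → ⟪x, a h⟫ < b h)} := by
  have : {x : E | ∀ h ∉ F, (h ∈ t → b h < ⟪x, a h⟫) ∧ (h ∉ t → ⟪x, a h⟫ < b h)} =
      ⋂ h : ι, ⋂ _ : h ∉ F, ({x | h ∈ t → b h < ⟪x, a h⟫} ∩ {x | h ∉ t → ⟪x, a h⟫ < b h}) := by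
    ext x; simp
  rw [this]
  refine isOpen_iInter_of_finite fun h => isOpen_iInter_of_finite fun _ => IsOpen.inter ?_ ?_
  · by_cases hh : h ∈ t
    · simp only [hh, forall_const]
      exact isOpen_lt continuous_const (by fun_prop)
    · simp [hh]
  · by_cases hh : h ∈ t
    · simp [hh]
    · simp only [hh, not_false_eq_true, forall_const]
      exact isOpen_lt (by fun_prop) continuous_const

theorem isOpen_face_empty (a : ι → E) (b : ι → ℝ) (t : Finset ι) : IsOpen (face a b ∅ t) := by
  have : face a b ∅ t = {x : E | ∀ h ∉ (∅ : Finset ι), (h ∈ t → b h < ⟪x, a h⟫) ∧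
      (h ∉ t → ⟪x, a h⟫ < b h)} := by
    ext x; simp [face]
  rw [this]
  exact isOpen_strict_side a b ∅ t

theorem exists_regular_level (γ : E → ℝ) (a : ι → E) (b : ι → ℝ) {l₀ l₁ : ℝ} (hl : l₀ < l₁) :
    ∃ lam, l₀ < lam ∧ lam < l₁ ∧ ∀ F t, (∃ q ∈ face a b F t, γ q = lam) →
      SplitBy γ lam (face a b F t) := by
  set Λ : Set ℝ := (Set.range fun q : Finset ι × Finset ι => sInf (γ '' face a b q.1 q.2)) ∪
    Set.range fun q : Finset ι × Finset ι => sSup (γ '' face a b q.1 q.2)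
  have hfin : Λ.Finite := (Set.finite_range _).union (Set.finite_range _)
  obtain ⟨lam, hlam, hΛ⟩ := ((Set.Ioo_infinite hl).sdiff hfin).nonempty
  refine ⟨lam, hlam.1, hlam.2, fun F t ⟨q, hq, hql⟩ => ⟨?_, ?_⟩⟩
  · by_contra hno
    push Not at hno
    have : IsLeast (γ '' face a b F t) lam := ⟨⟨q, hq, hql⟩, by rintro _ ⟨x, hx, rfl⟩; exact hno x hx⟩
    exact hΛ (Or.inl ⟨(F, t), this.csInf_eq⟩)
  · by_contra hno
    push Not at hno
    have : IsGreatest (γ '' face a b F t) lam :=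
      ⟨⟨q, hq, hql⟩, by rintro _ ⟨x, hx, rfl⟩; exact hno x hx⟩
    exact hΛ (Or.inr ⟨(F, t), this.csSup_eq⟩)

theorem exists_two_points {γ : E → ℝ} (hconv : ConvexOn ℝ Set.univ γ) (hcont : Continuous γ)
    {lam : ℝ} (hb : Bornology.IsBounded {x | γ x < lam}) (a : ι → E) (b : ι → ℝ)
    (hreg : ∀ F t, (∃ q ∈ face a b F t, γ q = lam) → SplitBy γ lam (face a b F t))
    (F : Finset ι) : ∃ p : Bool → E, ∀ t, SplitBy γ lam (face a b F t) →
      (∀ G, SplitBy γ lam (face a b G t) → G.card ≤ F.card) → ∃ ε, p ε ∈ face a b F t := by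
  by_cases hex : ∃ t, SplitBy γ lam (face a b F t)
  swap
  · exact ⟨fun _ => 0, fun t ht => absurd ⟨t, ht⟩ hex⟩
  obtain ⟨t₀, ⟨c, hc, hcl⟩, y₀, hy₀, hyl⟩ := hex
  set V : Submodule ℝ E := ⨅ h ∈ F, LinearMap.ker (innerₛₗ ℝ (a h)) with hV
  have hVmem : ∀ x, x ∈ V ↔ ∀ h ∈ F, ⟪x, a h⟫ = 0 := fun x => by
    simp [hV, Submodule.mem_iInf, real_inner_comm]
  have hu : y₀ - c ≠ 0 := fun h0 => by
    rw [sub_eq_zero.1 h0] at hyl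
    exact lt_asymm hyl hcl
  have hVsub : ∀ x, (∀ h ∈ F, ⟪x, a h⟫ = b h) → x - c ∈ V := fun x hx =>
    (hVmem _).2 fun h hh => by rw [inner_sub_left, hx h hh, hc.1 h hh, sub_self]
  have hVadd : ∀ x, x - c ∈ V → ∀ h ∈ F, ⟪x, a h⟫ = b h := fun x hx h hh => by
    have := (hVmem _).1 hx h hh
    rw [inner_sub_left, hc.1 h hh] at this
    linarith
  obtain ⟨p, hp⟩ := exists_preconnected_level hconv hcont hb hcl hu V (hVsub _ hy₀.1)
  refine ⟨p, fun t ht hmax => ?_⟩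
  obtain ⟨q, hq, hql⟩ := exists_level_of_splitBy hcont (convex_face a b F t) ht
  obtain ⟨ε, S, hS, hqS, hpS, hSV⟩ := hp (q - c) (hVsub q hq.1) (by rwa [add_sub_cancel])
  rw [add_sub_cancel] at hqS
  refine ⟨ε, hVadd _ (hSV _ hpS).1, ?_⟩
  set O : Set E := {x | ∀ h ∉ F, (h ∈ t → b h < ⟪x, a h⟫) ∧ (h ∉ t → ⟪x, a h⟫ < b h)} with hO
  set N : Set E := {x | ∃ h ∉ F, (h ∈ t ∧ ⟪x, a h⟫ < b h) ∨ (h ∉ t ∧ b h < ⟪x, a h⟫)} with hN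
  have hOo : IsOpen O := isOpen_strict_side a b F t
  have hNo : IsOpen N := by
    have : N = ⋃ h : ι, ⋃ _ : h ∉ F, ({x | h ∈ t ∧ ⟪x, a h⟫ < b h} ∪ {x | h ∉ t ∧ b h < ⟪x, a h⟫}) := by
      ext x; simp [hN]
    rw [this]
    refine isOpen_iUnion fun h => isOpen_iUnion fun _ => IsOpen.union ?_ ?_
    · by_cases hh : h ∈ t
      · simp only [hh, true_and]
        exact isOpen_lt (by fun_prop) continuous_const
      · simp [hh]
    · by_cases hh : h ∈ t
      · simp [hh]
      · simp only [hh, not_false_eq_true, true_and]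
        exact isOpen_lt continuous_const (by fun_prop)
  have hdisj : Disjoint O N := by
    rw [Set.disjoint_left]
    rintro x hx ⟨h, hh, ⟨h1, h2⟩ | ⟨h1, h2⟩⟩
    · exact lt_asymm h2 ((hx h hh).1 h1)
    · exact lt_asymm h2 ((hx h hh).2 h1)
  have hcov : S ⊆ O ∪ N := by
    intro s hs
    by_contra hno
    rw [Set.mem_union, not_or] at hno
    have hw : ∀ h ∉ F, (h ∈ t → b h ≤ ⟪s, a h⟫) ∧ (h ∉ t → ⟪s, a h⟫ ≤ b h) := by
      intro h hh
      refine ⟨fun h1 => ?_, fun h1 => ?_⟩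
      · by_contra h2
        exact hno.2 ⟨h, hh, Or.inl ⟨h1, not_le.1 h2⟩⟩
      · by_contra h2
        exact hno.2 ⟨h, hh, Or.inr ⟨h1, not_le.1 h2⟩⟩
    have hsF := hVadd s (hSV s hs).1
    set G : Finset ι := Finset.univ.filter fun h => ⟪s, a h⟫ = b h with hG
    have hmemG : ∀ h, h ∈ G ↔ ⟪s, a h⟫ = b h := fun h => by simp [hG]
    have hFG : F ⊆ G := fun h hh => (hmemG h).2 (hsF h hh)
    have hsG : s ∈ face a b G t := by
      refine ⟨fun h hh => (hmemG h).1 hh, fun h hh => ?_⟩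
      have h1 : h ∉ F := fun h' => hh (hFG h')
      have h2 : ⟪s, a h⟫ ≠ b h := fun h' => hh ((hmemG h).2 h')
      exact ⟨fun h3 => lt_of_le_of_ne ((hw h h1).1 h3) h2.symm,
        fun h3 => lt_of_le_of_ne ((hw h h1).2 h3) h2⟩
    have hle := hmax G (hreg G t ⟨s, hsG, (hSV s hs).2⟩)
    rw [← Finset.eq_of_subset_of_card_le hFG hle] at hsG
    exact hno.1 hsG.2
  exact hS.subset_left_of_subset_union hOo hNo hdisj hcov ⟨q, hqS, hq.2⟩ hpS

/-- In a simple arrangement, few cells are split by a level of a convex function. -/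
theorem card_split_cells_le [FiniteDimensional ℝ E] {D : ℕ} (hD : Module.finrank ℝ E = D + 1)
    {γ : E → ℝ} (hconv : ConvexOn ℝ Set.univ γ)
    (hcont : Continuous γ) {l₀ l₁ : ℝ} (hl : l₀ < l₁)
    (hb : ∀ lam, lam < l₁ → Bornology.IsBounded {x | γ x < lam}) (a : ι → E) (b : ι → ℝ)
    (hgen : ∀ S : Finset ι, S.card ≤ Module.finrank ℝ E → LinearIndepOn ℝ a (S : Set ι))
    (𝓣 : Finset (Finset ι)) (h𝓣 : ∀ t ∈ 𝓣, (∃ x ∈ face a b ∅ t, γ x ≤ l₀) ∧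
      ∃ y ∈ face a b ∅ t, l₁ ≤ γ y) :
    𝓣.card ≤ (D + 1) * (Fintype.card ι + 1) ^ D * 2 ^ (D + 1) := by
  obtain ⟨lam, hl0, hl1, hreg⟩ := exists_regular_level γ a b hl
  choose p hp using exists_two_points hconv hcont (hb lam hl1) a b hreg
  set 𝓕 : Finset (Finset ι) := Finset.univ.filter fun F => F.card ≤ D with h𝓕
  have hF : 𝓕.card ≤ (D + 1) * (Fintype.card ι + 1) ^ D := by
    refine card_family_le Finset.univ 𝓕 D (fun t _ => Finset.subset_univ t) fun s hs => ?_
    obtain ⟨u, hu, hsu⟩ := hs (subset_refl s)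
    exact (Finset.card_le_card (Finset.inter_eq_left.1 hsu)).trans (Finset.mem_filter.1 hu).2
  set code : Finset ι → Bool × Finset ι → Finset ι := fun F e =>
    e.2 ∪ (Finset.univ.filter fun h => h ∉ F ∧ b h < ⟪p F e.1, a h⟫) with hcode
  have hsub : 𝓣 ⊆ 𝓕.biUnion fun F => (Finset.univ ×ˢ F.powerset).image (code F) := by
    intro t ht
    obtain ⟨⟨x, hx, hxl⟩, y, hy, hyl⟩ := h𝓣 t ht
    set M : Finset (Finset ι) := Finset.univ.filter fun F => SplitBy γ lam (face a b F t) with hM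
    have hmemM : ∀ G, G ∈ M ↔ SplitBy γ lam (face a b G t) := fun G => by simp [hM]
    have hMne : M.Nonempty :=
      ⟨∅, (hmemM ∅).2 ⟨⟨x, hx, hxl.trans_lt hl0⟩, y, hy, hl1.trans_le hyl⟩⟩
    obtain ⟨F, hFM, hFmax⟩ := M.exists_max_image Finset.card hMne
    have hFs := (hmemM F).1 hFM
    obtain ⟨ε, hε⟩ := hp F t hFs fun G hG => hFmax G ((hmemM G).2 hG)
    have hcard := card_lt_of_splitBy a b hgen hFs
    rw [Finset.mem_biUnion]
    refine ⟨F, ?_, ?_⟩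
    · rw [h𝓕, Finset.mem_filter]; exact ⟨Finset.mem_univ _, by omega⟩
    · rw [Finset.mem_image]
      refine ⟨(ε, t ∩ F), by simp, ?_⟩
      ext h
      simp only [hcode, Finset.mem_union, Finset.mem_inter, Finset.mem_filter, Finset.mem_univ,
        true_and]
      by_cases hhF : h ∈ F
      · simp [hhF]
      · have := hε.2 h hhF
        simp only [hhF, and_false, not_false_eq_true, true_and, false_or]
        by_cases hht : h ∈ t
        · simp [hht, this.1 hht]
        · simp [hht, (this.2 hht).le]
  refine (Finset.card_le_card hsub).trans (Finset.card_biUnion_le.trans ?_)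
  calc ∑ F ∈ 𝓕, ((Finset.univ ×ˢ F.powerset).image (code F)).card
      ≤ ∑ F ∈ 𝓕, 2 ^ (D + 1) := Finset.sum_le_sum fun F hFF => by
        refine Finset.card_image_le.trans ?_
        rw [Finset.card_product, Finset.card_powerset, pow_succ, mul_comm]
        have : F.card ≤ D := (Finset.mem_filter.1 hFF).2
        have := Nat.pow_le_pow_right (n := 2) (by norm_num) this
        simpa using this
    _ = 𝓕.card * 2 ^ (D + 1) := by simp
    _ ≤ _ := Nat.mul_le_mul_right _ hF

end Faces

theorem interior_closure_eq_of_convex {E : Type*} [NormedAddCommGroup E] [NormedSpace ℝ E]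
    [FiniteDimensional ℝ E] {K : Set E} (hK : Convex ℝ K) : interior (closure K) = interior K := by
  rcases (interior (closure K)).eq_empty_or_nonempty with h | h
  · refine h.trans (Set.subset_empty_iff.1 ?_).symm
    rw [← h]
    exact interior_mono subset_closure
  · refine hK.interior_closure_eq_interior_of_nonempty_interior ?_
    rw [hK.interior_nonempty_iff_affineSpan_eq_top]
    rw [hK.closure.interior_nonempty_iff_affineSpan_eq_top] at h
    rw [← top_le_iff, ← h, affineSpan_le]
    exact closure_minimal (subset_affineSpan ℝ K) (AffineSubspace.closed_of_finiteDimensional _)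

theorem convexOn_infDist {E : Type*} [NormedAddCommGroup E] [NormedSpace ℝ E] {K : Set E}
    (hK : Convex ℝ K) (hne : K.Nonempty) :
    ConvexOn ℝ Set.univ fun x => Metric.infDist x K := by
  refine ⟨convex_univ, fun x _ y _ s t hs ht hst => ?_⟩
  refine le_of_forall_pos_le_add fun ε hε => ?_
  obtain ⟨p, hp, hxp⟩ := (Metric.infDist_lt_iff hne).1 (lt_add_of_pos_right (Metric.infDist x K) hε)
  obtain ⟨q, hq, hyq⟩ := (Metric.infDist_lt_iff hne).1 (lt_add_of_pos_right (Metric.infDist y K) hε)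
  refine (Metric.infDist_le_dist_of_mem (hK hp hq hs ht hst)).trans ?_
  have h1 : dist (s • x + t • y) (s • p + t • q) ≤ s * dist x p + t * dist y q := by
    refine (dist_add_add_le _ _ _ _).trans ?_
    rw [dist_smul₀, dist_smul₀, Real.norm_of_nonneg hs, Real.norm_of_nonneg ht]
  have h2 := mul_le_mul_of_nonneg_left hxp.le hs
  have h3 := mul_le_mul_of_nonneg_left hyq.le ht
  have h4 : s * ε + t * ε = ε := by rw [← add_mul, hst, one_mul]
  simp only [smul_eq_mul]
  linarith

theorem exists_pos_forall_le {α : Type*} (A : Finset α) (f : α → ℝ) (hf : ∀ t ∈ A, 0 < f t) :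
    ∃ l, 0 < l ∧ ∀ t ∈ A, l ≤ f t := by
  rcases A.eq_empty_or_nonempty with rfl | hne
  · exact ⟨1, one_pos, by simp⟩
  · obtain ⟨t, ht, hmin⟩ := A.exists_min_image f hne
    exact ⟨f t, hf t ht, hmin⟩

section ZoneCount

variable {E : Type*} [NormedAddCommGroup E] [InnerProductSpace ℝ E] [FiniteDimensional ℝ E]
  {ι : Type*} [Fintype ι]

theorem card_split_cells_le' {D : ℕ} (hD : Module.finrank ℝ E = D + 1)
    {γ : E → ℝ} (hconv : ConvexOn ℝ Set.univ γ)
    (hcont : Continuous γ) {l₀ l₁ : ℝ} (hl : l₀ < l₁)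
    (hb : ∀ lam, lam < l₁ → Bornology.IsBounded {x | γ x < lam}) (a : ι → E) (b : ι → ℝ)
    (𝓣 : Finset (Finset ι)) (h𝓣 : ∀ t ∈ 𝓣, (∃ x ∈ face a b ∅ t, γ x ≤ l₀) ∧
      ∃ y ∈ face a b ∅ t, l₁ ≤ γ y) :
    𝓣.card ≤ (D + 1) * (Fintype.card ι + 1) ^ D * 2 ^ (D + 1) := by
  choose! h1 h2 using h𝓣
  choose! x hx hxl using h1
  choose! y hy hyl using h2
  have hne : ∀ z t, z ∈ face a b ∅ t → ∀ h, 0 < |⟪z, a h⟫ - b h| / (‖z‖ + 1) := by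
    intro z t hz h
    refine div_pos (abs_pos.2 (sub_ne_zero.2 ?_)) (by positivity)
    by_cases hht : h ∈ t
    · exact ((hz.2 h (by simp)).1 hht).ne'
    · exact ((hz.2 h (by simp)).2 hht).ne
  obtain ⟨ε, hε, hεf⟩ := exists_pos_forall_le (𝓣 ×ˢ (Finset.univ : Finset ι))
    (fun q => min (|⟪x q.1, a q.2⟫ - b q.2| / (‖x q.1‖ + 1))
      (|⟪y q.1, a q.2⟫ - b q.2| / (‖y q.1‖ + 1))) (fun q hq => by
        have hq1 := (Finset.mem_product.1 hq).1
        exact lt_min (hne _ _ (hx _ hq1) _) (hne _ _ (hy _ hq1) _))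
  obtain ⟨u, -, hu, hgen⟩ := exists_generic (W := E) (∅ : Finset ι) a (by simp) hε
  have hmove : ∀ z t, z ∈ face a b ∅ t → (∀ h, ε ≤ |⟪z, a h⟫ - b h| / (‖z‖ + 1)) →
      z ∈ face u b ∅ t := by
    intro z t hz hzε
    refine ⟨by simp, fun h hh => ?_⟩
    have h3 := hzε h
    rw [le_div_iff₀ (by positivity)] at h3
    have h4 : |⟪z, u h⟫ - ⟪z, a h⟫| < |⟪z, a h⟫ - b h| := by
      rw [← inner_sub_right]
      refine (abs_real_inner_le_norm _ _).trans_lt (lt_of_lt_of_le ?_ h3)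
      have := mul_le_mul_of_nonneg_left (hu h).le (norm_nonneg z)
      linarith
    refine ⟨fun ht => ?_, fun ht => ?_⟩
    · have h5 := (hz.2 h hh).1 ht
      rw [abs_of_pos (sub_pos.2 h5)] at h4
      linarith [(abs_lt.1 h4).1]
    · have h5 := (hz.2 h hh).2 ht
      rw [abs_of_neg (sub_neg.2 h5)] at h4
      linarith [(abs_lt.1 h4).2]
  refine card_split_cells_le hD hconv hcont hl hb u b hgen 𝓣 fun t ht => ⟨⟨x t, ?_, hxl t ht⟩,
    y t, ?_, hyl t ht⟩
  · exact hmove _ t (hx t ht) fun h =>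
      (hεf (t, h) (Finset.mem_product.2 ⟨ht, Finset.mem_univ h⟩)).trans (min_le_left _ _)
  · exact hmove _ t (hy t ht) fun h =>
      (hεf (t, h) (Finset.mem_product.2 ⟨ht, Finset.mem_univ h⟩)).trans (min_le_right _ _)

/-- The zone of the boundary of a compact convex set has few cells. -/
theorem card_zone_compact_le {D : ℕ} (hD : Module.finrank ℝ E = D + 1) {K : Set E}
    (hK : Convex ℝ K) (hKc : IsCompact K) (a : ι → E) (b : ι → ℝ) (𝓣 : Finset (Finset ι))
    (h𝓣 : ∀ t ∈ 𝓣, ∃ z ∈ closure (face a b ∅ t), z ∈ K ∧ z ∉ interior K) :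
    𝓣.card ≤ 2 * ((D + 1) * (Fintype.card ι + 1) ^ D * 2 ^ (D + 1)) := by
  choose! z hz hzK hzi using h𝓣
  have hsplit := Finset.card_filter_add_card_filter_not (s := 𝓣) (fun t => face a b ∅ t ⊆ K)
  have hin : (𝓣.filter fun t => face a b ∅ t ⊆ K).card ≤
      (D + 1) * (Fintype.card ι + 1) ^ D * 2 ^ (D + 1) := by
    rcases (𝓣.filter fun t => face a b ∅ t ⊆ K).eq_empty_or_nonempty with he | ⟨t₀, ht₀⟩
    · rw [he]; simp
    have hne : ∀ t ∈ 𝓣, (face a b ∅ t).Nonempty := fun t ht => closure_nonempty_iff.1 ⟨_, hz t ht⟩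
    have hKint : ∀ t, face a b ∅ t ⊆ K → face a b ∅ t ⊆ interior K := fun t ht =>
      interior_maximal ht (isOpen_face_empty a b t)
    rw [Finset.mem_filter] at ht₀
    obtain ⟨o, ho⟩ := hne t₀ ht₀.1
    have hoK := hKint t₀ ht₀.2 ho
    set s : Set E := (fun v => o + v) ⁻¹' K with hs
    have hsc : Convex ℝ s := hK.translate_preimage_right o
    have hs0 : s ∈ nhds (0 : E) := by
      refine (continuous_const.add continuous_id).continuousAt.preimage_mem_nhds ?_
      simpa using mem_interior_iff_mem_nhds.1 hoK
    have hsint : ∀ v, v ∈ interior s ↔ o + v ∈ interior K := fun v => by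
      have := (Homeomorph.addLeft o).preimage_interior K
      rw [hs]
      change v ∈ interior ((Homeomorph.addLeft o) ⁻¹' K) ↔ _
      rw [← this]
      rfl
    set γ : E → ℝ := fun x => gauge s (x - o) with hγ
    have hγ1 : ∀ x, γ x < 1 ↔ x ∈ interior K := fun x => by
      rw [hγ]
      simp only
      rw [gauge_lt_one_iff_mem_interior hsc hs0, hsint, add_sub_cancel]
    have hcont : Continuous γ := (continuous_gauge hsc hs0).comp (continuous_id.sub continuous_const)
    have hconv : ConvexOn ℝ Set.univ γ := by
      refine ⟨convex_univ, fun x _ y _ p q hp hq hpq => ?_⟩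
      have h1 : p • x + q • y - o = p • (x - o) + q • (y - o) := by
        rw [smul_sub, smul_sub]
        conv_lhs => rw [← one_smul ℝ o, ← hpq, add_smul]
        abel
      simp only [hγ]
      rw [h1]
      refine (gauge_add_le hsc (absorbent_nhds_zero hs0) _ _).trans ?_
      rw [gauge_smul_of_nonneg hp, gauge_smul_of_nonneg hq]
    choose! x hx using hne
    obtain ⟨δ, hδ, hδl⟩ := exists_pos_forall_le (𝓣.filter fun t => face a b ∅ t ⊆ K)
      (fun t => 1 - γ (x t)) (fun t ht => by
        rw [Finset.mem_filter] at ht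
        exact sub_pos.2 ((hγ1 _).2 (hKint t ht.2 (hx t ht.1))))
    refine card_split_cells_le' hD hconv hcont (l₀ := 1 - δ) (l₁ := 1 - δ / 2) (by linarith)
      (fun lam hlam => ?_) a b _ fun t ht => ?_
    · refine hKc.isBounded.subset fun y hy => interior_subset ((hγ1 y).1 ?_)
      have : γ y < lam := hy
      linarith
    · have ht' := Finset.mem_filter.1 ht
      refine ⟨⟨x t, hx t ht'.1, by linarith [hδl t ht]⟩, ?_⟩
      have h1 : 1 - δ / 2 < γ (z t) := by
        have := mt (hγ1 (z t)).1 (hzi t ht'.1)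
        linarith
      obtain ⟨y, hy, hyf⟩ := mem_closure_iff.1 (hz t ht'.1) _ (isOpen_lt continuous_const hcont) h1
      exact ⟨y, hyf, le_of_lt hy⟩
  have hout : (𝓣.filter fun t => ¬ face a b ∅ t ⊆ K).card ≤
      (D + 1) * (Fintype.card ι + 1) ^ D * 2 ^ (D + 1) := by
    rcases (𝓣.filter fun t => ¬ face a b ∅ t ⊆ K).eq_empty_or_nonempty with he | ⟨t₀, ht₀⟩
    · rw [he]; simp
    rw [Finset.mem_filter] at ht₀
    have hKne : K.Nonempty := ⟨_, hzK t₀ ht₀.1⟩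
    have hy : ∀ t ∈ 𝓣.filter fun t => ¬ face a b ∅ t ⊆ K, ∃ y ∈ face a b ∅ t,
        0 < Metric.infDist y K := by
      intro t ht
      obtain ⟨y, hy, hyK⟩ := Set.not_subset.1 (Finset.mem_filter.1 ht).2
      exact ⟨y, hy, (hKc.isClosed.notMem_iff_infDist_pos hKne).1 hyK⟩
    choose! y hyf hyp using hy
    obtain ⟨l, hl, hlf⟩ := exists_pos_forall_le _ _ hyp
    refine card_split_cells_le' hD (convexOn_infDist hK hKne) (Metric.continuous_infDist_pt K)
      (l₀ := l / 2) (l₁ := l) (by linarith) (fun lam _ => ?_) a b _ fun t ht =>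
        ⟨?_, y t, hyf t ht, hlf t ht⟩
    · refine (hKc.isBounded.thickening (δ := lam)).subset fun v hv => ?_
      obtain ⟨w, hw, hvw⟩ := (Metric.infDist_lt_iff hKne).1 hv
      exact Metric.mem_thickening_iff.2 ⟨w, hw, hvw⟩
    · have ht' := Finset.mem_filter.1 ht
      obtain ⟨v, hv, hvz⟩ := Metric.mem_closure_iff.1 (hz t ht'.1) (l / 2) (by linarith)
      refine ⟨v, hv, (Metric.infDist_le_dist_of_mem (hzK t ht'.1)).trans ?_⟩
      rw [dist_comm]
      exact hvz.le
  omega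

/-- The zone of the boundary of a convex set has few cells. -/
theorem card_zone_le {D : ℕ} (hD : Module.finrank ℝ E = D + 1) {K : Set E}
    (hK : Convex ℝ K) (a : ι → E) (b : ι → ℝ) (𝓣 : Finset (Finset ι))
    (h𝓣 : ∀ t ∈ 𝓣, (closure (face a b ∅ t) ∩ frontier K).Nonempty) :
    𝓣.card ≤ 2 * ((D + 1) * (Fintype.card ι + 1) ^ D * 2 ^ (D + 1)) := by
  choose! z hz using h𝓣
  obtain ⟨M, hM⟩ := (𝓣.image fun t => ‖z t‖).bddAbove
  have hMz : ∀ t ∈ 𝓣, ‖z t‖ < M + 1 := fun t ht =>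
    (hM (Finset.mem_coe.2 (Finset.mem_image_of_mem _ ht))).trans_lt (lt_add_one M)
  have hKc : Convex ℝ (K ∩ Metric.ball 0 (M + 1)) := hK.inter (convex_ball _ _)
  refine card_zone_compact_le hD hKc.closure
    ((Metric.isBounded_ball.subset Set.inter_subset_right).isCompact_closure) a b 𝓣 fun t ht =>
      ⟨z t, (hz t ht).1, ?_, fun h => ?_⟩
  · have h1 : z t ∈ Metric.ball (0 : E) (M + 1) := by simpa using hMz t ht
    exact Metric.isOpen_ball.closure_inter ⟨(hz t ht).2.1, h1⟩
  · rw [interior_closure_eq_of_convex hKc] at h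
    exact (hz t ht).2.2 (interior_mono Set.inter_subset_left h)

end ZoneCount

/-- The weighted cutting lemma inside the orthant, for points with few sign patterns. -/
theorem exists_weighted_cutting_orthant {d : ℕ} (hd : 3 ≤ d) : ∃ C : ℝ, 0 ≤ C ∧
    ∀ (ι : Type) [Fintype ι] (v : ι → Fin (d + 1) → ℝ) (X : Finset (Fin (d + 1) → ℝ)) (A : ℝ),
    (∀ h, v h ≠ 0) → (∀ x ∈ X, ∀ i, 0 < x i) → (∀ x ∈ X, ∀ h, v h ⬝ᵥ x ≠ 0) →
    (∀ R : Finset ι, ((patterns (fun h => dotL (v h)) X R).card : ℝ) ≤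
      A * ((R.card : ℝ) + 1) ^ (d - 1)) →
    ∀ w : ι → ℝ, (∀ h, 0 ≤ w h) → 0 < ∑ h, w h → ∀ r : ℝ, 1 ≤ r →
    ∃ (m : ℕ) (a : Fin m → Fin (d + 1) → Fin (d + 1) → ℝ), (∀ i k, a i k ≠ 0) ∧
      (m : ℝ) ≤ C * A * (r ^ (d - 1) * (1 + Real.log r)) ∧
      (∀ i, ∑ h with Crosses (a i) (dotL (v h)), w h ≤ (∑ h, w h) / r) ∧
      (∀ i j, i ≠ j → Disjoint (openCone (a i)) (openCone (a j))) ∧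
      (∀ i, ∀ x ∈ openCone (a i), ∀ k, 0 ≤ x k) ∧
      ∀ x ∈ X, ∀ x', x' ≠ 0 → (∀ k, 0 ≤ x' k) → (∀ h, 0 < (v h ⬝ᵥ x) * (v h ⬝ᵥ x')) →
        ∃ i, x' ∈ closedCone (a i) := by
  obtain ⟨C₁, hC₁, hcut⟩ := exists_cutting_orthant (K := d - 1) hd le_rfl
  obtain ⟨C₂, hC₂, href⟩ := exists_refinement hd
  refine ⟨C₂ * C₁, by positivity, fun ι _ v X A hv hX hXv hA w hw hW r hr => ?_⟩
  set W := ∑ h, w h with hWdef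
  have hr0 : 0 < r := by linarith
  set p : ι → ℝ := fun h => min 1 (r * w h / W) with hp
  have hp0 : ∀ h, 0 ≤ p h := fun h => le_min zero_le_one (by have := hw h; positivity)
  have hps : ∑ h, p h ≤ r := by
    calc ∑ h, p h ≤ ∑ h, r * w h / W := Finset.sum_le_sum fun h _ => min_le_right _ _
      _ = r := by rw [← Finset.sum_div, ← Finset.mul_sum, ← hWdef]; field_simp
  obtain ⟨m, a, h1, h2, h3, h4, h5, h6⟩ := hcut ι v X A hv hX hXv hA p hp0
    (fun h => min_le_left _ _) r hr hps
  have hane : ∀ i k, a i k ≠ 0 := fun i k h0 => by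
    have := h1 i k
    rw [h0, norm_zero] at this
    exact zero_ne_one this
  choose n b g1 g2 g3 g4 g5 g6 using fun i => href ι v hv p hp0 (a i) (hane i) (h5 i)
  set e : Fin (Fintype.card (Σ i, Fin (n i))) ≃ (Σ i, Fin (n i)) := (Fintype.equivFin _).symm
  refine ⟨Fintype.card (Σ i, Fin (n i)), fun q => b (e q).1 (e q).2, fun q k => g1 _ _ _, ?_,
    fun q => ?_, fun q q' hq => ?_, fun q x hx => h5 _ _ (g5 _ _ hx), fun x hx x' hx' h0 hs => ?_⟩
  · rw [Fintype.card_sigma]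
    push_cast
    simp only [Fintype.card_fin]
    calc ∑ i, (n i : ℝ) ≤ ∑ i, C₂ * Real.exp ((∑ h with Crosses (a i) (dotL (v h)), p h) / 2) :=
          Finset.sum_le_sum fun i _ => g2 i
      _ = C₂ * ∑ i, Real.exp ((∑ h with Crosses (a i) (dotL (v h)), p h) / 2) := by
          rw [Finset.mul_sum]
      _ ≤ C₂ * (C₁ * A * (r ^ (d - 1) * (1 + Real.log r))) := mul_le_mul_of_nonneg_left h2 hC₂
      _ = _ := by ring
  · have h7 : ∀ h, Crosses (b (e q).1 (e q).2) (dotL (v h)) → w h = W / r * p h := by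
      rintro h ⟨x, hx, hx0⟩
      have h9 : p h ≠ 1 := fun h9 => h3 (e q).1 h h9 ⟨x, g5 _ _ hx, hx0⟩
      have h10 : p h = r * w h / W := by
        rcases min_choice 1 (r * w h / W) with h' | h'
        · exact absurd h' h9
        · exact h'
      rw [h10]; field_simp
    rw [Finset.sum_congr rfl fun h hh => h7 h (Finset.mem_filter.1 hh).2, ← Finset.mul_sum]
    calc W / r * _ ≤ W / r * 1 := mul_le_mul_of_nonneg_left (g3 _ _) (by positivity)
      _ = W / r := mul_one _
  · have hne : e q ≠ e q' := fun h => hq (e.injective h)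
    dsimp only
    generalize e q = s at hne ⊢
    generalize e q' = s' at hne ⊢
    obtain ⟨i, j⟩ := s
    obtain ⟨i', j'⟩ := s'
    by_cases hi : i = i'
    · subst hi
      exact g4 i j j' fun h => hne (by rw [h])
    · exact (h4 i i' hi).mono (g5 i j) (g5 i' j')
  · obtain ⟨i, hi⟩ := h6 x hx x' hx' h0 hs
    obtain ⟨j, hj⟩ := g6 i x' hx' hi fun h h' => by
      have := hs h
      rw [h', mul_zero] at this
      exact lt_irrefl _ this
    refine ⟨e.symm ⟨i, j⟩, ?_⟩
    dsimp only
    rw [e.apply_symm_apply]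
    exact hj

section Homogenization

variable {d : ℕ}

/-- The sign vector encoded by `s`. -/
def sgn (s : Fin d → Bool) (i : Fin d) : ℝ := if s i then 1 else -1

theorem sgn_mul_self (s : Fin d → Bool) (i : Fin d) : sgn s i * sgn s i = 1 := by
  unfold sgn; split_ifs <;> norm_num

/-- Homogeneous coordinates, reflected so that the orthant of `s` becomes positive. -/
def lift (s : Fin d → Bool) (x : EuclideanSpace ℝ (Fin d)) : Fin (d + 1) → ℝ :=
  Fin.cons 1 fun i => sgn s i * x i

/-- The covector of the affine function `x ↦ ⟪x, u⟫ - β` in reflected homogeneous coordinates. -/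
def covec (s : Fin d → Bool) (u : EuclideanSpace ℝ (Fin d)) (β : ℝ) : Fin (d + 1) → ℝ :=
  Fin.cons (-β) fun i => sgn s i * u i

theorem covec_dotProduct_lift (s : Fin d → Bool) (u x : EuclideanSpace ℝ (Fin d)) (β : ℝ) :
    covec s u β ⬝ᵥ lift s x = ⟪x, u⟫ - β := by
  have h1 : ∀ i, sgn s i * u i * (sgn s i * x i) = u i * x i := fun i => by
    calc sgn s i * u i * (sgn s i * x i) = sgn s i * sgn s i * (u i * x i) := by ring
      _ = u i * x i := by rw [sgn_mul_self, one_mul]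
  simp only [covec, lift, dotProduct, Fin.sum_univ_succ, Fin.cons_zero, Fin.cons_succ, h1]
  rw [PiLp.inner_apply]
  simp only [RCLike.inner_apply, conj_trivial]
  ring

theorem covec_ne_zero (s : Fin d → Bool) {u : EuclideanSpace ℝ (Fin d)} (hu : u ≠ 0) (β : ℝ) :
    covec s u β ≠ 0 := by
  intro h
  refine hu ?_
  ext i
  have h1 := congrFun h i.succ
  simp only [covec, Fin.cons_succ, Pi.zero_apply] at h1
  have h2 : sgn s i ≠ 0 := fun h0 => by have := sgn_mul_self s i; rw [h0] at this; simp at this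
  simpa using (mul_eq_zero.1 h1).resolve_left h2

/-- The normal vector of the halfspace cut out by the homogeneous row `c`. -/
def rowNormal (s : Fin d → Bool) (c : Fin (d + 1) → ℝ) : EuclideanSpace ℝ (Fin d) :=
  WithLp.toLp 2 fun i => -(sgn s i * c i.succ)

theorem dotProduct_lift (s : Fin d → Bool) (c : Fin (d + 1) → ℝ) (x : EuclideanSpace ℝ (Fin d)) :
    c ⬝ᵥ lift s x = c 0 - ⟪x, rowNormal s c⟫ := by
  simp only [lift, dotProduct, Fin.sum_univ_succ, Fin.cons_zero, Fin.cons_succ, rowNormal]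
  rw [PiLp.inner_apply]
  simp only [RCLike.inner_apply, conj_trivial]
  rw [mul_one, sub_eq_add_neg, ← Finset.sum_neg_distrib]
  congr 1
  exact Finset.sum_congr rfl fun i _ => by ring

theorem apply_zero_ne_zero {s : Fin d → Bool} {c : Fin (d + 1) → ℝ} (hc : c ≠ 0)
    (h : rowNormal s c = 0) : c 0 ≠ 0 := by
  intro h0
  refine hc ?_
  ext k
  refine Fin.cases h0 (fun i => ?_) k
  have h1 : sgn s i * c i.succ = 0 := by
    have := congrArg (fun x : EuclideanSpace ℝ (Fin d) => x i) h
    simpa [rowNormal] using this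
  have h2 : sgn s i ≠ 0 := fun h0 => by have := sgn_mul_self s i; rw [h0] at this; simp at this
  exact (mul_eq_zero.1 h1).resolve_left h2

/-- The affine piece of a homogeneous cone. -/
def piece (s : Fin d → Bool) (a : Fin (d + 1) → Fin (d + 1) → ℝ) : Set (EuclideanSpace ℝ (Fin d)) :=
  {x | lift s x ∈ closedCone a}

theorem piece_eq_iInter {s : Fin d → Bool} {a : Fin (d + 1) → Fin (d + 1) → ℝ}
    (hne : (piece s a).Nonempty) : ∃ S : Finset (EuclideanSpace ℝ (Fin d) × ℝ),
      S.card ≤ d + 1 ∧ (∀ p ∈ S, p.1 ≠ 0) ∧ piece s a = ⋂ p ∈ S, halfspace p.1 p.2 := by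
  refine ⟨(Finset.univ.filter fun k => rowNormal s (a k) ≠ 0).image fun k =>
    (rowNormal s (a k), a k 0), ?_, fun p hp => ?_, ?_⟩
  · refine Finset.card_image_le.trans ((Finset.card_filter_le _ _).trans ?_)
    simp
  · obtain ⟨k, hk, rfl⟩ := Finset.mem_image.1 hp
    exact (Finset.mem_filter.1 hk).2
  · ext x
    simp only [Set.mem_iInter]
    constructor
    · intro hx p hp
      obtain ⟨k, hk, rfl⟩ := Finset.mem_image.1 hp
      have := hx k
      rw [dotProduct_lift] at this
      exact sub_nonneg.1 this
    · intro hx k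
      rw [dotProduct_lift]
      by_cases hk : rowNormal s (a k) = 0
      · obtain ⟨y, hy⟩ := hne
        have := hy k
        rw [dotProduct_lift] at this
        simpa [hk] using this
      · have h1 := hx (rowNormal s (a k), a k 0)
          (Finset.mem_image.2 ⟨k, Finset.mem_filter.2 ⟨Finset.mem_univ k, hk⟩, rfl⟩)
        exact sub_nonneg.2 h1

theorem lift_mem_openCone {s : Fin d → Bool} {a : Fin (d + 1) → Fin (d + 1) → ℝ}
    (ha : ∀ k, a k ≠ 0) {x : EuclideanSpace ℝ (Fin d)} (hx : x ∈ interior (piece s a)) :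
    lift s x ∈ openCone a := by
  intro k
  have hx0 : 0 ≤ a k ⬝ᵥ lift s x := interior_subset hx k
  refine lt_of_le_of_ne hx0 fun h0 => ?_
  rw [dotProduct_lift] at h0
  by_cases hk : rowNormal s (a k) = 0
  · rw [hk, inner_zero_right, sub_zero] at h0
    exact apply_zero_ne_zero (ha k) hk h0.symm
  · set u := rowNormal s (a k) with hu
    have ht : Filter.Tendsto (fun t : ℝ => x + t • u) (nhds 0) (nhds (x + (0 : ℝ) • u)) :=
      Continuous.tendsto (by fun_prop) 0
    have hev : ∀ᶠ t : ℝ in nhds 0, x + t • u ∈ piece s a := by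
      refine ht ?_
      rw [zero_smul, add_zero]
      exact mem_interior_iff_mem_nhds.1 hx
    obtain ⟨ε, hε, hball⟩ := Metric.eventually_nhds_iff.1 hev
    have h1 := hball (y := ε / 2) (by simp [abs_of_pos hε]; linarith) k
    rw [dotProduct_lift, ← hu, inner_add_left, real_inner_smul_left] at h1
    have h2 : 0 < ε / 2 * ⟪u, u⟫ := mul_pos (by linarith) (real_inner_self_pos.2 hk)
    linarith

end Homogenization

/-- The cell of `x` in an arrangement of hyperplanes. -/
def cell {d : ℕ} {ι : Type*} [Fintype ι] (a : ι → EuclideanSpace ℝ (Fin d)) (b : ι → ℝ)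
    (x : EuclideanSpace ℝ (Fin d)) : Set (EuclideanSpace ℝ (Fin d)) :=
  face a b ∅ (Finset.univ.filter fun h => b h < ⟪x, a h⟫)

theorem mem_cell {d : ℕ} {ι : Type*} [Fintype ι] {a : ι → EuclideanSpace ℝ (Fin d)} {b : ι → ℝ}
    {x y : EuclideanSpace ℝ (Fin d)} (hx : ∀ h, ⟪x, a h⟫ ≠ b h) :
    y ∈ cell a b x ↔ ∀ h, 0 < (⟪x, a h⟫ - b h) * (⟪y, a h⟫ - b h) := by
  constructor
  · intro hy h
    have h1 := hy.2 h (by simp)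
    simp only [Finset.mem_filter, Finset.mem_univ, true_and] at h1
    rcases lt_or_gt_of_ne (hx h) with h2 | h2
    · exact mul_pos_of_neg_of_neg (sub_neg.2 h2) (sub_neg.2 (h1.2 (not_lt.2 h2.le)))
    · exact mul_pos (sub_pos.2 h2) (sub_pos.2 (h1.1 h2))
  · intro hy
    refine ⟨by simp, fun h _ => ?_⟩
    simp only [Finset.mem_filter, Finset.mem_univ, true_and]
    refine ⟨fun h1 => ?_, fun h1 => ?_⟩
    · exact sub_pos.1 (pos_of_mul_pos_right (hy h) (sub_pos.2 h1).le)
    · exact sub_neg.1 (neg_of_mul_pos_right (hy h) (sub_nonpos.2 (not_lt.1 h1)))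

theorem patterns_zone_le {d D : ℕ} (hD : d = D + 1) {ι : Type*} [Fintype ι]
    (a : ι → EuclideanSpace ℝ (Fin d)) (b : ι → ℝ) {K : Set (EuclideanSpace ℝ (Fin d))}
    (hK : Convex ℝ K) (s : Fin d → Bool) (X : Finset (Fin (d + 1) → ℝ))
    (hX : ∀ y ∈ X, ∃ x, y = lift s x ∧ (∀ h, ⟪x, a h⟫ ≠ b h) ∧
      (closure (cell a b x) ∩ frontier K).Nonempty) (R : Finset ι) :
    (patterns (fun h => dotL (covec s (a h) (b h))) X R).card ≤
      2 * ((D + 1) * (R.card + 1) ^ D * 2 ^ (D + 1)) := by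
  set 𝓣 : Finset (Finset R) := X.image fun y => Finset.univ.filter fun h : R =>
    0 < covec s (a h) (b h) ⬝ᵥ y with h𝓣
  have hle : (patterns (fun h => dotL (covec s (a h) (b h))) X R).card ≤ 𝓣.card := by
    refine (Finset.card_le_card (t := 𝓣.image fun t => t.map (Function.Embedding.subtype _))
      fun t ht => ?_).trans Finset.card_image_le
    obtain ⟨y, hy, rfl⟩ := mem_patterns.1 ht
    refine Finset.mem_image.2 ⟨_, Finset.mem_image_of_mem _ hy, ?_⟩
    ext h
    rw [posSet, Finset.mem_filter]
    simp [and_comm]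
  refine hle.trans ?_
  have := card_zone_le (E := EuclideanSpace ℝ (Fin d)) (ι := R) (D := D) (by simp [hD]) hK
    (fun h => a h) (fun h => b h) 𝓣 (fun t ht => by
      obtain ⟨y, hy, rfl⟩ := Finset.mem_image.1 ht
      obtain ⟨x, rfl, hx, hz⟩ := hX y hy
      refine hz.mono (Set.inter_subset_inter_left _ (closure_mono fun z hzc => ?_))
      refine ⟨by simp, fun h _ => ?_⟩
      have h1 := hzc.2 h (by simp)
      simp only [Finset.mem_filter, Finset.mem_univ, true_and] at h1 ⊢
      rw [covec_dotProduct_lift, sub_pos]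
      exact h1)
  simpa using this

theorem exists_orthant_point {d : ℕ} {U : Set (EuclideanSpace ℝ (Fin d))} (hU : IsOpen U)
    {y : EuclideanSpace ℝ (Fin d)} (hy : y ∈ U) : ∃ (s : Fin d → Bool) (z : EuclideanSpace ℝ (Fin d)),
      z ∈ U ∧ (∀ i, 0 < sgn s i * z i) ∧ ∀ i, 0 ≤ sgn s i * y i := by
  set u : EuclideanSpace ℝ (Fin d) := WithLp.toLp 2 fun i => if y i = 0 then 1 else 0 with hu
  have ht : Filter.Tendsto (fun t : ℝ => y + t • u) (nhds 0) (nhds (y + (0 : ℝ) • u)) :=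
    Continuous.tendsto (by fun_prop) 0
  have hev : ∀ᶠ t : ℝ in nhds 0, y + t • u ∈ U := by
    refine ht ?_
    rw [zero_smul, add_zero]
    exact hU.mem_nhds hy
  obtain ⟨ε, hε, hball⟩ := Metric.eventually_nhds_iff.1 hev
  refine ⟨fun i => decide (0 ≤ y i), y + (ε / 2) • u,
    hball (y := ε / 2) (by simp [abs_of_pos hε]; linarith), fun i => ?_, fun i => ?_⟩
  · by_cases h0 : y i = 0
    · simp [sgn, hu, h0, hε]
    · rcases lt_or_gt_of_ne h0 with h1 | h1
      · simp [sgn, hu, h0, not_le.2 h1, h1]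
      · simp [sgn, hu, h0, h1, h1.le]
  · by_cases h0 : 0 ≤ y i
    · simp [sgn, h0]
    · simp [sgn, h0, (not_le.1 h0).le]

/-- The weighted cutting lemma for the zone of a convex set, for indexed families. -/
theorem exists_zone_cutting {d : ℕ} (hd : 3 ≤ d) : ∃ C : ℝ, 0 ≤ C ∧
    ∀ (ι : Type) [Fintype ι] (a : ι → EuclideanSpace ℝ (Fin d)) (b : ι → ℝ), (∀ h, a h ≠ 0) →
    ∀ w : ι → ℝ, (∀ h, 0 ≤ w h) → 0 < ∑ h, w h → ∀ r : ℝ, 1 ≤ r →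
    ∀ K : Set (EuclideanSpace ℝ (Fin d)), Convex ℝ K →
    ∃ (m : ℕ) (Δ : Fin m → Set (EuclideanSpace ℝ (Fin d))),
      (m : ℝ) ≤ C * (r ^ (d - 1) * (1 + Real.log r)) ∧
      (∀ i, ∃ S : Finset (EuclideanSpace ℝ (Fin d) × ℝ),
        S.card ≤ d + 1 ∧ (∀ p ∈ S, p.1 ≠ 0) ∧
        Δ i = (⋂ p ∈ S, halfspace p.1 p.2) ∧ (Δ i).Nonempty) ∧
      (∀ i j, i ≠ j → interior (Δ i) ∩ interior (Δ j) = ∅) ∧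
      (∀ x, (∀ h, ⟪x, a h⟫ ≠ b h) → (closure (cell a b x) ∩ frontier K).Nonempty →
        cell a b x ⊆ ⋃ i, Δ i) ∧
      ∀ i, ∑ h with (hyperplane (a h) (b h) ∩ interior (Δ i)).Nonempty, w h ≤ (∑ h, w h) / r := by
  obtain ⟨D, rfl⟩ : ∃ D, d = D + 1 := ⟨d - 1, by omega⟩
  set d := D + 1 with hdD
  obtain ⟨C, hC, hcut⟩ := exists_weighted_cutting_orthant hd
  set A : ℝ := 2 * ((D + 1) * 2 ^ (D + 1)) with hA
  refine ⟨2 ^ d * (C * A), by positivity, fun ι _ a b ha w hw hW r hr K hK => ?_⟩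
  have hrep := fun s : Fin d → Bool => exists_representatives
    (fun h => dotL (covec s (a h) (b h))) fun y : Fin (d + 1) → ℝ => ∃ x, y = lift s x ∧
      (∀ i, 0 < sgn s i * x i) ∧ (∀ h, ⟪x, a h⟫ ≠ b h) ∧ (closure (cell a b x) ∩ frontier K).Nonempty
  choose X hX hXr using hrep
  have hXne : ∀ s, ∀ y ∈ X s, ∀ h, covec s (a h) (b h) ⬝ᵥ y ≠ 0 := by
    intro s y hy h
    obtain ⟨x, rfl, -, hx, -⟩ := hX s y hy
    rw [covec_dotProduct_lift]
    exact sub_ne_zero.2 (hx h)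
  have hall := fun s : Fin d → Bool => hcut ι (fun h => covec s (a h) (b h)) (X s) A
    (fun h => covec_ne_zero s (ha h) _)
    (fun y hy i => by
      obtain ⟨x, rfl, hx, -⟩ := hX s y hy
      refine Fin.cases ?_ (fun j => ?_) i
      · simp [lift]
      · simpa [lift] using hx j)
    (hXne s)
    (fun R => by
      have := patterns_zone_le hdD a b hK s (X s) (fun y hy => by
        obtain ⟨x, h1, -, h2, h3⟩ := hX s y hy
        exact ⟨x, h1, h2, h3⟩) R
      have h2 : ((patterns (fun h => dotL (covec s (a h) (b h))) (X s) R).card : ℝ) ≤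
        ((2 * ((D + 1) * (R.card + 1) ^ D * 2 ^ (D + 1)) : ℕ) : ℝ) := by exact_mod_cast this
      refine h2.trans (le_of_eq ?_)
      rw [hA, show d - 1 = D by omega]
      push_cast
      ring)
    w hw hW r hr
  choose m c h1 h2 h3 h4 h5 h6 using hall
  set Q := {q : Σ s, Fin (m s) // (piece q.1 (c q.1 q.2)).Nonempty}
  set e : Fin (Fintype.card Q) ≃ Q := (Fintype.equivFin Q).symm
  refine ⟨Fintype.card Q, fun i => piece (e i).1.1 (c (e i).1.1 (e i).1.2), ?_, fun i => ?_,
    fun i j hij => ?_, fun x hx hz y hy => ?_, fun i => ?_⟩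
  · have h7 : (Fintype.card Q : ℝ) ≤ ∑ s : Fin d → Bool, (m s : ℝ) := by
      have := Fintype.card_subtype_le fun q : Σ s, Fin (m s) => (piece q.1 (c q.1 q.2)).Nonempty
      rw [Fintype.card_sigma] at this
      simp only [Fintype.card_fin] at this
      exact_mod_cast this
    refine h7.trans ((Finset.sum_le_sum fun s _ => h2 s).trans (le_of_eq ?_))
    rw [Finset.sum_const, Finset.card_univ]
    simp
    ring
  · obtain ⟨S, hS1, hS2, hS3⟩ := piece_eq_iInter (e i).2
    exact ⟨S, hS1, hS2, hS3, (e i).2⟩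
  · have hne : (e i).1 ≠ (e j).1 := fun h => hij (e.injective (Subtype.ext h))
    dsimp only
    generalize (e i).1 = q at hne ⊢
    generalize (e j).1 = q' at hne ⊢
    obtain ⟨s, k⟩ := q
    obtain ⟨s', k'⟩ := q'
    rw [Set.eq_empty_iff_forall_notMem]
    rintro x ⟨hx, hx'⟩
    have g1 := lift_mem_openCone (h1 s k) hx
    have g2 := lift_mem_openCone (h1 s' k') hx'
    have hs : s = s' := by
      funext i
      have g3 := pos_of_mem_openCone (h5 s k) g1 i.succ
      have g4 := pos_of_mem_openCone (h5 s' k') g2 i.succ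
      simp only [lift, Fin.cons_succ, sgn] at g3 g4
      cases h7 : s i <;> cases h8 : s' i <;> simp [h7, h8] at g3 g4 ⊢ <;> linarith
    subst hs
    exact Set.disjoint_left.1 (h4 s k k' fun h => hne (by rw [h])) g1 g2
  · obtain ⟨s, z, hz1, hz2, hz3⟩ := exists_orthant_point (isOpen_face_empty a b _) hy
    have hxy := (mem_cell hx).1 hy
    have hxz := (mem_cell hx).1 hz1
    have hzne : ∀ h, ⟪z, a h⟫ ≠ b h := fun h h0 => by
      have := hxz h
      rw [h0, sub_self, mul_zero] at this
      exact lt_irrefl _ this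
    have hcell : cell a b x ⊆ cell a b z := fun u hu => by
      have hxu := (mem_cell hx).1 hu
      refine (mem_cell hzne).2 fun h => ?_
      have := mul_pos (hxz h) (hxu h)
      have h8 : 0 < (⟪x, a h⟫ - b h) ^ 2 := by
        have := sub_ne_zero.2 (hx h)
        positivity
      refine pos_of_mul_pos_right (b := (⟪z, a h⟫ - b h) * (⟪u, a h⟫ - b h)) ?_ h8.le
      linarith
    obtain ⟨v, hv, hvs⟩ := hXr s (lift s z) ⟨z, rfl, hz2, hzne,
      hz.mono (Set.inter_subset_inter_left _ (closure_mono hcell))⟩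
    have hzy := (mem_cell hzne).1 (hcell hy)
    obtain ⟨k, hk⟩ := h6 s v hv (lift s y)
      (fun h0 => by have := congrFun h0 0; simp [lift] at this)
      (fun i => by
        refine Fin.cases ?_ (fun j => ?_) i
        · simp [lift]
        · simpa [lift] using hz3 j)
      (fun h => by
        have g1 := hvs h
        have g2 := hXne s v hv h
        have g3 := hzy h
        simp only [dotL_apply] at g1
        rw [covec_dotProduct_lift] at g1 ⊢
        rcases lt_or_gt_of_ne g2 with g4 | g4
        · have g5 : ¬ 0 < ⟪z, a h⟫ - b h := fun g5 => absurd (g1.2 g5) (not_lt.2 g4.le)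
          exact mul_pos_of_neg_of_neg g4 (neg_of_mul_pos_right g3 (not_lt.1 g5))
        · exact mul_pos g4 (pos_of_mul_pos_right g3 (g1.1 g4).le))
    have hkp : y ∈ piece s (c s k) := hk
    have hq : (piece s (c s k)).Nonempty := ⟨y, hkp⟩
    set q : Q := ⟨⟨s, k⟩, hq⟩
    refine Set.mem_iUnion.2 ⟨e.symm q, ?_⟩
    have hqe := e.apply_symm_apply q
    change y ∈ piece (e (e.symm q)).1.1 (c (e (e.symm q)).1.1 (e (e.symm q)).1.2)
    rw [hqe]
    exact hkp
  · refine le_trans (Finset.sum_le_sum_of_subset_of_nonneg (fun h hh => ?_) fun h _ _ => hw h)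
      (h3 (e i).1.1 (e i).1.2)
    obtain ⟨x, hx, hxi⟩ := (Finset.mem_filter.1 hh).2
    refine Finset.mem_filter.2 ⟨Finset.mem_univ h, lift _ x, lift_mem_openCone (h1 _ _) hxi, ?_⟩
    rw [dotL_apply, covec_dotProduct_lift]
    exact sub_eq_zero.2 hx

theorem connectedComponentIn_subset_cell {d : ℕ} {ι : Type*} [Fintype ι]
    {a : ι → EuclideanSpace ℝ (Fin d)} {b : ι → ℝ} {U : Set (EuclideanSpace ℝ (Fin d))}
    (hU : ∀ x ∈ U, ∀ h, ⟪x, a h⟫ ≠ b h) {x : EuclideanSpace ℝ (Fin d)} (hx : x ∈ U) :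
    connectedComponentIn U x ⊆ cell a b x := by
  intro y hy
  refine (mem_cell (hU x hx)).2 fun h => ?_
  by_contra hno
  have hcont : Continuous fun z : EuclideanSpace ℝ (Fin d) => ⟪z, a h⟫ := by fun_prop
  have hpre : IsPreconnected (connectedComponentIn U x) := isPreconnected_connectedComponentIn
  have hxm := mem_connectedComponentIn hx
  have hbad : b h ∉ (fun z : EuclideanSpace ℝ (Fin d) => ⟪z, a h⟫) '' connectedComponentIn U x := by
    rintro ⟨z, hz, hzb⟩
    exact hU z (connectedComponentIn_subset U x hz) h hzb
  rcases mul_nonpos_iff.1 (not_lt.1 hno) with ⟨g1, g2⟩ | ⟨g1, g2⟩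
  · exact hbad (hpre.intermediate_value hy hxm hcont.continuousOn ⟨sub_nonpos.1 g2, sub_nonneg.1 g1⟩)
  · exact hbad (hpre.intermediate_value hxm hy hcont.continuousOn ⟨sub_nonpos.1 g1, sub_nonneg.1 g2⟩)

end ZoneCutting

/-- Corollary 3.2, weighted Cutting Lemma for the zone of a convex set. -/
theorem weighted_cutting_lemma_zone_of_convex_set (d : ℕ) (hd : 3 ≤ d) :
    ∃ C : ℝ, 0 < C ∧
      ∀ (H : Finset (EuclideanSpace ℝ (Fin d) × ℝ)), (∀ h ∈ H, h.1 ≠ 0) →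
      ∀ w : EuclideanSpace ℝ (Fin d) × ℝ → ℝ, (∀ h ∈ H, 0 ≤ w h) →
      0 < ∑ h ∈ H, w h →
      ∀ n : ℕ, H.card = n →
      ∀ r : ℝ, 2 ≤ r → r ≤ n →
      ∀ K₀ : Set (EuclideanSpace ℝ (Fin d)), Convex ℝ K₀ →
      ∃ (m : ℕ) (Δ : Fin m → Set (EuclideanSpace ℝ (Fin d))),
        (m : ℝ) ≤ C * r ^ (d - 1) * Real.logb 2 r ∧
        (∀ i, ∃ s : Finset (EuclideanSpace ℝ (Fin d) × ℝ),
          s.card ≤ d + 1 ∧ (∀ p ∈ s, p.1 ≠ 0) ∧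
          Δ i = (⋂ p ∈ s, halfspace p.1 p.2) ∧ (Δ i).Nonempty) ∧
        (∀ i j, i ≠ j → interior (Δ i) ∩ interior (Δ j) = ∅) ∧
        (∀ x ∉ ⋃ h ∈ H, hyperplane h.1 h.2,
          (closure (connectedComponentIn (⋃ h ∈ H, hyperplane h.1 h.2)ᶜ x) ∩
              frontier K₀).Nonempty →
            connectedComponentIn (⋃ h ∈ H, hyperplane h.1 h.2)ᶜ x ⊆ ⋃ i, Δ i) ∧
        (∀ i, (∑ h ∈ H.filter (fun h => (hyperplane h.1 h.2 ∩ interior (Δ i)).Nonempty), w h)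
            ≤ (∑ h ∈ H, w h) / r) := by
  obtain ⟨C, hC, hcut⟩ := ZoneCutting.exists_zone_cutting hd
  refine ⟨2 * C + 1, by positivity, fun H hH w hw hW n _ r hr _ K hK => ?_⟩
  have hsum : ∑ h : H, w h = ∑ h ∈ H, w h := Finset.sum_coe_sort H w
  obtain ⟨m, Δ, h1, h2, h3, h4, h5⟩ := hcut H (fun h => h.1.1) (fun h => h.1.2)
    (fun h => hH h h.2) (fun h => w h) (fun h => hw h h.2) (by rwa [hsum]) r (by linarith) K hK
  refine ⟨m, Δ, ?_, h2, h3, fun x hx hz => ?_, fun i => ?_⟩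
  · refine h1.trans ?_
    have hr1 : 1 ≤ Real.logb 2 r := by
      rw [Real.le_logb_iff_rpow_le one_lt_two (by linarith)]
      simpa using hr
    have hlog : Real.log r ≤ Real.logb 2 r := by
      rw [Real.logb, le_div_iff₀ (Real.log_pos one_lt_two)]
      have g1 : Real.log 2 ≤ 1 := by linarith [Real.log_two_lt_d9]
      have g2 : 0 ≤ Real.log r := Real.log_nonneg (by linarith)
      nlinarith
    have hrp : 0 ≤ r ^ (d - 1) := pow_nonneg (by linarith) _
    calc C * (r ^ (d - 1) * (1 + Real.log r)) ≤ C * (r ^ (d - 1) * (2 * Real.logb 2 r)) := by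
          gcongr; linarith
      _ ≤ C * (r ^ (d - 1) * (2 * Real.logb 2 r)) + r ^ (d - 1) * Real.logb 2 r := by
          have : 0 ≤ r ^ (d - 1) * Real.logb 2 r := mul_nonneg hrp (by linarith)
          linarith
      _ = (2 * C + 1) * r ^ (d - 1) * Real.logb 2 r := by ring
  · have hU : ∀ y ∈ (⋃ h ∈ H, hyperplane h.1 h.2)ᶜ, ∀ h : H, ⟪y, h.1.1⟫ ≠ h.1.2 := by
      intro y hy h hyh
      exact hy (Set.mem_iUnion₂.2 ⟨h.1, h.2, hyh⟩)
    have hsub := ZoneCutting.connectedComponentIn_subset_cell hU hx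
    exact hsub.trans (h4 x (hU x hx) (hz.mono (Set.inter_subset_inter_left _ (closure_mono hsub))))
  · have h6 := h5 i
    rw [hsum] at h6
    refine le_trans (le_of_eq ?_) h6
    rw [Finset.sum_filter, Finset.sum_filter, ← Finset.sum_coe_sort H]
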